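/- For every G-bounded subset U ⊂ 𝓜 there is a constant 0 < K < ∞ such that ‖γ₁ − γ₀‖_{H^s} ≤ K · d_G(γ₁, γ₀) for all γ₀, γ₁ ∈ U. In particular, d_G is definite (d_G(γ₀,γ₁) = 0 implies γ₀ = γ₁), convergence in d_G implies convergence in H^s, and every G-bounded set is bounded in H^s. -/

import Mathlib

open MeasureTheory Real Filter Set
open scoped ENNReal Topology RealInnerProductSpace

noncomputable section

/-- Euclidean space `ℝⁿ`. -/
abbrev En (n : ℕ) : Type := EuclideanSpace ℝ (Fin n)

/-- A fundamental domain for the circle `𝕋 = ℝ/ℤ`. -/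
def I01 : Set ℝ := Set.Ico (0 : ℝ) 1

/-- The intrinsic distance on `𝕋 = ℝ/ℤ`, expressed for real representatives. -/
def dT (x y : ℝ) : ℝ := ⨅ k : ℤ, |x - y - (k : ℝ)|

/-- Supremum norm of a (periodic) function on the circle. -/
def supNorm {E : Type*} [NormedAddCommGroup E] (f : ℝ → E) : ℝ := ⨆ x : ℝ, ‖f x‖

/-- The squared Gagliardo seminorm `[v]_{H^σ}²` of a function on the circle, valued in `[0,∞]`. -/
def gagliardoSqE {E : Type*} [NormedAddCommGroup E] (σ : ℝ) (v : ℝ → E) : ℝ≥0∞ :=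
  ∫⁻ x in I01, ∫⁻ y in I01, ENNReal.ofReal (‖v y - v x‖ ^ 2 / dT x y ^ (2 * σ + 1))

/-- Membership in the Sobolev–Slobodeckij space `H^s(𝕋, ℝⁿ)`; for `s ∈ (3/2,2)` such
functions have a `C¹` representative, which we take as the defining data. -/
def InHs {n : ℕ} (s : ℝ) (u : ℝ → En n) : Prop :=
  Function.Periodic u 1 ∧ ContDiff ℝ 1 u ∧ gagliardoSqE (s - 1) (deriv u) < ⊤

/-- The squared `H^s` norm `‖u‖²_{L²} + ‖u'‖²_{L²} + [u']²_{H^{s-1}}`. -/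
def HsNormSq {n : ℕ} (s : ℝ) (u : ℝ → En n) : ℝ :=
  (∫ x in I01, ‖u x‖ ^ 2) + (∫ x in I01, ‖deriv u x‖ ^ 2) +
    (gagliardoSqE (s - 1) (deriv u)).toReal

/-- The `H^s` norm. -/
def HsNorm {n : ℕ} (s : ℝ) (u : ℝ → En n) : ℝ := Real.sqrt (HsNormSq s u)

/-- The `H^s` inner product. -/
def HsInner {n : ℕ} (s : ℝ) (u v : ℝ → En n) : ℝ :=
  (∫ x in I01, ⟪u x, v x⟫) + (∫ x in I01, ⟪deriv u x, deriv v x⟫) +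
    ∫ x in I01, ∫ y in I01,
      ⟪deriv u y - deriv u x, deriv v y - deriv v x⟫ / dT x y ^ (2 * (s - 1) + 1)

/-- The manifold `𝓜` of embedded closed curves of class `H^s`: injective (on the circle)
immersions. -/
def InM {n : ℕ} (s : ℝ) (γ : ℝ → En n) : Prop :=
  InHs s γ ∧ Set.InjOn γ I01 ∧ ∀ x, deriv γ x ≠ 0

/-- The length `L(γ)`. -/
def arcLen {n : ℕ} (γ : ℝ → En n) : ℝ := ∫ x in I01, ‖deriv γ x‖

/-- The arc-length distance `d_γ(x,y)`: the length of the shorter of the two arcs of `γ`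
between `x` and `y`. -/
def arcDist {n : ℕ} (γ : ℝ → En n) (x y : ℝ) : ℝ :=
  ⨅ k : ℤ, |∫ t in x..(y + (k : ℝ)), ‖deriv γ t‖|

/-- Derivative with respect to arc length, `D_γ u = u' / |γ'|`. -/
def Dg {n : ℕ} (γ u : ℝ → En n) (x : ℝ) : En n := ‖deriv γ x‖⁻¹ • deriv u x

/-- `𝒟_γ u (x)`, the pointwise linear map `w ↦ |γ'(x)|⁻² ⟪γ'(x), w⟫ u'(x)`. -/
def DDg {n : ℕ} (γ u : ℝ → En n) (x : ℝ) (w : En n) : En n :=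
  ((‖deriv γ x‖ ^ 2)⁻¹ * ⟪deriv γ x, w⟫) • deriv u x

/-- The operator `R^s_γ`. -/
def Rop {n : ℕ} (s : ℝ) (γ u : ℝ → En n) (x y : ℝ) : En n :=
  (‖γ y - γ x‖ ^ s)⁻¹ • (u y - u x - DDg γ u x (γ y - γ x))

/-- Density of the measure `μ_γ` with respect to `λ ⊗ λ` on `𝕋 × 𝕋`. -/
def muW {n : ℕ} (γ : ℝ → En n) (x y : ℝ) : ℝ :=
  ‖deriv γ x‖ * ‖deriv γ y‖ / ‖γ y - γ x‖

/-- Density of the measure `ν_γ` with respect to `λ ⊗ λ` on `𝕋 × 𝕋`. -/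
def nuW {n : ℕ} (γ : ℝ → En n) (x y : ℝ) : ℝ :=
  ‖deriv γ x‖ * ‖deriv γ y‖ / arcDist γ x y

/-- The tangent-point energy, valued in `[0,∞]`. -/
def EtpE {n : ℕ} (s : ℝ) (γ : ℝ → En n) : ℝ≥0∞ :=
  ∫⁻ x in I01, ∫⁻ y in I01, ENNReal.ofReal (‖Rop s γ γ x y‖ ^ 2 * muW γ x y)

/-- The tangent-point energy, real-valued (finite on `𝓜`). -/
def Etp {n : ℕ} (s : ℝ) (γ : ℝ → En n) : ℝ := (EtpE s γ).toReal

/-- `‖R^s_γ u‖²_{L²(ν_γ)}`, valued in `[0,∞]`. -/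
def RnuSqE {n : ℕ} (s : ℝ) (γ u : ℝ → En n) : ℝ≥0∞ :=
  ∫⁻ x in I01, ∫⁻ y in I01, ENNReal.ofReal (‖Rop s γ u x y‖ ^ 2 * nuW γ x y)

/-- `‖R^s_γ u‖²_{L²(ν_γ)}`, real-valued. -/
def RnuSq {n : ℕ} (s : ℝ) (γ u : ℝ → En n) : ℝ := (RnuSqE s γ u).toReal

/-- The squared `γ`-dependent seminorm `[u]²_{H^s(γ)}`, valued in `[0,∞]`. -/
def gagGammaSqE {n : ℕ} (s : ℝ) (γ u : ℝ → En n) : ℝ≥0∞ :=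
  ∫⁻ x in I01, ∫⁻ y in I01,
    ENNReal.ofReal (‖Dg γ u y - Dg γ u x‖ ^ 2 / arcDist γ x y ^ (2 * (s - 1)) * nuW γ x y)

/-- The squared `γ`-dependent seminorm `[u]²_{H^s(γ)}`, real-valued. -/
def gagGammaSq {n : ℕ} (s : ℝ) (γ u : ℝ → En n) : ℝ := (gagGammaSqE s γ u).toReal

/-- The inner product `⟨u,v⟩_{L²(γ)}`. -/
def innerL2g {n : ℕ} (γ u v : ℝ → En n) : ℝ := ∫ x in I01, ⟪u x, v x⟫ * ‖deriv γ x‖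

/-- The inner product `⟨u,v⟩_{H¹(γ)}`. -/
def innerH1g {n : ℕ} (γ u v : ℝ → En n) : ℝ :=
  ∫ x in I01, ⟪Dg γ u x, Dg γ v x⟫ * ‖deriv γ x‖

/-- The squared `γ`-dependent norm `‖u‖²_{H^s(γ)}`. -/
def HsGammaNormSq {n : ℕ} (s : ℝ) (γ u : ℝ → En n) : ℝ :=
  innerL2g γ u u + innerH1g γ u u + gagGammaSq s γ u

/-- The `γ`-dependent norm `‖u‖_{H^s(γ)}`. -/
def HsGammaNorm {n : ℕ} (s : ℝ) (γ u : ℝ → En n) : ℝ := Real.sqrt (HsGammaNormSq s γ u)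

/-- The bilinear form `B¹_γ`. -/
def B1 {n : ℕ} (s : ℝ) (γ u v : ℝ → En n) : ℝ :=
  ∫ x in I01, ∫ y in I01, ⟪Rop s γ u x y, Rop s γ v x y⟫ * muW γ x y

/-- The bilinear form `B²_γ`. -/
def B2 {n : ℕ} (s : ℝ) (γ u v : ℝ → En n) : ℝ :=
  ∫ x in I01, ∫ y in I01,
    ‖Rop s γ γ x y‖ ^ 2 * (⟪u y - u x, v y - v x⟫ / ‖γ y - γ x‖ ^ 2) * muW γ x y

/-- The bilinear form `B³_γ`. -/
def B3 {n : ℕ} (s : ℝ) (γ u v : ℝ → En n) : ℝ :=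
  ∫ x in I01, ∫ y in I01,
    ‖Rop s γ γ x y‖ ^ 2 * (⟪Dg γ u x, Dg γ v x⟫ + ⟪Dg γ u y, Dg γ v y⟫) * muW γ x y

/-- The Riemannian metric `G_γ(u,v)`. -/
def Gmet {n : ℕ} (s : ℝ) (γ u v : ℝ → En n) : ℝ :=
  2 * B1 s γ u v + (2 * s + 1) * B2 s γ u v + B3 s γ u v + innerH1g γ u v + innerL2g γ u v

/-- The distortion `distor(γ) = sup_{x ≠ y} d_γ(x,y)/|γ(y) − γ(x)|`, valued in `[0,∞]`. -/
def distorE {n : ℕ} (γ : ℝ → En n) : ℝ≥0∞ :=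
  ⨆ (x ∈ I01) (y ∈ I01) (_ : x ≠ y), ENNReal.ofReal (arcDist γ x y / ‖γ y - γ x‖)

/-- The distortion, real-valued. -/
def distor {n : ℕ} (γ : ℝ → En n) : ℝ := (distorE γ).toReal

/-- A `C¹` path `[0,1] → 𝓜 ⊂ H^s(𝕋,ℝⁿ)` (with respect to the `H^s` topology), recorded
together with its velocity field `V`. -/
structure C1Path (s : ℝ) (n : ℕ) where
  Γ : ℝ → ℝ → En n
  V : ℝ → ℝ → En n
  mem : ∀ t ∈ Set.Icc (0 : ℝ) 1, InM s (Γ t)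
  memV : ∀ t ∈ Set.Icc (0 : ℝ) 1, InHs s (V t)
  isDeriv : ∀ t ∈ Set.Icc (0 : ℝ) 1,
    Tendsto (fun h : ℝ => HsNorm s fun x => h⁻¹ • (Γ (t + h) x - Γ t x) - V t x)
      (𝓝[{h : ℝ | t + h ∈ Set.Icc (0 : ℝ) 1 ∧ h ≠ 0}] 0) (𝓝 0)
  contV : ∀ t ∈ Set.Icc (0 : ℝ) 1,
    Tendsto (fun τ : ℝ => HsNorm s fun x => V τ x - V t x) (𝓝[Set.Icc (0 : ℝ) 1] t) (𝓝 0)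

/-- Length of a path with respect to `G`. -/
def pathLen {s : ℝ} {n : ℕ} (P : C1Path s n) : ℝ :=
  ∫ t in (0 : ℝ)..1, Real.sqrt (Gmet s (P.Γ t) (P.V t) (P.V t))

/-- The path (Dirichlet) energy of a path with respect to `G`. -/
def pathEnergy {s : ℝ} {n : ℕ} (P : C1Path s n) : ℝ :=
  (1 / 2) * ∫ t in (0 : ℝ)..1, Gmet s (P.Γ t) (P.V t) (P.V t)

/-- The geodesic distance induced by `G`, valued in `[0,∞]` (`∞` if there is no path). -/
def geodDist (s : ℝ) {n : ℕ} (γ₀ γ₁ : ℝ → En n) : ℝ≥0∞ :=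
  ⨅ (P : C1Path s n) (_ : P.Γ 0 = γ₀ ∧ P.Γ 1 = γ₁), ENNReal.ofReal (pathLen P)

/-- `U ⊆ 𝓜` is bounded with respect to the geodesic distance `d_G`. -/
def GBounded (s : ℝ) {n : ℕ} (U : Set (ℝ → En n)) : Prop :=
  (∀ γ ∈ U, InM s γ) ∧
    ∃ γ₀, InM s γ₀ ∧ ∃ R : ℝ, ∀ γ ∈ U, geodDist s γ γ₀ ≤ ENNReal.ofReal R

/-- Weak convergence in the Hilbert space `H^s(𝕋,ℝⁿ)`. -/
def WeakHsTendsto {n : ℕ} (s : ℝ) (γk : ℕ → ℝ → En n) (γ : ℝ → En n) : Prop :=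
  ∀ v : ℝ → En n, InHs s v →
    Tendsto (fun k => HsInner s (γk k) v) atTop (𝓝 (HsInner s γ v))

/-- Directional derivative of `γ ↦ G_γ(u,v)` at `γ` in direction `w`. -/
def DGdir {n : ℕ} (s : ℝ) (γ w u v : ℝ → En n) : ℝ :=
  deriv (fun t : ℝ => Gmet s (fun x => γ x + t • w x) u v) 0

/-- `F'` is the derivative of the path `F` with respect to the `H^s` norm, on `S`. -/
def IsHsDerivOn {n : ℕ} (s : ℝ) (F F' : ℝ → ℝ → En n) (S : Set ℝ) : Prop :=
  ∀ t ∈ S,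
    Tendsto (fun h : ℝ => HsNorm s fun x => h⁻¹ • (F (t + h) x - F t x) - F' t x)
      (𝓝[{h : ℝ | t + h ∈ S ∧ h ≠ 0}] 0) (𝓝 0)

/-- The path `F` is continuous on `S` with respect to the `H^s` norm. -/
def HsContOn {n : ℕ} (s : ℝ) (F : ℝ → ℝ → En n) (S : Set ℝ) : Prop :=
  ∀ t ∈ S, Tendsto (fun τ : ℝ => HsNorm s fun x => F τ x - F t x) (𝓝[S] t) (𝓝 0)

/-- A solution of the geodesic initial value problem on `[0,∞)`, recorded as a triple
(position `Γ`, velocity `V`, acceleration `W`); the geodesic equation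
`Γ̈ + A_Γ(Γ̇)Γ̇ = 0` is expressed weakly via the Koszul formula for the
Christoffel operator `A`. -/
def GeodesicSol {n : ℕ} (s : ℝ) (γ₀ v₀ : ℝ → En n) (Γ V W : ℝ → ℝ → En n) : Prop :=
  (∀ t ∈ Set.Ici (0 : ℝ), InM s (Γ t) ∧ InHs s (V t) ∧ InHs s (W t)) ∧
  Γ 0 = γ₀ ∧ V 0 = v₀ ∧
  IsHsDerivOn s Γ V (Set.Ici 0) ∧ IsHsDerivOn s V W (Set.Ici 0) ∧
  HsContOn s V (Set.Ici 0) ∧ HsContOn s W (Set.Ici 0) ∧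
  ∀ t ∈ Set.Ici (0 : ℝ), ∀ w : ℝ → En n, InHs s w →
    Gmet s (Γ t) (W t) w + DGdir s (Γ t) (V t) (V t) w
      - (1 / 2) * DGdir s (Γ t) w (V t) (V t) = 0

section
lemma cs_lint {α : Type*} [MeasurableSpace α] (μ : Measure α) {f g : α → ℝ≥0∞}
    (hf : AEMeasurable f μ) (hg : AEMeasurable g μ) :
    (∫⁻ x, f x * g x ∂μ) ^ 2 ≤ (∫⁻ x, f x ^ 2 ∂μ) * (∫⁻ x, g x ^ 2 ∂μ) := by
  have h := ENNReal.lintegral_mul_le_Lp_mul_Lq μ Real.HolderConjugate.two_two hf hg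
  simp only [ENNReal.rpow_ofNat, Pi.mul_apply] at h
  calc _ ≤ ((∫⁻ x, f x ^ 2 ∂μ) ^ (1/2:ℝ) * (∫⁻ x, g x ^ 2 ∂μ) ^ (1/2:ℝ)) ^ 2 := by gcongr
    _ = _ := by
      rw [mul_pow, ← ENNReal.rpow_natCast, ← ENNReal.rpow_natCast, ← ENNReal.rpow_mul,
        ← ENNReal.rpow_mul]
      norm_num

lemma jensen_int {F : Type*} [NormedAddCommGroup F] [NormedSpace ℝ F] [CompleteSpace F]
    {g : ℝ → F} (hg : Continuous g) {a b : ℝ} (hab : a < b) (c : F) :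
    ENNReal.ofReal (b - a) * ‖c - (b - a)⁻¹ • ∫ x in a..b, g x‖ₑ ^ 2 ≤
      ∫⁻ x in Ioo a b, ‖c - g x‖ₑ ^ 2 := by
  have h0 : 0 < b - a := by linarith
  have h1 : (b - a) • (c - (b - a)⁻¹ • ∫ x in a..b, g x) = ∫ x in a..b, (c - g x) := by
    rw [intervalIntegral.integral_sub (by simp) (hg.intervalIntegrable _ _), smul_sub, smul_smul,
      mul_inv_cancel₀ h0.ne', one_smul]
    simp
  have h2 : ENNReal.ofReal (b - a) * ‖c - (b - a)⁻¹ • ∫ x in a..b, g x‖ₑ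
      ≤ ∫⁻ x in Ioo a b, ‖c - g x‖ₑ := by
    have : ENNReal.ofReal (b - a) = ‖b - a‖ₑ := by
      rw [← ofReal_norm, Real.norm_of_nonneg h0.le]
    rw [this, ← enorm_smul, h1, intervalIntegral.integral_of_le hab.le,
      integral_Ioc_eq_integral_Ioo]
    exact enorm_integral_le_lintegral_enorm _
  have h3 : (∫⁻ x in Ioo a b, ‖c - g x‖ₑ) ^ 2 ≤
      ENNReal.ofReal (b - a) * ∫⁻ x in Ioo a b, ‖c - g x‖ₑ ^ 2 := by
    have := cs_lint (volume.restrict (Ioo a b)) (f := fun _ => 1) (g := fun x => ‖c - g x‖ₑ)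
      (by fun_prop) (by
        have : Continuous (fun x => ‖c - g x‖ₑ) := by fun_prop
        exact this.measurable.aemeasurable)
    simpa using this
  have h4 := (pow_le_pow_left' h2 2).trans h3
  rw [mul_pow, pow_two (ENNReal.ofReal _), mul_assoc] at h4
  exact (ENNReal.mul_le_mul_iff_right (by simpa using h0) ENNReal.ofReal_ne_top).1 h4

lemma morrey_step {F : Type*} [NormedAddCommGroup F] [NormedSpace ℝ F] [CompleteSpace F]
    {g : ℝ → F} (hg : Continuous g) {a b a' b' p Q : ℝ} (hp : 0 < p) (hab : a < b) (hab' : a' < b')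
    (hs : Ioo a' b' ⊆ Ioo a b) (hQ0 : 0 ≤ Q)
    (hQ : ∫⁻ x in Ioo a b, ∫⁻ y in Ioo a b, ENNReal.ofReal (‖g y - g x‖ ^ 2 / |y - x| ^ p) ≤
      ENNReal.ofReal Q) :
    (b' - a') * ((b - a) * ‖(b - a)⁻¹ • (∫ x in a..b, g x) - (b' - a')⁻¹ • ∫ x in a'..b', g x‖ ^ 2)
      ≤ (b - a) ^ p * Q := by
  set m := (b - a)⁻¹ • (∫ x in a..b, g x)
  set m' := (b' - a')⁻¹ • (∫ x in a'..b', g x)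
  have h1 := jensen_int hg hab' m
  have key : ENNReal.ofReal (b' - a') * (ENNReal.ofReal (b - a) * ‖m - m'‖ₑ ^ 2) ≤
      ENNReal.ofReal ((b - a) ^ p * Q) := by
    calc ENNReal.ofReal (b' - a') * (ENNReal.ofReal (b - a) * ‖m - m'‖ₑ ^ 2)
        = ENNReal.ofReal (b - a) * (ENNReal.ofReal (b' - a') * ‖m - m'‖ₑ ^ 2) := by ring
      _ ≤ ENNReal.ofReal (b - a) * ∫⁻ x in Ioo a' b', ‖m - g x‖ₑ ^ 2 := by gcongr
      _ = ∫⁻ x in Ioo a' b', ENNReal.ofReal (b - a) * ‖g x - m‖ₑ ^ 2 := by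
          rw [lintegral_const_mul' _ _ ENNReal.ofReal_ne_top]
          simp_rw [enorm_sub_rev m]
      _ ≤ ∫⁻ x in Ioo a' b', ∫⁻ y in Ioo a b, ‖g x - g y‖ₑ ^ 2 :=
          lintegral_mono fun x => jensen_int hg hab (g x)
      _ ≤ ∫⁻ x in Ioo a b, ∫⁻ y in Ioo a b, ‖g x - g y‖ₑ ^ 2 := lintegral_mono_set hs
      _ ≤ ∫⁻ x in Ioo a b, ∫⁻ y in Ioo a b, ENNReal.ofReal ((b - a) ^ p) *
            ENNReal.ofReal (‖g y - g x‖ ^ 2 / |y - x| ^ p) := by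
          refine setLIntegral_mono' measurableSet_Ioo fun x hx =>
            setLIntegral_mono' measurableSet_Ioo fun y hy => ?_
          rw [← ofReal_norm, ← ENNReal.ofReal_pow (norm_nonneg _), ← ENNReal.ofReal_mul
            (rpow_nonneg (by linarith) _), norm_sub_rev]
          apply ENNReal.ofReal_le_ofReal
          rcases eq_or_ne x y with rfl | hne
          · simp
          have h5 : 0 < |y - x| := abs_pos.2 (sub_ne_zero.2 hne.symm)
          have h6 : |y - x| ≤ b - a := by
            rw [abs_le]; constructor <;> linarith [hx.1, hx.2, hy.1, hy.2]
          rw [← mul_div_assoc, le_div_iff₀ (by positivity), mul_comm]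
          gcongr
      _ = ENNReal.ofReal ((b - a) ^ p) * ∫⁻ x in Ioo a b, ∫⁻ y in Ioo a b,
            ENNReal.ofReal (‖g y - g x‖ ^ 2 / |y - x| ^ p) := by
          rw [← lintegral_const_mul' _ _ ENNReal.ofReal_ne_top]
          simp_rw [lintegral_const_mul' _ _ ENNReal.ofReal_ne_top]
      _ ≤ ENNReal.ofReal ((b - a) ^ p) * ENNReal.ofReal Q := by gcongr
      _ = _ := by rw [ENNReal.ofReal_mul (rpow_nonneg (by linarith) _)]
  rw [← ofReal_norm, ← ENNReal.ofReal_pow (norm_nonneg _), ← ENNReal.ofReal_mul (by linarith),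
    ← ENNReal.ofReal_mul (by linarith)] at key
  exact (ENNReal.ofReal_le_ofReal_iff (mul_nonneg (rpow_nonneg (by linarith) _) hQ0)).1 key

lemma morrey_mean {F : Type*} [NormedAddCommGroup F] [NormedSpace ℝ F] [CompleteSpace F]
    {s : ℝ} (hs : 3 / 2 < s)
    {g : ℝ → F} (hg : Continuous g) {a b x Q : ℝ} (hab : a < b) (hx : x ∈ Icc a b) (hQ0 : 0 ≤ Q)
    (hQ : ∫⁻ x in Ioo a b, ∫⁻ y in Ioo a b, ENNReal.ofReal (‖g y - g x‖ ^ 2 / |y - x| ^ (2 * s - 1))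
      ≤ ENNReal.ofReal Q) :
    ‖(b - a)⁻¹ • (∫ x in a..b, g x) - g x‖ ≤
      √(2 * ((b - a) ^ (2 * s - 3) * Q)) / (1 - √((1/2) ^ (2 * s - 3))) := by
  set l := b - a with hl
  have hl0 : 0 < l := by simp only [hl]; linarith
  let A : ℕ → ℝ := fun k => x + (1/2)^k * (a - x)
  let B : ℕ → ℝ := fun k => x + (1/2)^k * (b - x)
  have hBA : ∀ k, B k - A k = (1/2)^k * l := fun k => by simp only [A, B, hl]; ring
  have hlt : ∀ k, A k < B k := fun k => by
    have := hBA k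
    have : 0 < (1/2:ℝ)^k * l := by positivity
    linarith
  have hle1 : ∀ k, (1/2:ℝ)^k ≤ 1 := fun k => pow_le_one₀ (by norm_num) (by norm_num)
  have hsub : ∀ k, Ioo (A k) (B k) ⊆ Ioo a b := fun k => by
    apply Ioo_subset_Ioo
    · simp only [A]; nlinarith [hle1 k, hx.1]
    · simp only [B]; nlinarith [hle1 k, hx.2]
  have hsub' : ∀ k, Ioo (A (k+1)) (B (k+1)) ⊆ Ioo (A k) (B k) := fun k => by
    have h : (0:ℝ) < (1/2)^k := by positivity
    apply Ioo_subset_Ioo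
    · simp only [A, pow_succ]; nlinarith [hx.1]
    · simp only [B, pow_succ]; nlinarith [hx.2]
  let m : ℕ → F := fun k => (B k - A k)⁻¹ • ∫ y in (A k)..(B k), g y
  set r := √((1/2:ℝ) ^ (2 * s - 3)) with hr
  have hrr : r < 1 := by
    rw [hr, Real.sqrt_lt' one_pos, one_pow]
    exact rpow_lt_one (by norm_num) (by norm_num) (by linarith)
  have hstep : ∀ k, dist (m k) (m (k+1)) ≤ √(2 * (l ^ (2 * s - 3) * Q)) * r ^ k := fun k => by
    have h := morrey_step hg (p := 2 * s - 1) (by linarith) (hlt k) (hlt (k+1)) (hsub' k) hQ0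
      (le_trans (lintegral_mono' (Measure.restrict_mono (hsub k) le_rfl)
        fun x => lintegral_mono_set (hsub k)) hQ)
    rw [dist_eq_norm]
    change (B (k+1) - A (k+1)) * ((B k - A k) * ‖m k - m (k+1)‖ ^ 2) ≤ _ at h
    rw [hBA, hBA] at h
    set z := (1/2:ℝ)^k * l with hz
    have hz0 : 0 < z := by positivity
    have e1 : (1/2:ℝ)^(k+1) * l = z / 2 := by rw [hz, pow_succ]; ring
    have e2 : z ^ (2 * s - 1) = z ^ 2 * z ^ (2 * s - 3) := by
      rw [← Real.rpow_natCast, ← Real.rpow_add hz0]; congr 1; push_cast; ring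
    rw [e1, e2] at h
    have h2 : ‖m k - m (k+1)‖ ^ 2 ≤ 2 * (z ^ (2 * s - 3) * Q) := by
      have : z^2 * ‖m k - m (k+1)‖ ^ 2 ≤ z^2 * (2 * (z ^ (2 * s - 3) * Q)) := by nlinarith
      exact le_of_mul_le_mul_left this (by positivity)
    have e3 : z ^ (2 * s - 3) = (r ^ k) ^ 2 * l ^ (2 * s - 3) := by
      rw [hz, Real.mul_rpow (by positivity) hl0.le, hr, ← pow_mul, mul_comm k 2, pow_mul,
        Real.sq_sqrt (by positivity), ← Real.rpow_natCast, ← Real.rpow_mul (by norm_num),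
        ← Real.rpow_natCast, ← Real.rpow_mul (by norm_num), mul_comm (k:ℝ)]
    have : √(2 * (l ^ (2 * s - 3) * Q)) * r ^ k = √(2 * (z ^ (2 * s - 3) * Q)) := by
      rw [e3, show 2 * ((r ^ k) ^ 2 * l ^ (2 * s - 3) * Q) = 2 * (l ^ (2 * s - 3) * Q) * (r^k)^2 by ring,
        Real.sqrt_mul (x := 2 * (l ^ (2 * s - 3) * Q)) (by positivity) ((r^k)^2),
        Real.sqrt_sq (by positivity)]
    rw [this]
    exact Real.le_sqrt_of_sq_le h2
  have htend : Tendsto m atTop (𝓝 (g x)) := by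
    rw [Metric.tendsto_atTop]
    intro ε hε
    obtain ⟨δ, hδ, hd⟩ := Metric.continuousAt_iff.1 (hg.continuousAt (x := x)) (ε/2) (by positivity)
    have ht : Tendsto (fun k : ℕ => (1/2:ℝ)^k * l) atTop (𝓝 0) := by
      simpa using (tendsto_pow_atTop_nhds_zero_of_lt_one (by norm_num : (0:ℝ) ≤ 1/2)
        (by norm_num)).mul_const l
    obtain ⟨N, hN⟩ := (ht.eventually (gt_mem_nhds hδ)).exists_forall_of_atTop
    refine ⟨N, fun k hk => ?_⟩
    have hz0 : 0 < B k - A k := by linarith [hlt k]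
    have e : m k - g x = (B k - A k)⁻¹ • ∫ y in (A k)..(B k), (g y - g x) := by
      rw [intervalIntegral.integral_sub (hg.intervalIntegrable _ _) (by simp), smul_sub]
      simp [m, smul_smul, inv_mul_cancel₀ hz0.ne']
    have hb : ‖∫ y in (A k)..(B k), (g y - g x)‖ ≤ (ε / 2) * |B k - A k| := by
      apply intervalIntegral.norm_integral_le_of_norm_le_const
      intro y hy
      rw [uIoc_of_le (hlt k).le] at hy
      rw [← dist_eq_norm]
      apply (hd _).le
      have h1 : A k ≤ x := by
        simp only [A]; nlinarith [hx.1, show (0:ℝ) < (1/2)^k by positivity]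
      have h2 : x ≤ B k := by
        simp only [B]; nlinarith [hx.2, show (0:ℝ) < (1/2)^k by positivity]
      have := hN k hk
      rw [← hBA] at this
      rw [Real.dist_eq, abs_lt]; constructor <;> linarith [hy.1, hy.2]
    rw [dist_eq_norm, e, norm_smul, norm_inv, Real.norm_of_nonneg hz0.le]
    rw [abs_of_pos hz0] at hb
    calc _ ≤ (B k - A k)⁻¹ * ((ε/2) * (B k - A k)) := by gcongr
      _ = ε/2 := by field_simp
      _ < ε := by linarith
  have := dist_le_of_le_geometric_of_tendsto₀ r _ hrr hstep htend
  rw [dist_eq_norm] at this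
  have h0 : m 0 = l⁻¹ • ∫ x in a..b, g x := by simp [m, A, B, hl]
  rwa [h0] at this

/-- Morrey's inequality, two-point form. -/
lemma morrey {s : ℝ} (hs : 3 / 2 < s) : ∃ C : ℝ, 0 < C ∧
    ∀ (F : Type) [NormedAddCommGroup F] [NormedSpace ℝ F] [CompleteSpace F]
    (g : ℝ → F) (_ : Continuous g) (a b x y Q : ℝ), a < b → x ∈ Icc a b → y ∈ Icc a b → 0 ≤ Q →
    (∫⁻ x in Ioo a b, ∫⁻ y in Ioo a b, ENNReal.ofReal (‖g y - g x‖ ^ 2 / |y - x| ^ (2 * s - 1))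
      ≤ ENNReal.ofReal Q) →
    ‖g x - g y‖ ^ 2 ≤ C * ((b - a) ^ (2 * s - 3) * Q) := by
  set r := √((1/2:ℝ) ^ (2 * s - 3)) with hr
  have hrr : 0 < 1 - r := by
    rw [sub_pos, hr, Real.sqrt_lt' one_pos, one_pow]
    exact rpow_lt_one (by norm_num) (by norm_num) (by linarith)
  refine ⟨8 / (1 - r) ^ 2, by positivity, ?_⟩
  intro F _ _ _ g hg a b x y Q hab hx hy hQ0 hQ
  have h1 := morrey_mean hs hg hab hx hQ0 hQ
  have h2 := morrey_mean hs hg hab hy hQ0 hQ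
  have h3 : ‖g x - g y‖ ≤ 2 * (√(2 * ((b - a) ^ (2 * s - 3) * Q)) / (1 - r)) := by
    set m := (b - a)⁻¹ • (∫ x in a..b, g x)
    calc ‖g x - g y‖ = ‖(m - g y) - (m - g x)‖ := by congr 1; abel
      _ ≤ ‖m - g y‖ + ‖m - g x‖ := norm_sub_le _ _
      _ ≤ _ := by linarith
  have h4 := pow_le_pow_left₀ (norm_nonneg _) h3 2
  refine h4.trans (le_of_eq ?_)
  have : 0 ≤ 2 * ((b - a) ^ (2 * s - 3) * Q) := by
    have : 0 ≤ (b - a) ^ (2 * s - 3) := rpow_nonneg (by linarith) _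
    positivity
  rw [mul_pow, div_pow, Real.sq_sqrt this]
  ring
end

section
lemma morrey_arc {s : ℝ} (hs : 3 / 2 < s) : ∃ C : ℝ, 0 < C ∧
    ∀ (F : Type) [NormedAddCommGroup F] [NormedSpace ℝ F] [CompleteSpace F]
    (f : ℝ → F) (_ : Continuous f) (w : ℝ → ℝ) (_ : Continuous w) (c : ℝ) (_ : 0 < c)
    (_ : ∀ x, c ≤ w x) (a b x y Q : ℝ), a < b → x ∈ Icc a b → y ∈ Icc a b → 0 ≤ Q →
    (∫⁻ p in Ioo a b, ∫⁻ q in Ioo a b,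
      ENNReal.ofReal (‖f q - f p‖ ^ 2 / |∫ t in p..q, w t| ^ (2 * s - 1) * (w p * w q))
      ≤ ENNReal.ofReal Q) →
    ‖f x - f y‖ ^ 2 ≤ C * ((∫ t in a..b, w t) ^ (2 * s - 3) * Q) := by
  obtain ⟨C, hC, H⟩ := morrey hs
  refine ⟨C, hC, ?_⟩
  intro F _ _ _ f hf w hw c hc hcw a b x y Q hab hx hy hQ0 hQ
  let S : ℝ → ℝ := fun z => ∫ t in (0:ℝ)..z, w t
  have hwpos : ∀ x, 0 < w x := fun x => hc.trans_le (hcw x)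
  have hS : ∀ z, HasDerivAt S (w z) z := fun z =>
    intervalIntegral.integral_hasDerivAt_right (hw.intervalIntegrable _ _)
      (hw.stronglyMeasurableAtFilter _ _) hw.continuousAt
  have hScont : Continuous S := continuous_iff_continuousAt.2 fun z => (hS z).continuousAt
  have hSdiff : ∀ p q, ∫ t in p..q, w t = S q - S p := fun p q => by
    simp only [S]
    rw [intervalIntegral.integral_interval_sub_left (hw.intervalIntegrable _ _)
      (hw.intervalIntegrable _ _)]
  have hSge : ∀ p q, p ≤ q → c * (q - p) ≤ S q - S p := fun p q hpq => by
    rw [← hSdiff]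
    have := intervalIntegral.integral_mono_on (μ := volume) (f := fun _ => c) (g := w) hpq (by simp)
      (hw.intervalIntegrable _ _) (fun x _ => hcw x)
    simp at this
    linarith
  have hmono : StrictMono S := fun p q hpq => by
    have := hSge p q hpq.le
    nlinarith
  have hsurj : Function.Surjective S := by
    apply hScont.surjective
    · apply tendsto_atTop_mono' atTop (f₁ := fun z => S 0 + c * z)
      · filter_upwards [eventually_ge_atTop (0:ℝ)] with z hz
        have := hSge 0 z hz; simp at this; linarith
      · exact tendsto_atTop_add_const_left _ _ (tendsto_id.const_mul_atTop hc)
    · apply tendsto_atBot_mono' atBot (f₁ := fun z => S 0 + c * z)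
      · filter_upwards [eventually_le_atBot (0:ℝ)] with z hz
        have := hSge z 0 hz; linarith
      · exact tendsto_atBot_add_const_left _ _ (tendsto_id.const_mul_atBot hc)
  let e : ℝ ≃o ℝ := hmono.orderIsoOfSurjective S hsurj
  have he : ∀ z, e z = S z := fun z => rfl
  have hes : ∀ z, e.symm (S z) = z := fun z => e.symm_apply_apply z
  let g : ℝ → F := fun z => f (e.symm z)
  have hg : Continuous g := hf.comp e.symm.continuous
  have himg : S '' Ioo a b = Ioo (S a) (S b) := e.image_Ioo a b
  have hcv : ∀ G : ℝ → ℝ≥0∞, ∫⁻ z in Ioo (S a) (S b), G z =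
      ∫⁻ z in Ioo a b, ENNReal.ofReal (w z) * G (S z) := fun G => by
    rw [← himg, lintegral_image_eq_lintegral_abs_deriv_mul measurableSet_Ioo
      (fun z _ => (hS z).hasDerivWithinAt) hmono.injective.injOn]
    simp_rw [abs_of_pos (hwpos _)]
  have hQ' : ∫⁻ x in Ioo (S a) (S b), ∫⁻ y in Ioo (S a) (S b),
      ENNReal.ofReal (‖g y - g x‖ ^ 2 / |y - x| ^ (2 * s - 1)) ≤ ENNReal.ofReal Q := by
    refine le_trans (le_of_eq ?_) hQ
    rw [hcv]
    refine lintegral_congr fun p => ?_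
    rw [hcv, ← lintegral_const_mul' _ _ ENNReal.ofReal_ne_top]
    refine lintegral_congr fun q => ?_
    rw [← ENNReal.ofReal_mul (hwpos _).le, ← ENNReal.ofReal_mul (hwpos _).le, hSdiff]
    simp only [g, hes]
    congr 1; ring
  have := H F g hg (S a) (S b) (S x) (S y) Q (hmono hab)
    ⟨hmono.monotone hx.1, hmono.monotone hx.2⟩ ⟨hmono.monotone hy.1, hmono.monotone hy.2⟩ hQ0 hQ'
  simp only [g, hes] at this
  rwa [hSdiff]
end

section
lemma lint_per {f : ℝ → ℝ≥0∞} (hf : Function.Periodic f 1) (a : ℝ) :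
    ∫⁻ x in Ico a (a + 1), f x = ∫⁻ x in I01, f x := by
  rw [I01, Measure.restrict_congr_set Ico_ae_eq_Ioc, Measure.restrict_congr_set Ico_ae_eq_Ioc]
  have h := (isAddFundamentalDomain_Ioc (T := 1) one_pos a volume).setLIntegral_eq
    (isAddFundamentalDomain_Ioc (T := 1) one_pos 0 volume) f (by
      rintro ⟨g, hg⟩ x
      obtain ⟨k, rfl⟩ := AddSubgroup.mem_zmultiples_iff.1 hg
      have := hf.zsmul k x
      rw [add_comm] at this
      exact this)
  simpa using h

lemma lint_per_le {f : ℝ → ℝ≥0∞} (hf : Function.Periodic f 1) {a b : ℝ} (hb : b ≤ a + 1) :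
    ∫⁻ x in Ioo a b, f x ≤ ∫⁻ x in I01, f x := by
  rw [← lint_per hf a]
  exact lintegral_mono_set (fun x hx => ⟨hx.1.le, hx.2.trans_le hb⟩)

def B1i {n : ℕ} (s : ℝ) (γ u : ℝ → En n) (x y : ℝ) : ℝ := ‖Rop s γ u x y‖ ^ 2 * muW γ x y

def B3i {n : ℕ} (s : ℝ) (γ u : ℝ → En n) (x y : ℝ) : ℝ :=
  ‖Rop s γ γ x y‖ ^ 2 * (‖Dg γ u x‖ ^ 2 + ‖Dg γ u y‖ ^ 2) * muW γ x y

def B2i {n : ℕ} (s : ℝ) (γ u : ℝ → En n) (x y : ℝ) : ℝ :=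
  ‖Rop s γ γ x y‖ ^ 2 * (‖u y - u x‖ ^ 2 / ‖γ y - γ x‖ ^ 2) * muW γ x y

def qI {n : ℕ} (s : ℝ) (γ u : ℝ → En n) (x y : ℝ) : ℝ := B1i s γ u x y + B3i s γ u x y

lemma muW_nonneg {n : ℕ} (γ : ℝ → En n) (x y : ℝ) : 0 ≤ muW γ x y := by
  unfold muW; positivity

lemma B1i_nonneg {n : ℕ} (s : ℝ) (γ u : ℝ → En n) (x y : ℝ) : 0 ≤ B1i s γ u x y :=
  mul_nonneg (by positivity) (muW_nonneg _ _ _)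
lemma B2i_nonneg {n : ℕ} (s : ℝ) (γ u : ℝ → En n) (x y : ℝ) : 0 ≤ B2i s γ u x y :=
  mul_nonneg (by positivity) (muW_nonneg _ _ _)
lemma B3i_nonneg {n : ℕ} (s : ℝ) (γ u : ℝ → En n) (x y : ℝ) : 0 ≤ B3i s γ u x y :=
  mul_nonneg (by positivity) (muW_nonneg _ _ _)
lemma qI_nonneg {n : ℕ} (s : ℝ) (γ u : ℝ → En n) (x y : ℝ) : 0 ≤ qI s γ u x y :=
  add_nonneg (B1i_nonneg _ _ _ _ _) (B3i_nonneg _ _ _ _ _)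

lemma DDg_eq {n : ℕ} (γ u : ℝ → En n) (x : ℝ) (w : En n) :
    DDg γ u x w = ⟪Dg γ γ x, w⟫ • Dg γ u x := by
  simp only [DDg, Dg, inner_smul_left, smul_smul]
  congr 1
  simp only [conj_trivial]
  ring

lemma norm_T {n : ℕ} (γ : ℝ → En n) {x : ℝ} (h : deriv γ x ≠ 0) : ‖Dg γ γ x‖ = 1 := by
  have : ‖deriv γ x‖ ≠ 0 := norm_ne_zero_iff.2 h
  simp [Dg, norm_smul, this]

lemma vec_pt {n : ℕ} (D Du ax ay Tx Ty : En n) (hTx : ‖Tx‖ = 1) (hTy : ‖Ty‖ = 1)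
    (h1 : 0 ≤ ⟪Tx, D⟫) (h2 : 0 ≤ ⟪Ty, D⟫) :
    (‖ay - ax‖ * ‖D‖) ^ 2 ≤ 4 * (‖Du - ⟪Tx, D⟫ • ax‖ ^ 2 + ‖Du - ⟪Ty, D⟫ • ay‖ ^ 2
      + (‖ax‖ * ‖D - ⟪Tx, D⟫ • Tx‖) ^ 2 + (‖ay‖ * ‖D - ⟪Ty, D⟫ • Ty‖) ^ 2) := by
  have key : ∀ T : En n, ‖T‖ = 1 → 0 ≤ ⟪T, D⟫ → |‖D‖ - ⟪T, D⟫| ≤ ‖D - ⟪T, D⟫ • T‖ := by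
    intro T hT h
    have := abs_norm_sub_norm_le D (⟪T, D⟫ • T)
    rwa [norm_smul, hT, mul_one, Real.norm_of_nonneg h] at this
  have e : ‖D‖ • (ay - ax) = (Du - ⟪Tx, D⟫ • ax) - (Du - ⟪Ty, D⟫ • ay)
      - (‖D‖ - ⟪Tx, D⟫) • ax + (‖D‖ - ⟪Ty, D⟫) • ay := by module
  have : ‖ay - ax‖ * ‖D‖ ≤ ‖Du - ⟪Tx, D⟫ • ax‖ + ‖Du - ⟪Ty, D⟫ • ay‖
      + ‖ax‖ * ‖D - ⟪Tx, D⟫ • Tx‖ + ‖ay‖ * ‖D - ⟪Ty, D⟫ • Ty‖ := by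
    have h3 : ‖ay - ax‖ * ‖D‖ = ‖‖D‖ • (ay - ax)‖ := by rw [norm_smul, norm_norm, mul_comm]
    rw [h3, e]
    have a1 := norm_add_le ((Du - ⟪Tx, D⟫ • ax) - (Du - ⟪Ty, D⟫ • ay)
      - (‖D‖ - ⟪Tx, D⟫) • ax) ((‖D‖ - ⟪Ty, D⟫) • ay)
    have a2 := norm_sub_le ((Du - ⟪Tx, D⟫ • ax) - (Du - ⟪Ty, D⟫ • ay)) ((‖D‖ - ⟪Tx, D⟫) • ax)
    have a3 := norm_sub_le (Du - ⟪Tx, D⟫ • ax) (Du - ⟪Ty, D⟫ • ay)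
    rw [norm_smul, Real.norm_eq_abs] at a1 a2
    have b1 := mul_le_mul_of_nonneg_right (key Tx hTx h1) (norm_nonneg ax)
    have b2 := mul_le_mul_of_nonneg_right (key Ty hTy h2) (norm_nonneg ay)
    linarith
  have h4 := pow_le_pow_left₀ (by positivity) this 2
  refine h4.trans ?_
  set a := ‖Du - ⟪Tx, D⟫ • ax‖
  set b := ‖Du - ⟪Ty, D⟫ • ay‖
  set c := ‖ax‖ * ‖D - ⟪Tx, D⟫ • Tx‖
  set d := ‖ay‖ * ‖D - ⟪Ty, D⟫ • Ty‖
  nlinarith [sq_nonneg (a - b), sq_nonneg (a - c), sq_nonneg (a - d), sq_nonneg (b - c),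
    sq_nonneg (b - d), sq_nonneg (c - d)]

lemma norm_Rop {n : ℕ} (s : ℝ) (γ u : ℝ → En n) (x y : ℝ) : ‖Rop s γ u x y‖ =
    (‖γ y - γ x‖ ^ s)⁻¹ * ‖(u y - u x) - ⟪Dg γ γ x, γ y - γ x⟫ • Dg γ u x‖ := by
  rw [Rop, DDg_eq, norm_smul, norm_inv, Real.norm_of_nonneg (by positivity)]

lemma norm_Rop' {n : ℕ} (s : ℝ) (γ u : ℝ → En n) (x y : ℝ) : ‖Rop s γ u y x‖ =
    (‖γ y - γ x‖ ^ s)⁻¹ * ‖(u y - u x) - ⟪Dg γ γ y, γ y - γ x⟫ • Dg γ u y‖ := by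
  rw [norm_Rop, norm_sub_rev (γ x), ← norm_neg ((u y - u x) - _)]
  congr 2
  rw [← neg_sub (γ y) (γ x), inner_neg_right]
  module

lemma pt_bound {n : ℕ} {s : ℝ} (hs : 3 / 2 < s) (γ u : ℝ → En n) (x y : ℝ)
    (hx : deriv γ x ≠ 0) (hy : deriv γ y ≠ 0)
    (h1 : 0 ≤ ⟪Dg γ γ x, γ y - γ x⟫) (h2 : 0 ≤ ⟪Dg γ γ y, γ y - γ x⟫) :
    ‖Dg γ u y - Dg γ u x‖ ^ 2 / ‖γ y - γ x‖ ^ (2 * s - 1) * (‖deriv γ x‖ * ‖deriv γ y‖) ≤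
      4 * (qI s γ u x y + qI s γ u y x) := by
  rcases eq_or_ne (γ y - γ x) 0 with h0 | h0
  · rw [h0, norm_zero, Real.zero_rpow (by linarith)]
    simp only [div_zero, zero_mul]
    have := qI_nonneg s γ u x y
    have := qI_nonneg s γ u y x
    linarith
  have hd : 0 < ‖γ y - γ x‖ := norm_pos_iff.2 h0
  have hv := vec_pt (γ y - γ x) (u y - u x) (Dg γ u x) (Dg γ u y) _ _ (norm_T γ hx) (norm_T γ hy)
    h1 h2
  have e : ‖γ y - γ x‖ ^ (2 * s - 1) = (‖γ y - γ x‖ ^ s) ^ 2 / ‖γ y - γ x‖ := by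
    rw [← Real.rpow_natCast, ← Real.rpow_mul hd.le, Real.rpow_sub_one hd.ne']
    congr 2; push_cast; ring
  unfold qI B1i B3i
  rw [norm_Rop' s γ u x y, norm_Rop' s γ γ x y, norm_Rop s γ u x y, norm_Rop s γ γ x y]
  unfold muW
  rw [norm_sub_rev (γ x), e]
  set d := ‖γ y - γ x‖
  set ds := d ^ s
  have hds : 0 < ds := by positivity
  set A := ‖Dg γ u y - Dg γ u x‖
  set n1 := ‖u y - u x - ⟪Dg γ γ x, γ y - γ x⟫ • Dg γ u x‖
  set n2 := ‖u y - u x - ⟪Dg γ γ y, γ y - γ x⟫ • Dg γ u y‖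
  set m1 := ‖γ y - γ x - ⟪Dg γ γ x, γ y - γ x⟫ • Dg γ γ x‖
  set m2 := ‖γ y - γ x - ⟪Dg γ γ y, γ y - γ x⟫ • Dg γ γ y‖
  set w1 := ‖deriv γ x‖
  set w2 := ‖deriv γ y‖
  set b1 := ‖Dg γ u x‖
  set b2 := ‖Dg γ u y‖
  have hk : 0 ≤ (ds⁻¹) ^ 2 * (w1 * w2 / d) := by positivity
  calc A ^ 2 / (ds ^ 2 / d) * (w1 * w2) = (A * d) ^ 2 * ((ds⁻¹) ^ 2 * (w1 * w2 / d)) := by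
        field_simp
    _ ≤ 4 * (n1 ^ 2 + n2 ^ 2 + (b1 * m1) ^ 2 + (b2 * m2) ^ 2) * ((ds⁻¹) ^ 2 * (w1 * w2 / d)) := by
        gcongr
    _ ≤ 4 * (n1 ^ 2 + n2 ^ 2 + m1 ^ 2 * (b1 ^ 2 + b2 ^ 2) + m2 ^ 2 * (b2 ^ 2 + b1 ^ 2))
          * ((ds⁻¹) ^ 2 * (w1 * w2 / d)) := by
        refine mul_le_mul_of_nonneg_right ?_ hk
        nlinarith [sq_nonneg (m1 * b2), sq_nonneg (m2 * b1)]
    _ = _ := by ring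
end

section
structure Reg {n : ℕ} (γ : ℝ → En n) : Prop where
  per : Function.Periodic γ 1
  c1 : ContDiff ℝ 1 γ
  imm : ∀ x, deriv γ x ≠ 0

def QE {n : ℕ} (s : ℝ) (γ u : ℝ → En n) : ℝ≥0∞ :=
  ∫⁻ x in I01, ∫⁻ y in I01, ENNReal.ofReal (qI s γ u x y)

lemma deriv_per {n : ℕ} {u : ℝ → En n} (h : Function.Periodic u 1) :
    Function.Periodic (deriv u) 1 := by
  intro x
  have : (fun y => u (y + 1)) = u := funext h
  rw [← deriv_comp_add_const, this]

lemma cont_deriv {n : ℕ} {u : ℝ → En n} (h : ContDiff ℝ 1 u) : Continuous (deriv u) :=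
  h.continuous_deriv le_rfl

lemma per_bdd {f : ℝ → ℝ} (hf : Continuous f) (hp : Function.Periodic f 1) :
    ∃ M : ℝ, ∀ x, f x ≤ M := by
  obtain ⟨M, hM⟩ := (isCompact_Icc (a := (0:ℝ)) (b := 1)).bddAbove_image hf.continuousOn
  refine ⟨M, fun x => ?_⟩
  obtain ⟨y, hy, e⟩ := hp.exists_mem_Ico₀ one_pos x
  rw [e]
  exact hM (mem_image_of_mem _ ⟨hy.1, hy.2.le⟩)

lemma per_min {f : ℝ → ℝ} (hf : Continuous f) (hp : Function.Periodic f 1) (h0 : ∀ x, 0 < f x) :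
    ∃ c : ℝ, 0 < c ∧ ∀ x, c ≤ f x := by
  obtain ⟨z, hz, hm⟩ := (isCompact_Icc (a := (0:ℝ)) (b := 1)).exists_isMinOn ⟨0, by simp⟩
    hf.continuousOn
  refine ⟨f z, h0 z, fun x => ?_⟩
  obtain ⟨y, hy, e⟩ := hp.exists_mem_Ico₀ one_pos x
  rw [e]
  exact hm ⟨hy.1, hy.2.le⟩

namespace Reg
variable {n : ℕ} {γ u : ℝ → En n}

lemma cd (h : Reg γ) : Continuous (deriv γ) := cont_deriv h.c1
lemma wpos (h : Reg γ) (x : ℝ) : 0 < ‖deriv γ x‖ := norm_pos_iff.2 (h.imm x)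

lemma cDg (h : Reg γ) (hu : ContDiff ℝ 1 u) : Continuous (Dg γ u) := by
  unfold Dg
  exact (h.cd.norm.inv₀ (fun x => (h.wpos x).ne')).smul (cont_deriv hu)

lemma low (h : Reg γ) : ∃ c : ℝ, 0 < c ∧ ∀ x, c ≤ ‖deriv γ x‖ :=
  per_min h.cd.norm (fun x => by simp only [deriv_per h.per x]) h.wpos

lemma ftc (h : Reg γ) (p q : ℝ) : γ q - γ p = ∫ r in p..q, deriv γ r := by
  rw [intervalIntegral.integral_deriv_eq_sub (fun x _ => (h.c1.differentiable one_ne_zero) x)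
    (h.cd.intervalIntegrable _ _)]

lemma dg (h : Reg γ) (x : ℝ) : deriv γ x = ‖deriv γ x‖ • Dg γ γ x := by
  rw [Dg, smul_smul, mul_inv_cancel₀ (h.wpos x).ne', one_smul]

lemma delta_le (h : Reg γ) (p q : ℝ) : ‖γ q - γ p‖ ≤ |∫ t in p..q, ‖deriv γ t‖| := by
  rw [h.ftc]
  exact intervalIntegral.norm_integral_le_abs_integral_norm

lemma inner_ge (h : Reg γ) {p q : ℝ} (hpq : p ≤ q) {v : En n}
    (hv : ∀ r ∈ Icc p q, (1 / 2 : ℝ) ≤ ⟪v, Dg γ γ r⟫) :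
    (1 / 2 : ℝ) * (∫ t in p..q, ‖deriv γ t‖) ≤ ⟪v, γ q - γ p⟫ := by
  have e : ⟪v, γ q - γ p⟫ = ∫ r in p..q, ⟪v, deriv γ r⟫ := by
    rw [h.ftc]
    exact ((innerSL ℝ v).intervalIntegral_comp_comm (h.cd.intervalIntegrable _ _)).symm
  rw [e, ← intervalIntegral.integral_const_mul]
  have c1 : Continuous (fun t => (1/2:ℝ) * ‖deriv γ t‖) := continuous_const.mul h.cd.norm
  have c2 : Continuous (fun r => ⟪v, deriv γ r⟫) := Continuous.inner continuous_const h.cd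
  refine intervalIntegral.integral_mono_on hpq (c1.intervalIntegrable _ _)
    (c2.intervalIntegrable _ _) fun r hr => ?_
  rw [h.dg r, inner_smul_right, norm_smul, norm_T γ (h.imm r), Real.norm_of_nonneg (norm_nonneg _)]
  nlinarith [hv r hr, h.wpos r]

lemma len_pos (h : Reg γ) {p q : ℝ} (hpq : p < q) : 0 < ∫ t in p..q, ‖deriv γ t‖ :=
  intervalIntegral.intervalIntegral_pos_of_pos_on (h.cd.norm.intervalIntegrable _ _)
    (fun x _ => h.wpos x) hpq

lemma T_inner (h : Reg γ) {p r : ℝ} (hT : ‖Dg γ γ p - Dg γ γ r‖ ≤ 1) :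
    (1 / 2 : ℝ) ≤ ⟪Dg γ γ p, Dg γ γ r⟫ := by
  have := norm_sub_sq_real (Dg γ γ p) (Dg γ γ r)
  rw [norm_T γ (h.imm _), norm_T γ (h.imm _)] at this
  nlinarith [norm_nonneg (Dg γ γ p - Dg γ γ r)]

lemma good_lt (h : Reg γ) {s : ℝ} (hs : 3 / 2 < s) (u : ℝ → En n) {p q : ℝ} (hpq : p < q)
    (hT : ∀ a ∈ Icc p q, ∀ b ∈ Icc p q, ‖Dg γ γ a - Dg γ γ b‖ ≤ 1) :
    0 < ‖γ q - γ p‖ ∧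
    ‖Dg γ u q - Dg γ u p‖ ^ 2 / ‖γ q - γ p‖ ^ (2 * s - 1) * (‖deriv γ p‖ * ‖deriv γ q‖) ≤
      4 * (qI s γ u p q + qI s γ u q p) := by
  have hp : p ∈ Icc p q := ⟨le_rfl, hpq.le⟩
  have hq : q ∈ Icc p q := ⟨hpq.le, le_rfl⟩
  have h1 := h.inner_ge hpq.le (v := Dg γ γ p) fun r hr => h.T_inner (hT p hp r hr)
  have h2 := h.inner_ge hpq.le (v := Dg γ γ q) fun r hr => h.T_inner (hT q hq r hr)
  have h3 := h.len_pos hpq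
  refine ⟨norm_pos_iff.2 fun h0 => ?_, pt_bound hs γ u p q (h.imm _) (h.imm _) (by linarith)
    (by linarith)⟩
  rw [h0, inner_zero_right] at h1
  linarith

lemma good_ne (h : Reg γ) {s : ℝ} (hs : 3 / 2 < s) (u : ℝ → En n) {p q : ℝ} (hpq : p ≠ q)
    (hT : ∀ a ∈ uIcc p q, ∀ b ∈ uIcc p q, ‖Dg γ γ a - Dg γ γ b‖ ≤ 1) :
    0 < ‖γ q - γ p‖ ∧
    ‖Dg γ u q - Dg γ u p‖ ^ 2 / ‖γ q - γ p‖ ^ (2 * s - 1) * (‖deriv γ p‖ * ‖deriv γ q‖) ≤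
      4 * (qI s γ u p q + qI s γ u q p) := by
  rcases lt_or_gt_of_ne hpq with hl | hl
  · rw [uIcc_of_le hl.le] at hT
    exact h.good_lt hs u hl hT
  · rw [uIcc_of_ge hl.le] at hT
    have := h.good_lt hs u hl hT
    rwa [norm_sub_rev (γ p), norm_sub_rev (Dg γ u p), mul_comm ‖deriv γ q‖,
      add_comm (qI s γ u q p)] at this

lemma perDg (h : Reg γ) (hu : Function.Periodic u 1) : Function.Periodic (Dg γ u) 1 := fun x => by
  simp only [Dg, deriv_per h.per x, deriv_per hu x]

lemma perRop1 (h : Reg γ) (hu : Function.Periodic u 1) (s x y : ℝ) :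
    Rop s γ u (x + 1) y = Rop s γ u x y := by
  simp only [Rop, DDg, deriv_per h.per x, deriv_per hu x, h.per x, hu x]

lemma perRop2 (h : Reg γ) (hu : Function.Periodic u 1) (s x y : ℝ) :
    Rop s γ u x (y + 1) = Rop s γ u x y := by
  simp only [Rop, DDg, h.per y, hu y]

lemma permu1 (h : Reg γ) (x y : ℝ) : muW γ (x + 1) y = muW γ x y := by
  simp only [muW, deriv_per h.per x, h.per x]
lemma permu2 (h : Reg γ) (x y : ℝ) : muW γ x (y + 1) = muW γ x y := by
  simp only [muW, deriv_per h.per y, h.per y]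

lemma perq1 (h : Reg γ) (hu : Function.Periodic u 1) (s x y : ℝ) :
    qI s γ u (x + 1) y = qI s γ u x y := by
  simp only [qI, B1i, B3i, h.perRop1 hu, h.perRop1 h.per, h.permu1, h.perDg hu x]
lemma perq2 (h : Reg γ) (hu : Function.Periodic u 1) (s x y : ℝ) :
    qI s γ u x (y + 1) = qI s γ u x y := by
  simp only [qI, B1i, B3i, h.perRop2 hu, h.perRop2 h.per, h.permu2, h.perDg hu y]

lemma meas_q (h : Reg γ) (hu : ContDiff ℝ 1 u) (s : ℝ) :
    Measurable (fun z : ℝ × ℝ => qI s γ u z.1 z.2) := by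
  have a1 := h.c1.continuous.measurable
  have a2 := h.cd.measurable
  have a3 := hu.continuous.measurable
  have a4 := (cont_deriv hu).measurable
  unfold qI B1i B3i Rop DDg Dg muW
  fun_prop

lemma q_swap (h : Reg γ) (hu : ContDiff ℝ 1 u) (s : ℝ) :
    ∫⁻ x in I01, ∫⁻ y in I01, ENNReal.ofReal (qI s γ u y x) = QE s γ u := by
  rw [QE, lintegral_lintegral_swap]
  exact (ENNReal.measurable_ofReal.comp ((h.meas_q hu s).comp measurable_swap)).aemeasurable

lemma q_two (h : Reg γ) (hu : ContDiff ℝ 1 u) (s : ℝ) :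
    ∫⁻ x in I01, ∫⁻ y in I01, ENNReal.ofReal (qI s γ u x y + qI s γ u y x) = 2 * QE s γ u := by
  have m := ENNReal.measurable_ofReal.comp (h.meas_q hu s)
  simp_rw [ENNReal.ofReal_add (qI_nonneg _ _ _ _ _) (qI_nonneg _ _ _ _ _)]
  have : ∀ x, ∫⁻ y in I01, (ENNReal.ofReal (qI s γ u x y) + ENNReal.ofReal (qI s γ u y x)) =
      (∫⁻ y in I01, ENNReal.ofReal (qI s γ u x y)) + ∫⁻ y in I01, ENNReal.ofReal (qI s γ u y x) :=
    fun x => lintegral_add_left (m.comp measurable_prodMk_left) _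
  simp_rw [this]
  rw [lintegral_add_left, h.q_swap hu, two_mul]
  · rfl
  · exact Measurable.lintegral_prod_right' m

/-- arcs on which the tangent is almost constant -/
lemma arc_bound (h : Reg γ) {s : ℝ} (hs : 3 / 2 < s) (hu : ContDiff ℝ 1 u)
    (hup : Function.Periodic u 1) {a b : ℝ} (hb : b ≤ a + 1)
    (hT : ∀ p ∈ Ioo a b, ∀ q ∈ Ioo a b, ‖Dg γ γ p - Dg γ γ q‖ ≤ 1) :
    ∫⁻ p in Ioo a b, ∫⁻ q in Ioo a b, ENNReal.ofReal (‖Dg γ u q - Dg γ u p‖ ^ 2 /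
      |∫ t in p..q, ‖deriv γ t‖| ^ (2 * s - 1) * (‖deriv γ p‖ * ‖deriv γ q‖)) ≤ 8 * QE s γ u := by
  calc _ ≤ ∫⁻ p in Ioo a b, ∫⁻ q in Ioo a b, 4 * ENNReal.ofReal (qI s γ u p q + qI s γ u q p) := by
        refine setLIntegral_mono' measurableSet_Ioo fun p hp =>
            setLIntegral_mono' measurableSet_Ioo fun q hq => ?_
        rw [show (4:ℝ≥0∞) = ENNReal.ofReal 4 by simp, ← ENNReal.ofReal_mul (by norm_num)]
        apply ENNReal.ofReal_le_ofReal
        rcases eq_or_ne p q with rfl | hne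
        · simp only [sub_self, norm_zero, intervalIntegral.integral_same]
          have := qI_nonneg s γ u p p
          norm_num
          linarith
        have hsub : uIcc p q ⊆ Ioo a b := fun r hr =>
          ⟨lt_of_lt_of_le (lt_min hp.1 hq.1) hr.1, lt_of_le_of_lt hr.2 (max_lt hp.2 hq.2)⟩
        obtain ⟨g1, g2⟩ := h.good_ne hs u hne fun a ha b hb => hT a (hsub ha) b (hsub hb)
        refine le_trans ?_ g2
        have := h.delta_le p q
        have : (0:ℝ) ≤ 2 * s - 1 := by linarith
        gcongr
    _ = 4 * ∫⁻ p in Ioo a b, ∫⁻ q in Ioo a b, ENNReal.ofReal (qI s γ u p q + qI s γ u q p) := by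
        rw [← lintegral_const_mul' _ _ (by simp)]
        simp_rw [lintegral_const_mul' (4:ℝ≥0∞) _ (by simp)]
    _ ≤ 4 * ∫⁻ p in I01, ∫⁻ q in I01, ENNReal.ofReal (qI s γ u p q + qI s γ u q p) := by
        refine mul_le_mul' le_rfl ?_
        refine le_trans (lintegral_mono fun p => lint_per_le (fun q => ?_) hb) ?_
        · simp only [h.perq1 hup, h.perq2 hup]
        refine lint_per_le (fun p => ?_) hb
        simp only [h.perq1 hup, h.perq2 hup]
    _ = 8 * QE s γ u := by
        rw [h.q_two hu, ← mul_assoc]; norm_num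

end Reg

lemma QE_self {n : ℕ} {γ : ℝ → En n} (h : Reg γ) (s : ℝ) : QE s γ γ = 3 * EtpE s γ := by
  rw [QE, EtpE, ← lintegral_const_mul' _ _ (by simp)]
  simp_rw [← lintegral_const_mul' (3:ℝ≥0∞) _ (by simp)]
  refine lintegral_congr fun x => lintegral_congr fun y => ?_
  rw [show (3:ℝ≥0∞) = ENNReal.ofReal 3 by simp, ← ENNReal.ofReal_mul (by norm_num)]
  simp only [qI, B1i, B3i, norm_T γ (h.imm _)]
  congr 1; ring
end

section
lemma arc_holder {s : ℝ} (hs : 3 / 2 < s) : ∃ C : ℝ, 0 < C ∧ ∀ (n : ℕ) (γ u : ℝ → En n)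
    (_ : Reg γ) (_ : ContDiff ℝ 1 u) (_ : Function.Periodic u 1) (a b H : ℝ), a < b → b ≤ a + 1 →
    (∀ p ∈ Ioo a b, ∀ q ∈ Ioo a b, ‖Dg γ γ p - Dg γ γ q‖ ≤ 1) → 0 ≤ H →
    QE s γ u ≤ ENNReal.ofReal H → ∀ x ∈ Icc a b, ∀ y ∈ Icc a b,
    ‖Dg γ u x - Dg γ u y‖ ^ 2 ≤ C * ((∫ t in a..b, ‖deriv γ t‖) ^ (2 * s - 3) * H) := by
  obtain ⟨C, hC, M⟩ := morrey_arc hs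
  refine ⟨8 * C, by positivity, ?_⟩
  intro n γ u h hu hup a b H hab hb hT hH hQ x hx y hy
  obtain ⟨c, hc, hcw⟩ := h.low
  have := M (En n) (Dg γ u) (h.cDg hu) (fun t => ‖deriv γ t‖) h.cd.norm c hc hcw a b x y (8 * H)
    hab hx hy (by positivity) (by
      refine (h.arc_bound hs hu hup hb hT).trans ?_
      rw [ENNReal.ofReal_mul (by norm_num), show ENNReal.ofReal 8 = 8 by simp]
      exact mul_le_mul' le_rfl hQ)
  linarith

lemma Reg.len_mono {n : ℕ} {γ : ℝ → En n} (h : Reg γ) {a b p : ℝ} (_ : a ≤ p) (hb : p ≤ b) :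
    (∫ t in a..p, ‖deriv γ t‖) ≤ ∫ t in a..b, ‖deriv γ t‖ := by
  rw [← intervalIntegral.integral_add_adjacent_intervals (h.cd.norm.intervalIntegrable a p)
    (h.cd.norm.intervalIntegrable p b)]
  have : 0 ≤ ∫ t in p..b, ‖deriv γ t‖ :=
    intervalIntegral.integral_nonneg hb fun _ _ => norm_nonneg _
  linarith

lemma straight {s : ℝ} (hs : 3 / 2 < s) (E0 : ℝ) (hE0 : 0 ≤ E0) : ∃ δ : ℝ, 0 < δ ∧
    ∀ (n : ℕ) (γ : ℝ → En n), Reg γ → EtpE s γ ≤ ENNReal.ofReal E0 → ∀ a b : ℝ, a < b →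
    (∫ t in a..b, ‖deriv γ t‖) ≤ δ →
    b < a + 1 ∧ ∀ p ∈ Icc a b, ∀ q ∈ Icc a b, ‖Dg γ γ p - Dg γ γ q‖ ≤ 1 := by
  obtain ⟨C, hC, AH⟩ := arc_holder hs
  have he : 0 < 2 * s - 3 := by linarith
  set θ : ℝ := 1 / (4 * (C * (3 * E0) + 1)) with hθ
  have hθ0 : 0 < θ := by positivity
  refine ⟨θ ^ (2 * s - 3)⁻¹, by positivity, ?_⟩
  intro n γ h hE a b hab hL
  have hQ : QE s γ γ ≤ ENNReal.ofReal (3 * E0) := by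
    rw [QE_self h, ENNReal.ofReal_mul (by norm_num), show ENNReal.ofReal 3 = 3 by simp]
    exact mul_le_mul' le_rfl hE
  have cT := h.cDg h.c1
  have key : ∀ p ∈ Icc a (min b (a + 1)), ‖Dg γ γ p - Dg γ γ a‖ < 1 / 2 := by
    by_contra! hcon
    let K : Set ℝ := Icc a (min b (a + 1)) ∩ {p | 1 / 2 ≤ ‖Dg γ γ p - Dg γ γ a‖}
    have hK : IsCompact K := isCompact_Icc.inter_right
      (isClosed_le continuous_const (cT.sub continuous_const).norm)
    have hne : K.Nonempty := by
      obtain ⟨p, hp, h2⟩ := hcon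
      exact ⟨p, hp, h2⟩
    obtain ⟨p, ⟨hp, hp2⟩, hmin⟩ := hK.exists_isLeast hne
    have hap : a < p := by
      rcases hp.1.lt_or_eq with h1 | h1
      · exact h1
      · subst h1
        simp only [mem_ofPred_eq, sub_self, norm_zero] at hp2
        norm_num at hp2
    have hpb := le_min_iff.1 hp.2
    have hlt : ∀ r ∈ Ioo a p, ‖Dg γ γ r - Dg γ γ a‖ < 1 / 2 := by
      intro r hr
      by_contra! h3
      exact absurd (hmin (show r ∈ K from ⟨⟨hr.1.le, hr.2.le.trans hp.2⟩, h3⟩)) (not_le.2 hr.2)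
    have := AH n γ γ h h.c1 h.per a p (3 * E0) hap hpb.2 (fun r hr q hq => by
      have e : Dg γ γ r - Dg γ γ q = (Dg γ γ r - Dg γ γ a) - (Dg γ γ q - Dg γ γ a) := by abel
      rw [e]
      have := norm_sub_le (Dg γ γ r - Dg γ γ a) (Dg γ γ q - Dg γ γ a)
      linarith [hlt r hr, hlt q hq]) (by positivity) hQ p ⟨hap.le, le_rfl⟩ a ⟨le_rfl, hap.le⟩
    have l1 : (∫ t in a..p, ‖deriv γ t‖) ^ (2 * s - 3) ≤ θ := by
      calc _ ≤ (θ ^ (2 * s - 3)⁻¹) ^ (2 * s - 3) :=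
            Real.rpow_le_rpow (h.len_pos hap).le ((h.len_mono hap.le hpb.1).trans hL) he.le
        _ = θ := Real.rpow_inv_rpow hθ0.le he.ne'
    have l2 : C * ((∫ t in a..p, ‖deriv γ t‖) ^ (2 * s - 3) * (3 * E0)) ≤ C * (θ * (3 * E0)) := by
      gcongr
    have l3 : C * (θ * (3 * E0)) < 1 / 4 := by
      rw [hθ, show C * (1 / (4 * (C * (3 * E0) + 1)) * (3 * E0)) =
        (C * (3 * E0)) / (4 * (C * (3 * E0) + 1)) by ring, div_lt_iff₀ (by positivity)]
      linarith
    have hp3 : 1 / 2 ≤ ‖Dg γ γ p - Dg γ γ a‖ := hp2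
    nlinarith
  have key2 : ∀ p ∈ Icc a (min b (a + 1)), ∀ q ∈ Icc a (min b (a + 1)),
      ‖Dg γ γ p - Dg γ γ q‖ ≤ 1 := fun r hr q hq => by
    have e : Dg γ γ r - Dg γ γ q = (Dg γ γ r - Dg γ γ a) - (Dg γ γ q - Dg γ γ a) := by abel
    rw [e]
    have := norm_sub_le (Dg γ γ r - Dg γ γ a) (Dg γ γ q - Dg γ γ a)
    linarith [key r hr, key q hq]
  have hb : b < a + 1 := by
    by_contra! hb
    rw [min_eq_right hb] at key2
    have h1 := h.inner_ge (p := a) (q := a + 1) (by linarith) (v := Dg γ γ a)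
      fun r hr => h.T_inner (key2 a ⟨le_rfl, by linarith⟩ r hr)
    have h3 := h.len_pos (show a < a + 1 by linarith)
    rw [h.per, sub_self, inner_zero_right] at h1
    linarith
  rw [min_eq_left hb.le] at key2
  exact ⟨hb, key2⟩

/-- sup bound for the arclength derivative -/
lemma sup_lemma {s : ℝ} (hs : 3 / 2 < s) (E0 : ℝ) (hE0 : 0 ≤ E0) : ∃ C : ℝ, 0 < C ∧
    ∀ (n : ℕ) (γ u : ℝ → En n), Reg γ → EtpE s γ ≤ ENNReal.ofReal E0 → ContDiff ℝ 1 u →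
    Function.Periodic u 1 → ∀ H : ℝ, 0 ≤ H → QE s γ u ≤ ENNReal.ofReal H →
    ∫⁻ x in I01, ENNReal.ofReal (‖Dg γ u x‖ ^ 2 * ‖deriv γ x‖) ≤ ENNReal.ofReal H →
    ∀ x, ‖Dg γ u x‖ ^ 2 ≤ C * H := by
  obtain ⟨C, hC, AH⟩ := arc_holder hs
  obtain ⟨δ, hδ, ST⟩ := straight hs E0 hE0
  refine ⟨2 / δ + 2 * (C * δ ^ (2 * s - 3)), by positivity, ?_⟩
  intro n γ u h hE hu hup H hH hQ hL x
  obtain ⟨c, hc, hcw⟩ := h.low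
  have cw := h.cd.norm
  -- choose y
  obtain ⟨y, hy, hxy⟩ : ∃ y, x < y ∧ (∫ t in x..y, ‖deriv γ t‖) = δ := by
    have hcont : Continuous (fun y => ∫ t in x..y, ‖deriv γ t‖) :=
      intervalIntegral.continuous_primitive (fun a b => cw.intervalIntegrable a b) x
    have hbig : δ ≤ ∫ t in x..(x + δ / c), ‖deriv γ t‖ := by
      have h0 : x ≤ x + δ / c := by have : 0 < δ / c := by positivity
                                    linarith
      calc δ = ∫ t in x..(x + δ / c), c := by
            rw [intervalIntegral.integral_const, smul_eq_mul]; field_simp; ring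
        _ ≤ _ := intervalIntegral.integral_mono_on h0 (by simp) (cw.intervalIntegrable _ _)
            fun t _ => hcw t
    obtain ⟨y, hy, e⟩ := intermediate_value_Icc (f := fun y => ∫ t in x..y, ‖deriv γ t‖)
      (show x ≤ x + δ / c by have : 0 < δ / c := by positivity
                             linarith) hcont.continuousOn
      (show δ ∈ Icc _ _ from ⟨by simp [hδ.le], hbig⟩)
    refine ⟨y, lt_of_le_of_ne hy.1 ?_, e⟩
    rintro rfl
    simp at e
    exact hδ.ne e
  obtain ⟨hy1, hT⟩ := ST n γ h hE x y hy hxy.le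
  have hold := AH n γ u h hu hup x y H hy hy1.le (fun p hp q hq => hT p (Ioo_subset_Icc_self hp) q
    (Ioo_subset_Icc_self hq)) hH hQ x ⟨le_rfl, hy.le⟩
  rw [hxy] at hold
  have ca := h.cDg hu
  have cI : Continuous (fun z => (2 * ‖Dg γ u z‖ ^ 2 + 2 * (C * (δ ^ (2 * s - 3) * H))) *
      ‖deriv γ z‖) := by fun_prop
  have cJ : Continuous (fun z => ‖Dg γ u z‖ ^ 2 * ‖deriv γ z‖) := by fun_prop
  have h1 : (∫ z in x..y, ‖Dg γ u x‖ ^ 2 * ‖deriv γ z‖) ≤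
      ∫ z in x..y, (2 * ‖Dg γ u z‖ ^ 2 + 2 * (C * (δ ^ (2 * s - 3) * H))) * ‖deriv γ z‖ := by
    refine intervalIntegral.integral_mono_on hy.le ((continuous_const.mul cw).intervalIntegrable _ _)
      (cI.intervalIntegrable _ _) fun z hz => ?_
    refine mul_le_mul_of_nonneg_right ?_ (norm_nonneg _)
    have b1 := hold z hz
    have b2 : ‖Dg γ u x‖ ≤ ‖Dg γ u z‖ + ‖Dg γ u x - Dg γ u z‖ := by
      have := norm_add_le (Dg γ u z) (Dg γ u x - Dg γ u z)
      simpa using this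
    nlinarith [norm_nonneg (Dg γ u x), sq_nonneg (‖Dg γ u z‖ - ‖Dg γ u x - Dg γ u z‖)]
  have h2 : (∫ z in x..y, ‖Dg γ u z‖ ^ 2 * ‖deriv γ z‖) ≤ H := by
    rw [intervalIntegral.integral_of_le hy.le, integral_Ioc_eq_integral_Ioo]
    have hi : IntegrableOn (fun z => ‖Dg γ u z‖ ^ 2 * ‖deriv γ z‖) (Ioo x y) :=
      (cJ.integrableOn_Icc (a := x) (b := y)).mono_set Ioo_subset_Icc_self
    rw [← ENNReal.ofReal_le_ofReal_iff hH, ofReal_integral_eq_lintegral_ofReal hi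
      (Eventually.of_forall fun z => by positivity)]
    refine le_trans (lint_per_le (fun z => ?_) hy1.le) hL
    simp only [h.perDg hup z, deriv_per h.per z]
  rw [intervalIntegral.integral_const_mul, hxy] at h1
  have h3 : ∀ k : ℝ, (∫ z in x..y, (2 * ‖Dg γ u z‖ ^ 2 + k) * ‖deriv γ z‖) =
      2 * (∫ z in x..y, ‖Dg γ u z‖ ^ 2 * ‖deriv γ z‖) + k * δ := by
    intro k
    have i1 : IntervalIntegrable (fun z => 2 * (‖Dg γ u z‖ ^ 2 * ‖deriv γ z‖)) volume x y :=
      (continuous_const.mul cJ).intervalIntegrable _ _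
    have i2 : IntervalIntegrable (fun z => k * ‖deriv γ z‖) volume x y :=
      (continuous_const.mul cw).intervalIntegrable _ _
    rw [← hxy, ← intervalIntegral.integral_const_mul, ← intervalIntegral.integral_const_mul,
      ← intervalIntegral.integral_add i1 i2]
    congr 1; funext z; ring
  rw [h3] at h1
  have h4 : ‖Dg γ u x‖ ^ 2 ≤ (2 * H + 2 * (C * (δ ^ (2 * s - 3) * H)) * δ) / δ := by
    rw [le_div_iff₀ hδ]; linarith
  refine h4.trans (le_of_eq ?_)
  field_simp
end

section
lemma dT_eq (x y : ℝ) : dT x y = |x - y - round (x - y)| := by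
  refine le_antisymm (ciInf_le ⟨0, ?_⟩ (round (x - y))) (le_ciInf fun k => round_le _ _)
  rintro _ ⟨k, rfl⟩
  exact abs_nonneg _

lemma dT_nonneg (x y : ℝ) : 0 ≤ dT x y := by rw [dT_eq]; exact abs_nonneg _

lemma dT_le (x y : ℝ) : dT x y ≤ |x - y| := by
  rw [dT_eq]; simpa using round_le (x - y) 0

lemma dT_le_half (x y : ℝ) : dT x y ≤ 1 / 2 := by rw [dT_eq]; exact abs_sub_round _

lemma dT_symm (x y : ℝ) : dT x y = dT y x := by
  unfold dT
  refine (Equiv.neg ℤ).iInf_congr fun k => ?_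
  simp only [Equiv.neg_apply, Int.cast_neg]
  rw [← abs_neg]; congr 1; ring

lemma meas_dT : Measurable (fun z : ℝ × ℝ => dT z.1 z.2) := by
  unfold dT
  exact Measurable.iInf fun k => by fun_prop

instance vol_I01 : IsProbabilityMeasure (volume.restrict I01) :=
  ⟨by simp [I01]⟩

/-- shifting to the nearest representative -/
lemma dT_shift (x y : ℝ) : ∃ k : ℤ, dT x y = |(y - k * 1) - x| := by
  refine ⟨-round (x - y), ?_⟩
  rw [dT_eq, ← abs_neg]
  congr 1; push_cast; ring

lemma gag_lemma {s : ℝ} (hs : 3 / 2 < s) (E0 l : ℝ) (hE0 : 0 ≤ E0) (hl : 0 < l) :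
    ∃ C : ℝ, 0 < C ∧
    ∀ (n : ℕ) (γ u : ℝ → En n), Reg γ → EtpE s γ ≤ ENNReal.ofReal E0 → ContDiff ℝ 1 u →
    Function.Periodic u 1 → (∀ x, l⁻¹ ≤ ‖deriv γ x‖ ∧ ‖deriv γ x‖ ≤ l) → ∀ H : ℝ, 0 ≤ H →
    QE s γ u ≤ ENNReal.ofReal H → (∀ x, ‖Dg γ u x‖ ^ 2 ≤ H) →
    gagliardoSqE (s - 1) (Dg γ u) ≤ ENNReal.ofReal (C * H) := by
  obtain ⟨δ, hδ, ST⟩ := straight hs E0 hE0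
  have he : 0 ≤ 2 * s - 1 := by linarith
  set C1 : ℝ := 4 * (l ^ (2 * s - 1) * l ^ 2) with hC1
  set C2 : ℝ := 4 / (δ / l) ^ (2 * s - 1) with hC2
  have C1p : 0 < C1 := by positivity
  have C2p : 0 < C2 := by positivity
  refine ⟨2 * C1 + C2, by positivity, ?_⟩
  intro n γ u h hE hu hup hw H hH hQ hsup
  have pt : ∀ x y, ‖Dg γ u y - Dg γ u x‖ ^ 2 / dT x y ^ (2 * (s - 1) + 1) ≤
      C1 * (qI s γ u x y + qI s γ u y x) + C2 * H := by
    intro x y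
    rw [show 2 * (s - 1) + 1 = 2 * s - 1 by ring]
    obtain ⟨k, hk⟩ := dT_shift x y
    have e1 : Dg γ u y = Dg γ u (y - k * 1) := ((h.perDg hup).sub_int_mul_eq k).symm
    have e2 : qI s γ u x y = qI s γ u x (y - k * 1) :=
      (Function.Periodic.sub_int_mul_eq (f := fun y => qI s γ u x y) (h.perq2 hup s x) k).symm
    have e3 : qI s γ u y x = qI s γ u (y - k * 1) x :=
      (Function.Periodic.sub_int_mul_eq (f := fun y => qI s γ u y x)
        (fun y => h.perq1 hup s y x) k).symm
    rw [e1, e2, e3, hk]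
    generalize y - k * 1 = z
    have q1 := qI_nonneg s γ u x z
    have q2 := qI_nonneg s γ u z x
    rcases eq_or_ne x z with rfl | hne
    · simp; positivity
    have hpos : 0 < |z - x| := abs_pos.2 (sub_ne_zero.2 hne.symm)
    rcases le_or_gt |z - x| (δ / l) with hcl | hfar
    · have hlen : |∫ t in x..z, ‖deriv γ t‖| ≤ l * |z - x| := by
        have := intervalIntegral.norm_integral_le_of_norm_le_const (a := x) (b := z)
          (f := fun t => ‖deriv γ t‖) (C := l) (fun t _ => by simpa using (hw t).2)
        simpa using this
      have hld : l * |z - x| ≤ δ := by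
        rw [le_div_iff₀ hl] at hcl; linarith
      have hst : ∀ a ∈ uIcc x z, ∀ b ∈ uIcc x z, ‖Dg γ γ a - Dg γ γ b‖ ≤ 1 := by
        rcases lt_or_gt_of_ne hne with hlt | hlt
        · rw [uIcc_of_le hlt.le]
          exact (ST n γ h hE x z hlt ((le_abs_self _).trans (hlen.trans hld))).2
        · rw [uIcc_of_ge hlt.le]
          refine (ST n γ h hE z x hlt ?_).2
          rw [intervalIntegral.integral_symm]
          exact (neg_le_abs _).trans (hlen.trans hld)
      obtain ⟨g1, g2⟩ := h.good_ne hs u hne hst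
      have d1 := (h.delta_le x z).trans hlen
      set D := ‖γ z - γ x‖
      set A := ‖Dg γ u z - Dg γ u x‖
      have d2 : D ^ (2 * s - 1) ≤ l ^ (2 * s - 1) * |z - x| ^ (2 * s - 1) := by
        rw [← Real.mul_rpow hl.le hpos.le]
        exact Real.rpow_le_rpow g1.le d1 he
      have d3 : 1 ≤ l ^ 2 * (‖deriv γ x‖ * ‖deriv γ z‖) := by
        have a1 : 1 ≤ l * ‖deriv γ x‖ := by
          have := mul_le_mul_of_nonneg_left (hw x).1 hl.le
          rwa [mul_inv_cancel₀ hl.ne'] at this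
        have a2 : 1 ≤ l * ‖deriv γ z‖ := by
          have := mul_le_mul_of_nonneg_left (hw z).1 hl.le
          rwa [mul_inv_cancel₀ hl.ne'] at this
        nlinarith
      have d4 : A ^ 2 / |z - x| ^ (2 * s - 1) ≤ l ^ (2 * s - 1) * (A ^ 2 / D ^ (2 * s - 1)) := by
        rw [← mul_div_assoc, div_le_div_iff₀ (by positivity) (by positivity)]
        nlinarith [sq_nonneg A]
      calc A ^ 2 / |z - x| ^ (2 * s - 1) ≤ l ^ (2 * s - 1) * (A ^ 2 / D ^ (2 * s - 1)) * 1 := by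
            rw [mul_one]; exact d4
        _ ≤ l ^ (2 * s - 1) * (A ^ 2 / D ^ (2 * s - 1)) *
            (l ^ 2 * (‖deriv γ x‖ * ‖deriv γ z‖)) := by gcongr
        _ = l ^ (2 * s - 1) * l ^ 2 *
            (A ^ 2 / D ^ (2 * s - 1) * (‖deriv γ x‖ * ‖deriv γ z‖)) := by ring
        _ ≤ l ^ (2 * s - 1) * l ^ 2 * (4 * (qI s γ u x z + qI s γ u z x)) := by gcongr
        _ = C1 * (qI s γ u x z + qI s γ u z x) := by rw [hC1]; ring
        _ ≤ _ := by
          have : 0 ≤ C2 * H := by positivity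
          linarith
    · have hA : ‖Dg γ u z - Dg γ u x‖ ^ 2 ≤ 4 * H := by
        have a1 := norm_sub_le (Dg γ u z) (Dg γ u x)
        nlinarith [hsup x, hsup z, norm_nonneg (Dg γ u z - Dg γ u x),
          sq_nonneg (‖Dg γ u z‖ - ‖Dg γ u x‖)]
      calc ‖Dg γ u z - Dg γ u x‖ ^ 2 / |z - x| ^ (2 * s - 1)
          ≤ 4 * H / (δ / l) ^ (2 * s - 1) := by gcongr
        _ = C2 * H := by rw [hC2]; ring
        _ ≤ _ := by
          have : 0 ≤ C1 * (qI s γ u x z + qI s γ u z x) := by positivity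
          linarith
  calc gagliardoSqE (s - 1) (Dg γ u) ≤ ∫⁻ x in I01, ∫⁻ y in I01,
      (ENNReal.ofReal C1 * ENNReal.ofReal (qI s γ u x y + qI s γ u y x)
        + ENNReal.ofReal (C2 * H)) := by
        refine lintegral_mono fun x => lintegral_mono fun y => ?_
        rw [← ENNReal.ofReal_mul C1p.le, ← ENNReal.ofReal_add]
        · exact ENNReal.ofReal_le_ofReal (pt x y)
        · have q1 := qI_nonneg s γ u x y
          have q2 := qI_nonneg s γ u y x
          positivity
        · positivity
    _ = ENNReal.ofReal C1 * (2 * QE s γ u) + ENNReal.ofReal (C2 * H) := by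
        simp_rw [lintegral_add_right _ measurable_const]
        rw [← h.q_two hu]
        simp_rw [lintegral_const_mul' _ _ ENNReal.ofReal_ne_top]
        simp
    _ ≤ ENNReal.ofReal C1 * (2 * ENNReal.ofReal H) + ENNReal.ofReal (C2 * H) := by gcongr
    _ = _ := by
        rw [show (2:ℝ≥0∞) = ENNReal.ofReal 2 by simp, ← ENNReal.ofReal_mul (by norm_num),
          ← ENNReal.ofReal_mul C1p.le, ← ENNReal.ofReal_add (by positivity) (by positivity)]
        congr 1; ring
end

section
lemma ftc_enorm {F : Type*} [NormedAddCommGroup F] [NormedSpace ℝ F] [CompleteSpace F]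
    {φ φ' : ℝ → F} (hd : ∀ t ∈ Icc (0:ℝ) 1, HasDerivWithinAt φ (φ' t) (Icc 0 1) t)
    (hc : ContinuousOn φ' (Icc 0 1)) {t0 t1 : ℝ} (h0 : t0 ∈ Icc (0:ℝ) 1) (h1 : t1 ∈ Icc (0:ℝ) 1) :
    ‖φ t1 - φ t0‖ₑ ≤ ∫⁻ t in Icc (0:ℝ) 1, ‖φ' t‖ₑ := by
  have hsub : uIcc t0 t1 ⊆ Icc 0 1 := uIcc_subset_Icc h0 h1
  have e : ∫ t in t0..t1, φ' t = φ t1 - φ t0 := by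
    refine intervalIntegral.integral_eq_sub_of_hasDeriv_right
      (fun t ht => ((hd t (hsub ht)).continuousWithinAt).mono hsub) (fun t ht => ?_)
      ((hc.mono hsub).intervalIntegrable)
    have ht' : t ∈ Ioo (0:ℝ) 1 :=
      ⟨lt_of_le_of_lt (le_min h0.1 h1.1) ht.1, lt_of_lt_of_le ht.2 (max_le h0.2 h1.2)⟩
    exact ((hd t (Ioo_subset_Icc_self ht')).hasDerivAt (Icc_mem_nhds ht'.1 ht'.2)).hasDerivWithinAt
  rw [← e]
  have : ‖∫ t in t0..t1, φ' t‖ₑ ≤ ∫⁻ t in uIoc t0 t1, ‖φ' t‖ₑ := by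
    have h2 : ‖∫ t in t0..t1, φ' t‖ₑ = ‖∫ t in uIoc t0 t1, φ' t‖ₑ := by
      rw [← ofReal_norm, ← ofReal_norm, intervalIntegral.norm_intervalIntegral_eq]
    rw [h2]
    exact enorm_integral_le_lintegral_enorm _
  exact this.trans (lintegral_mono_set (uIoc_subset_uIcc.trans hsub))

lemma mink {X : Type*} [MeasurableSpace X] (μ : Measure X) [SFinite μ] {F : Type*}
    [NormedAddCommGroup F] [NormedSpace ℝ F] [CompleteSpace F] [MeasurableSpace F]
    [BorelSpace F] (Φ Φ' : ℝ → X → F) (hm : Measurable (fun z : ℝ × X => Φ' z.1 z.2))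
    (hd : ∀ᵐ x ∂μ, ∀ t ∈ Icc (0:ℝ) 1, HasDerivWithinAt (fun t => Φ t x) (Φ' t x) (Icc 0 1) t)
    (hc : ∀ᵐ x ∂μ, ContinuousOn (fun t => Φ' t x) (Icc 0 1))
    (g : ℝ → ℝ) (hg0 : ∀ t, 0 ≤ g t) (hgm : Measurable g) (hgi : IntervalIntegrable g volume 0 1)
    {C : ℝ} (hC : 0 ≤ C)
    (hk : ∀ t ∈ Icc (0:ℝ) 1, ∫⁻ x, ‖Φ' t x‖ₑ ^ 2 ∂μ ≤ ENNReal.ofReal (C * g t ^ 2))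
    {t0 t1 : ℝ} (h0 : t0 ∈ Icc (0:ℝ) 1) (h1 : t1 ∈ Icc (0:ℝ) 1) :
    ∫⁻ x, ‖Φ t1 x - Φ t0 x‖ₑ ^ 2 ∂μ ≤ ENNReal.ofReal (C * (∫ t in (0:ℝ)..1, g t) ^ 2) := by
  set I := ∫ t in (0:ℝ)..1, g t with hI
  have hI0 : 0 ≤ I := intervalIntegral.integral_nonneg zero_le_one fun t _ => hg0 t
  have hgi' : IntegrableOn g (Icc 0 1) :=
    (intervalIntegrable_iff_integrableOn_Icc_of_le zero_le_one).1 hgi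
  have step : ∀ ε : ℝ, 0 < ε →
      ∫⁻ x, ‖Φ t1 x - Φ t0 x‖ₑ ^ 2 ∂μ ≤ ENNReal.ofReal (C * (I + ε) ^ 2) := by
    intro ε hε
    have gp : ∀ t, 0 < g t + ε := fun t => by linarith [hg0 t]
    have hG : ∫⁻ t in Icc (0:ℝ) 1, ENNReal.ofReal (g t + ε) = ENNReal.ofReal (I + ε) := by
      rw [← ofReal_integral_eq_lintegral_ofReal]
      · rw [integral_add hgi' (integrable_const _), integral_Icc_eq_integral_Ioc,
          ← intervalIntegral.integral_of_le zero_le_one]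
        simp [hI]
      · exact hgi'.add (integrable_const _)
      · exact Eventually.of_forall fun t => (gp t).le
    have cs : ∀ᵐ x ∂μ, ‖Φ t1 x - Φ t0 x‖ₑ ^ 2 ≤ ENNReal.ofReal (I + ε) *
        ∫⁻ t in Icc (0:ℝ) 1, ENNReal.ofReal ((g t + ε)⁻¹) * ‖Φ' t x‖ₑ ^ 2 := by
      filter_upwards [hd, hc] with x hdx hcx
      have a1 := ftc_enorm hdx hcx h0 h1
      have m1 : Measurable (fun t => Φ' t x) := hm.comp measurable_prodMk_right
      have a2 := cs_lint (volume.restrict (Icc (0:ℝ) 1)) (f := fun t => ENNReal.ofReal √(g t + ε))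
        (g := fun t => ENNReal.ofReal (√(g t + ε))⁻¹ * ‖Φ' t x‖ₑ)
        (by fun_prop) (by fun_prop)
      have e1 : ∀ t, ENNReal.ofReal √(g t + ε) * (ENNReal.ofReal (√(g t + ε))⁻¹ * ‖Φ' t x‖ₑ) =
          ‖Φ' t x‖ₑ := fun t => by
        have : 0 < √(g t + ε) := Real.sqrt_pos.2 (gp t)
        rw [← mul_assoc, ← ENNReal.ofReal_mul this.le, mul_inv_cancel₀ this.ne',
          ENNReal.ofReal_one, one_mul]
      have e2 : ∀ t, ENNReal.ofReal √(g t + ε) ^ 2 = ENNReal.ofReal (g t + ε) := fun t => by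
        rw [← ENNReal.ofReal_pow (Real.sqrt_nonneg _), Real.sq_sqrt (gp t).le]
      have e3 : ∀ t, (ENNReal.ofReal (√(g t + ε))⁻¹ * ‖Φ' t x‖ₑ) ^ 2 =
          ENNReal.ofReal ((g t + ε)⁻¹) * ‖Φ' t x‖ₑ ^ 2 := fun t => by
        rw [mul_pow, ← ENNReal.ofReal_pow (by positivity), inv_pow, Real.sq_sqrt (gp t).le]
      simp only [e1, e2, e3, hG] at a2
      exact (pow_le_pow_left' a1 2).trans a2
    calc _ ≤ ∫⁻ x, (ENNReal.ofReal (I + ε) *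
        ∫⁻ t in Icc (0:ℝ) 1, ENNReal.ofReal ((g t + ε)⁻¹) * ‖Φ' t x‖ₑ ^ 2) ∂μ := lintegral_mono_ae cs
      _ = ENNReal.ofReal (I + ε) * ∫⁻ t in Icc (0:ℝ) 1, ∫⁻ x,
            ENNReal.ofReal ((g t + ε)⁻¹) * ‖Φ' t x‖ₑ ^ 2 ∂μ := by
          rw [lintegral_const_mul' _ _ ENNReal.ofReal_ne_top, lintegral_lintegral_swap]
          have : Measurable (fun z : X × ℝ => Φ' z.2 z.1) := hm.comp measurable_swap
          have : Measurable (fun z : X × ℝ => ENNReal.ofReal ((g z.2 + ε)⁻¹) *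
            ‖Φ' z.2 z.1‖ₑ ^ 2) := by fun_prop
          exact this.aemeasurable
      _ ≤ ENNReal.ofReal (I + ε) * ∫⁻ t in Icc (0:ℝ) 1, ENNReal.ofReal C *
            ENNReal.ofReal (g t + ε) := by
          refine mul_le_mul' le_rfl (setLIntegral_mono' measurableSet_Icc fun t ht => ?_)
          rw [lintegral_const_mul' _ _ ENNReal.ofReal_ne_top]
          refine (mul_le_mul' le_rfl (hk t ht)).trans ?_
          rw [← ENNReal.ofReal_mul (inv_nonneg.2 (gp t).le), ← ENNReal.ofReal_mul hC]
          apply ENNReal.ofReal_le_ofReal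
          rw [inv_mul_le_iff₀ (gp t)]
          have := hg0 t
          have : g t ^ 2 ≤ (g t + ε) ^ 2 := by gcongr; linarith
          nlinarith
      _ = ENNReal.ofReal (C * (I + ε) ^ 2) := by
          rw [lintegral_const_mul' _ _ ENNReal.ofReal_ne_top, hG, ← ENNReal.ofReal_mul hC,
            ← ENNReal.ofReal_mul (by positivity)]
          congr 1; ring
  have lim : Tendsto (fun ε : ℝ => ENNReal.ofReal (C * (I + ε) ^ 2)) (𝓝[>] 0)
      (𝓝 (ENNReal.ofReal (C * I ^ 2))) := by
    have : Continuous (fun ε : ℝ => ENNReal.ofReal (C * (I + ε) ^ 2)) :=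
      ENNReal.continuous_ofReal.comp (by fun_prop)
    have h2 := (this.tendsto 0).mono_left (nhdsWithin_le_nhds (s := Ioi 0))
    simpa using h2
  exact ge_of_tendsto lim (eventually_nhdsWithin_of_forall fun ε hε => step ε hε)
end

section
lemma mean_sup {n : ℕ} {f : ℝ → En n} (hf : Continuous f) (hp : Function.Periodic f 1) {B : ℝ}
    (hB : ∀ x ∈ Icc (0:ℝ) 1, ∀ y ∈ Icc (0:ℝ) 1, ‖f x - f y‖ ^ 2 ≤ B) (x : ℝ) :
    ‖f x‖ ^ 2 ≤ 2 * (∫ y in I01, ‖f y‖ ^ 2) + 2 * B := by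
  obtain ⟨z, hz, e⟩ := hp.exists_mem_Ico₀ one_pos x
  rw [e]
  have hi : IntegrableOn (fun y => ‖f y‖ ^ 2) I01 :=
    ((hf.norm.pow 2).integrableOn_Icc (a := 0) (b := 1)).mono_set Ico_subset_Icc_self
  have h1 : ∫ y in I01, ‖f z‖ ^ 2 ≤ ∫ y in I01, (2 * ‖f y‖ ^ 2 + 2 * B) := by
    refine setIntegral_mono_on (integrable_const _) ((hi.const_mul 2).add (integrable_const _))
      measurableSet_Ico fun y hy => ?_
    have b1 := hB z ⟨hz.1, hz.2.le⟩ y ⟨hy.1, hy.2.le⟩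
    have b2 : ‖f z‖ ≤ ‖f y‖ + ‖f z - f y‖ := by
      have := norm_add_le (f y) (f z - f y)
      simpa using this
    nlinarith [norm_nonneg (f z), sq_nonneg (‖f y‖ - ‖f z - f y‖)]
  rw [integral_add (hi.const_mul 2) (integrable_const _), integral_const_mul] at h1
  simpa using h1

lemma HsNormSq_nonneg {n : ℕ} (s : ℝ) (u : ℝ → En n) : 0 ≤ HsNormSq s u := by
  unfold HsNormSq
  have a : 0 ≤ ∫ x in I01, ‖u x‖ ^ 2 := integral_nonneg fun _ => by positivity
  have b : 0 ≤ ∫ x in I01, ‖deriv u x‖ ^ 2 := integral_nonneg fun _ => by positivity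
  have c : 0 ≤ (gagliardoSqE (s - 1) (deriv u)).toReal := ENNReal.toReal_nonneg
  linarith

lemma HsNorm_sq {n : ℕ} (s : ℝ) (u : ℝ → En n) : HsNorm s u ^ 2 = HsNormSq s u :=
  Real.sq_sqrt (HsNormSq_nonneg s u)

lemma L2_le_Hs {n : ℕ} (s : ℝ) (u : ℝ → En n) : (∫ x in I01, ‖u x‖ ^ 2) ≤ HsNormSq s u := by
  unfold HsNormSq
  have b : 0 ≤ ∫ x in I01, ‖deriv u x‖ ^ 2 := integral_nonneg fun _ => by positivity
  have c : 0 ≤ (gagliardoSqE (s - 1) (deriv u)).toReal := ENNReal.toReal_nonneg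
  linarith
lemma H1_le_Hs {n : ℕ} (s : ℝ) (u : ℝ → En n) : (∫ x in I01, ‖deriv u x‖ ^ 2) ≤ HsNormSq s u := by
  unfold HsNormSq
  have b : 0 ≤ ∫ x in I01, ‖u x‖ ^ 2 := integral_nonneg fun _ => by positivity
  have c : 0 ≤ (gagliardoSqE (s - 1) (deriv u)).toReal := ENNReal.toReal_nonneg
  linarith
lemma gag_le_Hs {n : ℕ} {s : ℝ} {u : ℝ → En n} (h : InHs s u) :
    gagliardoSqE (s - 1) (deriv u) ≤ ENNReal.ofReal (HsNormSq s u) := by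
  rw [← ENNReal.ofReal_toReal h.2.2.ne]
  apply ENNReal.ofReal_le_ofReal
  unfold HsNormSq
  have a : 0 ≤ ∫ x in I01, ‖u x‖ ^ 2 := integral_nonneg fun _ => by positivity
  have b : 0 ≤ ∫ x in I01, ‖deriv u x‖ ^ 2 := integral_nonneg fun _ => by positivity
  linarith

lemma per_dT0 {E : Type*} {f : ℝ → E} (hf : Function.Periodic f 1) {x y : ℝ} (h : dT x y = 0) :
    f x = f y := by
  rw [dT_eq, abs_eq_zero] at h
  have : x = y + (round (x - y) : ℤ) * 1 := by linarith
  rw [this]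
  exact hf.int_mul _ _

lemma sobolev {s : ℝ} (hs : 3 / 2 < s) : ∃ C : ℝ, 0 < C ∧ ∀ (n : ℕ) (u : ℝ → En n), InHs s u →
    ∀ x, ‖u x‖ ^ 2 ≤ C * HsNormSq s u ∧ ‖deriv u x‖ ^ 2 ≤ C * HsNormSq s u := by
  obtain ⟨C, hC, M⟩ := morrey hs
  refine ⟨2 + 2 * (2 + 2 * C), by positivity, ?_⟩
  intro n u hu
  have N0 := HsNormSq_nonneg s u
  have cd := cont_deriv hu.2.1
  have pd := deriv_per hu.1
  have hm : ∫⁻ x in Ioo (0:ℝ) 1, ∫⁻ y in Ioo (0:ℝ) 1, ENNReal.ofReal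
      (‖deriv u y - deriv u x‖ ^ 2 / |y - x| ^ (2 * s - 1)) ≤ ENNReal.ofReal (HsNormSq s u) := by
    refine le_trans ?_ (gag_le_Hs hu)
    refine (lintegral_mono_set Ioo_subset_Ico_self).trans (lintegral_mono fun x =>
      (lintegral_mono_set Ioo_subset_Ico_self).trans (lintegral_mono fun y => ?_))
    apply ENNReal.ofReal_le_ofReal
    rw [show 2 * (s - 1) + 1 = 2 * s - 1 by ring]
    rcases (dT_nonneg x y).eq_or_lt with h0 | h0
    · rw [per_dT0 pd h0.symm]; simp
    · have := dT_le x y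
      rw [abs_sub_comm] at this
      have : 0 ≤ 2 * s - 1 := by linarith
      gcongr
  have h1 : ∀ x, ‖deriv u x‖ ^ 2 ≤ (2 + 2 * C) * HsNormSq s u := by
    intro x
    have := mean_sup cd pd (B := C * HsNormSq s u) (fun x hx y hy => by
      have := M (En n) (deriv u) cd 0 1 x y (HsNormSq s u) one_pos hx hy N0 hm
      simpa using this) x
    have := H1_le_Hs s u
    linarith
  intro x
  constructor
  · have := mean_sup hu.2.1.continuous hu.1 (B := (2 + 2 * C) * HsNormSq s u) (fun x hx y hy => by
      have l := Convex.norm_image_sub_le_of_norm_deriv_le (f := u) (s := univ) (x := y) (y := x)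
        (C := √((2 + 2 * C) * HsNormSq s u))
        (fun z _ => hu.2.1.differentiable one_ne_zero z)
        (fun z _ => Real.le_sqrt_of_sq_le (h1 z)) convex_univ (mem_univ _) (mem_univ _)
      have d : ‖x - y‖ ≤ 1 := by
        rw [Real.norm_eq_abs, abs_le]; constructor <;> linarith [hx.1, hx.2, hy.1, hy.2]
      have l2 : ‖u x - u y‖ ≤ √((2 + 2 * C) * HsNormSq s u) :=
        l.trans (mul_le_of_le_one_right (Real.sqrt_nonneg _) d)
      have := pow_le_pow_left₀ (norm_nonneg _) l2 2
      rwa [Real.sq_sqrt (by positivity)] at this) x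
    have := L2_le_Hs s u
    linarith
  · have := h1 x
    nlinarith

lemma meas_gag {E : Type*} [NormedAddCommGroup E] [MeasurableSpace E] [BorelSpace E]
    [SecondCountableTopology E] {f : ℝ → E}
    (hf : Continuous f) (σ : ℝ) : Measurable (fun z : ℝ × ℝ =>
      ENNReal.ofReal (‖f z.2 - f z.1‖ ^ 2 / dT z.1 z.2 ^ (2 * σ + 1))) := by
  have := meas_dT
  have := hf.measurable
  fun_prop

lemma gag_add {E : Type*} [NormedAddCommGroup E] [MeasurableSpace E] [BorelSpace E]
    [SecondCountableTopology E] {f g : ℝ → E}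
    (hf : Continuous f) (σ : ℝ) :
    gagliardoSqE σ (fun x => f x + g x) ≤ 2 * gagliardoSqE σ f + 2 * gagliardoSqE σ g := by
  have mf := meas_gag hf σ
  calc gagliardoSqE σ (fun x => f x + g x) ≤ ∫⁻ x in I01, ∫⁻ y in I01,
      (2 * ENNReal.ofReal (‖f y - f x‖ ^ 2 / dT x y ^ (2 * σ + 1)) +
       2 * ENNReal.ofReal (‖g y - g x‖ ^ 2 / dT x y ^ (2 * σ + 1))) := by
        refine lintegral_mono fun x => lintegral_mono fun y => ?_
        have d0 : 0 ≤ dT x y ^ (2 * σ + 1) := Real.rpow_nonneg (dT_nonneg _ _) _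
        rw [show (2:ℝ≥0∞) = ENNReal.ofReal 2 by simp, ← ENNReal.ofReal_mul (by norm_num),
          ← ENNReal.ofReal_mul (by norm_num), ← ENNReal.ofReal_add (by positivity) (by positivity)]
        apply ENNReal.ofReal_le_ofReal
        rw [← mul_div_assoc, ← mul_div_assoc, ← add_div]
        refine div_le_div_of_nonneg_right ?_ d0
        have : f y + g y - (f x + g x) = (f y - f x) + (g y - g x) := by abel
        rw [this]
        have := norm_add_le (f y - f x) (g y - g x)
        nlinarith [norm_nonneg (f y - f x + (g y - g x)), sq_nonneg (‖f y - f x‖ - ‖g y - g x‖)]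
    _ = _ := by
        have m2 : ∀ x, Measurable fun y =>
            2 * ENNReal.ofReal (‖f y - f x‖ ^ 2 / dT x y ^ (2 * σ + 1)) :=
          fun x => (mf.comp measurable_prodMk_left).const_mul 2
        simp_rw [fun x => lintegral_add_left (μ := volume.restrict I01) (m2 x)]
        rw [lintegral_add_left]
        · simp_rw [lintegral_const_mul' (2:ℝ≥0∞) _ (by simp)]; rfl
        · exact Measurable.lintegral_prod_right' (mf.const_mul 2)

lemma gag_smul {E : Type*} [NormedAddCommGroup E] [NormedSpace ℝ E] (f : ℝ → E) (σ c : ℝ) :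
    gagliardoSqE σ (fun x => c • f x) = ENNReal.ofReal (c ^ 2) * gagliardoSqE σ f := by
  unfold gagliardoSqE
  simp_rw [← smul_sub, norm_smul, mul_pow, Real.norm_eq_abs, sq_abs, mul_div_assoc,
    ENNReal.ofReal_mul (sq_nonneg c)]
  simp_rw [lintegral_const_mul' _ _ ENNReal.ofReal_ne_top]

lemma deriv_add' {n : ℕ} {u v : ℝ → En n} (hu : ContDiff ℝ 1 u) (hv : ContDiff ℝ 1 v) :
    deriv (fun x => u x + v x) = fun x => deriv u x + deriv v x := by
  funext x
  exact ((hu.differentiable one_ne_zero x).hasDerivAt.add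
    (hv.differentiable one_ne_zero x).hasDerivAt).deriv

lemma deriv_smul' {n : ℕ} {u : ℝ → En n} (hu : ContDiff ℝ 1 u) (c : ℝ) :
    deriv (fun x => c • u x) = fun x => c • deriv u x := by
  funext x
  exact ((hu.differentiable one_ne_zero x).hasDerivAt.const_smul c).deriv

lemma InHs.add {n : ℕ} {s : ℝ} {u v : ℝ → En n} (hu : InHs s u) (hv : InHs s v) :
    InHs s (fun x => u x + v x) := by
  refine ⟨fun x => by simp only [hu.1 x, hv.1 x], hu.2.1.add hv.2.1, ?_⟩
  rw [deriv_add' hu.2.1 hv.2.1]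
  refine lt_of_le_of_lt (gag_add (cont_deriv hu.2.1) _) ?_
  exact ENNReal.add_lt_top.2 ⟨ENNReal.mul_lt_top (by simp) hu.2.2,
    ENNReal.mul_lt_top (by simp) hv.2.2⟩

lemma InHs.smul {n : ℕ} {s : ℝ} {u : ℝ → En n} (hu : InHs s u) (c : ℝ) :
    InHs s (fun x => c • u x) := by
  refine ⟨fun x => by simp only [hu.1 x], hu.2.1.const_smul c, ?_⟩
  rw [deriv_smul' hu.2.1, gag_smul]
  exact ENNReal.mul_lt_top (by simp) hu.2.2

lemma InHs.sub {n : ℕ} {s : ℝ} {u v : ℝ → En n} (hu : InHs s u) (hv : InHs s v) :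
    InHs s (fun x => u x - v x) := by
  have := hu.add (hv.smul (-1))
  simpa [sub_eq_add_neg] using this

lemma HsNormSq_smul {n : ℕ} {s : ℝ} {u : ℝ → En n} (hu : InHs s u) (c : ℝ) :
    HsNormSq s (fun x => c • u x) = c ^ 2 * HsNormSq s u := by
  unfold HsNormSq
  rw [deriv_smul' hu.2.1, gag_smul, ENNReal.toReal_mul, ENNReal.toReal_ofReal (sq_nonneg c)]
  simp_rw [norm_smul, mul_pow, Real.norm_eq_abs, sq_abs, integral_const_mul]
  ring

lemma int_add_sq {n : ℕ} {f g : ℝ → En n} (hf : Continuous f) (hg : Continuous g) :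
    (∫ x in I01, ‖f x + g x‖ ^ 2) ≤
      2 * (∫ x in I01, ‖f x‖ ^ 2) + 2 * ∫ x in I01, ‖g x‖ ^ 2 := by
  have hi : ∀ f : ℝ → En n, Continuous f → IntegrableOn (fun y => ‖f y‖ ^ 2) I01 := fun f hf =>
    ((hf.norm.pow 2).integrableOn_Icc (a := 0) (b := 1)).mono_set Ico_subset_Icc_self
  rw [← integral_const_mul, ← integral_const_mul,
    ← integral_add ((hi f hf).const_mul 2) ((hi g hg).const_mul 2)]
  refine integral_mono (hi _ (hf.add hg)) (((hi f hf).const_mul 2).add ((hi g hg).const_mul 2))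
    fun x => ?_
  have := norm_add_le (f x) (g x)
  have := norm_nonneg (f x + g x)
  show ‖f x + g x‖ ^ 2 ≤ 2 * ‖f x‖ ^ 2 + 2 * ‖g x‖ ^ 2
  nlinarith [sq_nonneg (‖f x‖ - ‖g x‖)]

lemma HsNormSq_add {n : ℕ} {s : ℝ} {u v : ℝ → En n} (hu : InHs s u) (hv : InHs s v) :
    HsNormSq s (fun x => u x + v x) ≤ 2 * HsNormSq s u + 2 * HsNormSq s v := by
  unfold HsNormSq
  rw [deriv_add' hu.2.1 hv.2.1]
  have a := int_add_sq hu.2.1.continuous hv.2.1.continuous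
  have b := int_add_sq (cont_deriv hu.2.1) (cont_deriv hv.2.1)
  have c : (gagliardoSqE (s - 1) (fun x => deriv u x + deriv v x)).toReal ≤
      2 * (gagliardoSqE (s - 1) (deriv u)).toReal + 2 * (gagliardoSqE (s - 1) (deriv v)).toReal := by
    have h := ENNReal.toReal_mono (by
      exact (ENNReal.add_lt_top.2 ⟨ENNReal.mul_lt_top (by simp) hu.2.2,
        ENNReal.mul_lt_top (by simp) hv.2.2⟩).ne)
      (gag_add (g := deriv v) (cont_deriv hu.2.1) (s - 1))
    rw [ENNReal.toReal_add (ENNReal.mul_lt_top (by simp) hu.2.2).ne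
      (ENNReal.mul_lt_top (by simp) hv.2.2).ne, ENNReal.toReal_mul, ENNReal.toReal_mul] at h
    simpa using h
  linarith

lemma HsNormSq_of_sub {n : ℕ} {s : ℝ} {u v : ℝ → En n} (hu : InHs s u) (hv : InHs s v) :
    HsNormSq s u ≤ 2 * HsNormSq s (fun x => u x - v x) + 2 * HsNormSq s v := by
  have := HsNormSq_add (hu.sub hv) hv
  simpa using this
end

section
/-- A bounded, jointly continuous family of curves and fields. -/
structure Fam {n : ℕ} (s : ℝ) (Γ V : ℝ → ℝ → En n) : Prop where
  mem : ∀ t, InM s (Γ t)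
  memV : ∀ t, InHs s (V t)
  cΓ : Continuous (fun z : ℝ × ℝ => Γ z.1 z.2)
  cΓ' : Continuous (fun z : ℝ × ℝ => deriv (Γ z.1) z.2)
  cV : Continuous (fun z : ℝ × ℝ => V z.1 z.2)
  cV' : Continuous (fun z : ℝ × ℝ => deriv (V z.1) z.2)
  bdd : ∃ M, 0 ≤ M ∧ ∀ t ∈ Icc (0:ℝ) 1, HsNormSq s (Γ t) ≤ M ∧ HsNormSq s (V t) ≤ M

structure RP {n : ℕ} (s : ℝ) (Γ V : ℝ → ℝ → En n) : Prop extends Fam s Γ V where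
  dΓ : ∀ t ∈ Icc (0:ℝ) 1, ∀ x, HasDerivWithinAt (fun t => Γ t x) (V t x) (Icc 0 1) t
  dΓ' : ∀ t ∈ Icc (0:ℝ) 1, ∀ x,
    HasDerivWithinAt (fun t => deriv (Γ t) x) (deriv (V t) x) (Icc 0 1) t

def cl (t : ℝ) : ℝ := max 0 (min 1 t)

lemma cl_mem (t : ℝ) : cl t ∈ Icc (0:ℝ) 1 :=
  ⟨le_max_left _ _, max_le zero_le_one (min_le_left _ _)⟩
lemma cl_eq {t : ℝ} (h : t ∈ Icc (0:ℝ) 1) : cl t = t := by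
  rw [cl, min_eq_right h.2, max_eq_right h.1]
lemma cl_cont : Continuous cl := by unfold cl; fun_prop

lemma joint_cont {E : Type*} [NormedAddCommGroup E] (F : ℝ → ℝ → E) (b : ℝ → ℝ → ℝ)
    (hF : ∀ t ∈ Icc (0:ℝ) 1, Continuous (F t))
    (hb : ∀ t ∈ Icc (0:ℝ) 1, Tendsto (b t) (𝓝[Icc (0:ℝ) 1] t) (𝓝 0))
    (h : ∀ t ∈ Icc (0:ℝ) 1, ∀ τ ∈ Icc (0:ℝ) 1, ∀ x, ‖F τ x - F t x‖ ≤ b t τ) :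
    Continuous (fun z : ℝ × ℝ => F (cl z.1) z.2) := by
  rw [continuous_iff_continuousAt]
  rintro ⟨t, x⟩
  have ht := cl_mem t
  have h1 : Tendsto (fun z : ℝ × ℝ => cl z.1) (𝓝 (t, x)) (𝓝[Icc (0:ℝ) 1] (cl t)) :=
    tendsto_nhdsWithin_iff.2 ⟨(cl_cont.comp continuous_fst).tendsto (t, x),
      Eventually.of_forall fun z => cl_mem _⟩
  have h2 := (hb _ ht).comp h1
  have h3 : Tendsto (fun z : ℝ × ℝ => F (cl z.1) z.2 - F (cl t) z.2) (𝓝 (t, x)) (𝓝 0) :=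
    squeeze_zero_norm (fun z => h _ ht _ (cl_mem _) _) h2
  have h4 : Tendsto (fun z : ℝ × ℝ => F (cl t) z.2) (𝓝 (t, x)) (𝓝 (F (cl t) x)) :=
    ((hF _ ht).comp continuous_snd).tendsto (t, x)
  have := h3.add h4
  simpa [ContinuousAt] using this

namespace C1Path
variable {s : ℝ} {n : ℕ} (P : C1Path s n)

def q (t τ : ℝ) (x : ℝ) : En n := (τ - t)⁻¹ • (P.Γ τ x - P.Γ t x) - P.V t x

lemma q_mem {t τ : ℝ} (ht : t ∈ Icc (0:ℝ) 1) (hτ : τ ∈ Icc (0:ℝ) 1) : InHs s (P.q t τ) :=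
  (((P.mem τ hτ).1.sub (P.mem t ht).1).smul _).sub (P.memV t ht)

lemma q_lim {t : ℝ} (ht : t ∈ Icc (0:ℝ) 1) :
    Tendsto (fun τ => HsNorm s (P.q t τ)) (𝓝[Icc (0:ℝ) 1 \ {t}] t) (𝓝 0) := by
  have h1 : Tendsto (fun τ : ℝ => τ - t) (𝓝[Icc (0:ℝ) 1 \ {t}] t)
      (𝓝[{h : ℝ | t + h ∈ Set.Icc (0 : ℝ) 1 ∧ h ≠ 0}] 0) := by
    refine tendsto_nhdsWithin_iff.2 ⟨?_, eventually_nhdsWithin_of_forall fun τ hτ => ?_⟩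
    · have : Continuous (fun τ : ℝ => τ - t) := by fun_prop
      have := (this.tendsto t).mono_left (nhdsWithin_le_nhds (s := Icc (0:ℝ) 1 \ {t}))
      simpa using this
    · exact ⟨by simpa using hτ.1, sub_ne_zero.2 (by simpa using hτ.2)⟩
  have := (P.isDeriv t ht).comp h1
  refine this.congr fun τ => ?_
  simp only [Function.comp]
  congr 1
  funext x
  simp [q]

lemma deriv_q {t τ : ℝ} (ht : t ∈ Icc (0:ℝ) 1) (hτ : τ ∈ Icc (0:ℝ) 1) (x : ℝ) :
    deriv (P.q t τ) x = (τ - t)⁻¹ • (deriv (P.Γ τ) x - deriv (P.Γ t) x) - deriv (P.V t) x := by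
  have a := ((P.mem τ hτ).1.2.1.differentiable one_ne_zero x).hasDerivAt
  have b := ((P.mem t ht).1.2.1.differentiable one_ne_zero x).hasDerivAt
  have c := ((P.memV t ht).2.1.differentiable one_ne_zero x).hasDerivAt
  exact (((a.sub b).const_smul (τ - t)⁻¹).sub c).deriv

lemma dd (hs : 3 / 2 < s) {t : ℝ} (ht : t ∈ Icc (0:ℝ) 1) (x : ℝ) :
    HasDerivWithinAt (fun t => P.Γ t x) (P.V t x) (Icc 0 1) t ∧
    HasDerivWithinAt (fun t => deriv (P.Γ t) x) (deriv (P.V t) x) (Icc 0 1) t := by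
  obtain ⟨C, hC, S⟩ := sobolev hs
  have lim : Tendsto (fun τ => √C * HsNorm s (P.q t τ)) (𝓝[Icc (0:ℝ) 1 \ {t}] t) (𝓝 0) := by
    simpa using (P.q_lim ht).const_mul (√C)
  have hb : ∀ v : En n, ∀ τ, ‖v‖ ^ 2 ≤ C * HsNormSq s (P.q t τ) →
      ‖v‖ ≤ √C * HsNorm s (P.q t τ) := fun v τ h => by
    rw [HsNorm, ← Real.sqrt_mul hC.le]
    exact Real.le_sqrt_of_sq_le h
  constructor
  · rw [hasDerivWithinAt_iff_tendsto_slope, tendsto_iff_norm_sub_tendsto_zero]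
    refine squeeze_zero' (Eventually.of_forall fun _ => norm_nonneg _) ?_ lim
    refine eventually_nhdsWithin_of_forall fun τ hτ => ?_
    have := hb _ τ (S n _ (P.q_mem ht hτ.1) x).1
    simpa [slope, q] using this
  · rw [hasDerivWithinAt_iff_tendsto_slope, tendsto_iff_norm_sub_tendsto_zero]
    refine squeeze_zero' (Eventually.of_forall fun _ => norm_nonneg _) ?_ lim
    refine eventually_nhdsWithin_of_forall fun τ hτ => ?_
    have := hb _ τ (S n _ (P.q_mem ht hτ.1) x).2
    rw [P.deriv_q ht hτ.1] at this
    simpa [slope] using this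

lemma limV {t : ℝ} (ht : t ∈ Icc (0:ℝ) 1) :
    Tendsto (fun τ => HsNormSq s fun x => P.V τ x - P.V t x) (𝓝[Icc (0:ℝ) 1] t) (𝓝 0) := by
  have := (P.contV t ht).pow 2
  simpa [HsNorm_sq] using this

lemma limΓ {t : ℝ} (ht : t ∈ Icc (0:ℝ) 1) :
    Tendsto (fun τ => HsNormSq s fun x => P.Γ τ x - P.Γ t x) (𝓝[Icc (0:ℝ) 1] t) (𝓝 0) := by
  have key : Tendsto (fun τ => HsNormSq s fun x => P.Γ τ x - P.Γ t x)
      (𝓝[Icc (0:ℝ) 1 \ {t}] t) (𝓝 0) := by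
    have l1 : Tendsto (fun τ => (τ - t) ^ 2 * (2 * HsNorm s (P.q t τ) ^ 2 + 2 * HsNormSq s (P.V t)))
        (𝓝[Icc (0:ℝ) 1 \ {t}] t) (𝓝 0) := by
      have a : Tendsto (fun τ : ℝ => (τ - t) ^ 2) (𝓝[Icc (0:ℝ) 1 \ {t}] t) (𝓝 0) := by
        have : Continuous (fun τ : ℝ => (τ - t) ^ 2) := by fun_prop
        have := (this.tendsto t).mono_left (nhdsWithin_le_nhds (s := Icc (0:ℝ) 1 \ {t}))
        simpa using this
      have b := (((P.q_lim ht).pow 2).const_mul 2).add_const (2 * HsNormSq s (P.V t))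
      simpa using a.mul b
    refine squeeze_zero' (Eventually.of_forall fun _ => HsNormSq_nonneg _ _) ?_ l1
    refine eventually_nhdsWithin_of_forall fun τ hτ => ?_
    have hne : τ - t ≠ 0 := sub_ne_zero.2 (by simpa using hτ.2)
    have e : (fun x => P.Γ τ x - P.Γ t x) =
        fun x => (τ - t) • ((fun x => P.q t τ x + P.V t x) x) := by
      funext x
      simp [q, smul_smul, hne]
    rw [e, HsNormSq_smul ((P.q_mem ht hτ.1).add (P.memV t ht)), HsNorm_sq]
    have := HsNormSq_add (P.q_mem ht hτ.1) (P.memV t ht)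
    gcongr
  have h0 : HsNormSq s (fun x => P.Γ t x - P.Γ t x) = 0 := by
    have := HsNormSq_smul (P.mem t ht).1 0
    simpa using this
  have : 𝓝[Icc (0:ℝ) 1] t ≤ 𝓝[Icc (0:ℝ) 1 \ {t}] t ⊔ pure t := by
    rw [sup_comm, ← nhdsWithin_insert]
    apply nhdsWithin_mono
    intro x hx
    by_cases h : x = t
    · left; exact h
    · right; exact ⟨hx, h⟩
  refine Tendsto.mono_left ?_ this
  refine key.sup ?_
  rw [tendsto_pure_left]
  intro S hS
  rw [h0]
  exact mem_of_mem_nhds hS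

end C1Path

lemma loc_bdd {n : ℕ} {s : ℝ} (U : ℝ → ℝ → En n) (hU : ∀ t ∈ Icc (0:ℝ) 1, InHs s (U t))
    (hl : ∀ t ∈ Icc (0:ℝ) 1,
      Tendsto (fun τ => HsNormSq s fun x => U τ x - U t x) (𝓝[Icc (0:ℝ) 1] t) (𝓝 0)) :
    ∃ M, ∀ t ∈ Icc (0:ℝ) 1, HsNormSq s (U t) ≤ M := by
  refine isCompact_Icc.induction_on (p := fun S => ∃ M, ∀ t ∈ S, HsNormSq s (U t) ≤ M)
    ⟨0, by simp⟩ ?_ ?_ ?_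
  · rintro S T h ⟨M, hM⟩
    exact ⟨M, fun t ht => hM t (h ht)⟩
  · rintro S T ⟨M, hM⟩ ⟨N, hN⟩
    refine ⟨max M N, fun t ht => ?_⟩
    rcases ht with ht | ht
    · exact (hM t ht).trans (le_max_left _ _)
    · exact (hN t ht).trans (le_max_right _ _)
  · intro t ht
    have h1 : ∀ᶠ τ in 𝓝[Icc (0:ℝ) 1] t, HsNormSq s (fun x => U τ x - U t x) < 1 :=
      (hl t ht).eventually (gt_mem_nhds one_pos)
    have h2 := h1.and (eventually_mem_nhdsWithin)
    refine ⟨_, h2, 2 + 2 * HsNormSq s (U t), fun τ hτ => ?_⟩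
    have := HsNormSq_of_sub (hU τ hτ.2) (hU t ht)
    have := hτ.1
    linarith

lemma joint_of_lim {n : ℕ} {s : ℝ} (hs : 3 / 2 < s) (U : ℝ → ℝ → En n)
    (hU : ∀ t ∈ Icc (0:ℝ) 1, InHs s (U t))
    (hl : ∀ t ∈ Icc (0:ℝ) 1,
      Tendsto (fun τ => HsNormSq s fun x => U τ x - U t x) (𝓝[Icc (0:ℝ) 1] t) (𝓝 0)) :
    Continuous (fun z : ℝ × ℝ => U (cl z.1) z.2) ∧
    Continuous (fun z : ℝ × ℝ => deriv (U (cl z.1)) z.2) := by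
  obtain ⟨C, hC, S⟩ := sobolev hs
  have hb : ∀ t ∈ Icc (0:ℝ) 1, Tendsto (fun τ => √(C * HsNormSq s fun x => U τ x - U t x))
      (𝓝[Icc (0:ℝ) 1] t) (𝓝 0) := fun t ht => by
    have := ((hl t ht).const_mul C).sqrt
    simpa using this
  constructor
  · refine joint_cont U _ (fun t ht => (hU t ht).2.1.continuous) hb fun t ht τ hτ x => ?_
    exact Real.le_sqrt_of_sq_le (S n _ ((hU τ hτ).sub (hU t ht)) x).1
  · refine joint_cont (fun t => deriv (U t)) _ (fun t ht => cont_deriv (hU t ht).2.1) hb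
      fun t ht τ hτ x => ?_
    have := Real.le_sqrt_of_sq_le (S n _ ((hU τ hτ).sub (hU t ht)) x).2
    have e : deriv (fun x => U τ x - U t x) x = deriv (U τ) x - deriv (U t) x :=
      (((hU τ hτ).2.1.differentiable one_ne_zero x).hasDerivAt.sub
        ((hU t ht).2.1.differentiable one_ne_zero x).hasDerivAt).deriv
    rwa [e] at this

lemma C1Path.rp {s : ℝ} {n : ℕ} (P : C1Path s n) (hs : 3 / 2 < s) :
    RP s (fun t => P.Γ (cl t)) (fun t => P.V (cl t)) := by
  have j1 := joint_of_lim hs P.Γ (fun t ht => (P.mem t ht).1) (fun t ht => P.limΓ ht)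
  have j2 := joint_of_lim hs P.V P.memV (fun t ht => P.limV ht)
  obtain ⟨M1, b1⟩ := loc_bdd P.Γ (fun t ht => (P.mem t ht).1) (fun t ht => P.limΓ ht)
  obtain ⟨M2, b2⟩ := loc_bdd P.V P.memV (fun t ht => P.limV ht)
  refine ⟨⟨fun t => P.mem _ (cl_mem t), fun t => P.memV _ (cl_mem t), j1.1, j1.2, j2.1, j2.2,
    max 0 (max M1 M2), le_max_left _ _, fun t _ => ⟨?_, ?_⟩⟩, fun t ht x => ?_, fun t ht x => ?_⟩
  · exact (b1 _ (cl_mem t)).trans ((le_max_left _ _).trans (le_max_right _ _))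
  · exact (b2 _ (cl_mem t)).trans ((le_max_right _ _).trans (le_max_right _ _))
  · have := (P.dd hs ht x).1
    rw [cl_eq ht]
    exact this.congr (fun τ hτ => by simp only [cl_eq hτ]) (by simp only [cl_eq ht])
  · have := (P.dd hs ht x).2
    rw [cl_eq ht]
    exact this.congr (fun τ hτ => by simp only [cl_eq hτ]) (by simp only [cl_eq ht])
end

section
def J0 : Set ℝ := Ico (-(1/2):ℝ) (1/2)

lemma scale_lint {F : ℝ → ℝ≥0∞} (hF : Measurable F) {θ : ℝ} (hθ : 0 < θ) :
    ∫⁻ k, F k = ENNReal.ofReal θ * ∫⁻ h, F (θ * h) := by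
  have e := Real.smul_map_volume_mul_left hθ.ne'
  conv_lhs => rw [← e]
  rw [lintegral_smul_measure, lintegral_map hF (by fun_prop), abs_of_pos hθ, smul_eq_mul]

lemma rho_pt {n : ℕ} {u : ℝ → En n} (hu : ContDiff ℝ 1 u) (x h : ℝ) :
    ‖u (x + h) - u x - h • deriv u x‖ₑ ^ 2 ≤
      ∫⁻ θ in Ioc (0:ℝ) 1, ENNReal.ofReal (h ^ 2 * ‖deriv u (x + θ * h) - deriv u x‖ ^ 2) := by
  have cd := cont_deriv hu
  have c1 : Continuous (fun θ : ℝ => h • (deriv u (x + θ * h) - deriv u x)) := by fun_prop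
  have e : u (x + h) - u x - h • deriv u x =
      ∫ θ in Ioc (0:ℝ) 1, h • (deriv u (x + θ * h) - deriv u x) := by
    rw [← intervalIntegral.integral_of_le zero_le_one]
    rw [intervalIntegral.integral_eq_sub_of_hasDerivAt
      (f := fun θ => u (x + θ * h) - (θ * h) • deriv u x)]
    · simp; abel
    · intro θ _
      have h1 : HasDerivAt (fun θ : ℝ => x + θ * h) h θ := by
        simpa using ((hasDerivAt_id θ).mul_const h).const_add x
      have h2 := (hu.differentiable one_ne_zero (x + θ * h)).hasDerivAt.scomp θ h1
      have h3 : HasDerivAt (fun θ : ℝ => (θ * h) • deriv u x) (h • deriv u x) θ := by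
        have : HasDerivAt (fun θ : ℝ => θ * h) h θ := by
          simpa using (hasDerivAt_id θ).mul_const h
        exact this.smul_const _
      have := h2.sub h3
      rw [smul_sub]
      exact this
    · exact c1.intervalIntegrable _ _
  rw [e]
  have a1 := enorm_integral_le_lintegral_enorm (μ := volume.restrict (Ioc (0:ℝ) 1))
    (fun θ => h • (deriv u (x + θ * h) - deriv u x))
  have a2 := cs_lint (volume.restrict (Ioc (0:ℝ) 1)) (f := fun _ => 1)
    (g := fun θ => ‖h • (deriv u (x + θ * h) - deriv u x)‖ₑ) (by fun_prop)
    (c1.measurable.enorm.aemeasurable)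
  simp only [one_mul, one_pow, lintegral_one, Measure.restrict_apply MeasurableSet.univ, univ_inter,
    Real.volume_Ioc, sub_zero, ENNReal.ofReal_one] at a2
  refine (pow_le_pow_left' a1 2).trans (a2.trans (le_of_eq ?_))
  refine lintegral_congr fun θ => ?_
  rw [← ofReal_norm, ← ENNReal.ofReal_pow (norm_nonneg _), norm_smul, mul_pow, Real.norm_eq_abs,
    sq_abs]

lemma hardy {n : ℕ} {s : ℝ} (hs : 3 / 2 < s) {u : ℝ → En n} (hu : ContDiff ℝ 1 u) (x : ℝ) :
    ∫⁻ h in J0, ENNReal.ofReal (‖u (x + h) - u x - h • deriv u x‖ ^ 2 / |h| ^ (2 * s + 1)) ≤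
    ∫⁻ h in J0, ENNReal.ofReal (‖deriv u (x + h) - deriv u x‖ ^ 2 / |h| ^ (2 * s - 1)) := by
  have cd := cont_deriv hu
  have md := cd.measurable
  set f : ℝ → ℝ≥0∞ := fun h =>
    ENNReal.ofReal (‖deriv u (x + h) - deriv u x‖ ^ 2 / |h| ^ (2 * s - 1)) with hf
  have mf : Measurable f := by
    rw [hf]
    have : Measurable (fun h : ℝ => |h|) := continuous_abs.measurable
    fun_prop
  have mJ : MeasurableSet J0 := measurableSet_Ico
  have pt : ∀ h, ENNReal.ofReal (‖u (x + h) - u x - h • deriv u x‖ ^ 2 / |h| ^ (2 * s + 1)) ≤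
      ∫⁻ θ in Ioc (0:ℝ) 1,
        ENNReal.ofReal (‖deriv u (x + θ * h) - deriv u x‖ ^ 2 / |h| ^ (2 * s - 1)) := by
    intro h
    rcases eq_or_ne h 0 with rfl | h0
    · simp
    have hp : 0 < |h| := abs_pos.2 h0
    have e1 : |h| ^ (2 * s + 1) = |h| ^ (2 * s - 1) * h ^ 2 := by
      rw [← sq_abs h, ← Real.rpow_natCast, ← Real.rpow_add hp]; congr 1; push_cast; ring
    rw [div_eq_inv_mul, ENNReal.ofReal_mul (by positivity), ENNReal.ofReal_pow (norm_nonneg _),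
      ofReal_norm]
    refine (mul_le_mul' le_rfl (rho_pt hu x h)).trans (le_of_eq ?_)
    rw [← lintegral_const_mul' _ _ ENNReal.ofReal_ne_top]
    refine lintegral_congr fun θ => ?_
    rw [← ENNReal.ofReal_mul (by positivity), e1]
    congr 1
    have : 0 < |h| ^ (2 * s - 1) := by positivity
    field_simp
  refine (lintegral_mono fun h => pt h).trans ?_
  rw [lintegral_lintegral_swap]
  swap
  · have : Measurable (fun h : ℝ => |h|) := continuous_abs.measurable
    have : Measurable (fun z : ℝ × ℝ => ENNReal.ofReal
      (‖deriv u (x + z.2 * z.1) - deriv u x‖ ^ 2 / |z.1| ^ (2 * s - 1))) := by fun_prop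
    exact this.aemeasurable
  calc _ ≤ ∫⁻ θ in Ioc (0:ℝ) 1, ∫⁻ h in J0, f h := by
        refine setLIntegral_mono' measurableSet_Ioc fun θ hθ => ?_
        set F : ℝ → ℝ≥0∞ := J0.indicator f with hFd
        have mF : Measurable F := mf.indicator mJ
        rw [← lintegral_indicator mJ, ← lintegral_indicator mJ, scale_lint mF hθ.1,
          ← lintegral_const_mul' _ _ ENNReal.ofReal_ne_top]
        refine lintegral_mono fun h => ?_
        by_cases hh : h ∈ J0
        · have hh2 : θ * h ∈ J0 := by
            constructor
            · nlinarith [hh.1, hθ.1, hθ.2]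
            · nlinarith [hh.2, hθ.1, hθ.2]
          rw [indicator_of_mem hh, hFd, indicator_of_mem hh2, hf]
          simp only
          rw [← ENNReal.ofReal_mul hθ.1.le]
          apply ENNReal.ofReal_le_ofReal
          rw [abs_mul, abs_of_pos hθ.1, Real.mul_rpow hθ.1.le (abs_nonneg _)]
          rcases eq_or_ne h 0 with rfl | h0
          · simp
          have hp : 0 < |h| ^ (2 * s - 1) := by
            have : 0 < |h| := abs_pos.2 h0
            positivity
          have ht : 0 < θ ^ (2 * s - 1) := Real.rpow_pos_of_pos hθ.1 _
          have hle : θ ^ (2 * s - 1) ≤ θ := by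
            have := Real.rpow_le_rpow_of_exponent_ge hθ.1 hθ.2 (show 1 ≤ 2 * s - 1 by linarith)
            simpa using this
          rw [← mul_div_assoc, div_le_div_iff₀ hp (by positivity)]
          have : 0 ≤ ‖deriv u (x + θ * h) - deriv u x‖ ^ 2 * |h| ^ (2 * s - 1) := by positivity
          nlinarith
        · rw [indicator_of_notMem hh]; exact zero_le
    _ = _ := by simp

lemma shift_lint (f : ℝ → ℝ≥0∞) (hf : Function.Periodic f 1) (x : ℝ) :
    ∫⁻ y in I01, f y = ∫⁻ h in J0, f (x + h) := by
  unfold J0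
  rw [← lint_per hf (x - 1/2), ← lintegral_indicator measurableSet_Ico,
    ← lintegral_indicator measurableSet_Ico, ← lintegral_add_left_eq_self _ x]
  refine lintegral_congr fun h => ?_
  have e : x + h ∈ Ico (x - 1/2) (x - 1/2 + 1) ↔ h ∈ Ico (-(1/2):ℝ) (1/2) := by
    constructor <;> rintro ⟨a, b⟩ <;> constructor <;> linarith
  by_cases hh : h ∈ Ico (-(1/2):ℝ) (1/2)
  · rw [indicator_of_mem hh, indicator_of_mem (e.2 hh)]
  · rw [indicator_of_notMem hh, indicator_of_notMem (fun h' => hh (e.1 h'))]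

lemma dT_add_int (x y : ℝ) : dT x (y + 1) = dT x y := by
  unfold dT
  refine (Equiv.addRight (1:ℤ)).iInf_congr fun k => ?_
  simp only [Equiv.coe_addRight, Int.cast_add, Int.cast_one]
  congr 1; ring

/-- Hardy-type inequality for the second order remainder -/
lemma hardy_gag {n : ℕ} {s : ℝ} (hs : 3 / 2 < s) {u : ℝ → En n} (hu : InHs s u) :
    ∫⁻ x in I01, ∫⁻ h in J0,
      ENNReal.ofReal (‖u (x + h) - u x - h • deriv u x‖ ^ 2 / |h| ^ (2 * s + 1)) ≤
    gagliardoSqE (s - 1) (deriv u) := by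
  refine lintegral_mono fun x => (hardy hs hu.2.1 x).trans ?_
  have pd := deriv_per hu.1
  rw [shift_lint (fun y => ENNReal.ofReal (‖deriv u y - deriv u x‖ ^ 2 /
    dT x y ^ (2 * (s - 1) + 1))) (fun y => by simp only [pd y, dT_add_int]) x]
  refine lintegral_mono fun h => ENNReal.ofReal_le_ofReal ?_
  rw [show 2 * (s - 1) + 1 = 2 * s - 1 by ring]
  rcases (dT_nonneg x (x + h)).eq_or_lt with h0 | h0
  · rw [per_dT0 pd h0.symm]; simp
  · have := dT_le x (x + h)
    rw [abs_sub_comm, add_sub_cancel_left] at this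
    have : 0 ≤ 2 * s - 1 := by linarith
    gcongr
end

section
lemma InM.reg {n : ℕ} {s : ℝ} {γ : ℝ → En n} (h : InM s γ) : Reg γ := ⟨h.1.1, h.1.2.1, h.2.2⟩

lemma InM.ne {n : ℕ} {s : ℝ} {γ : ℝ → En n} (h : InM s γ) (x : ℝ) {k : ℝ} (h0 : k ≠ 0)
    (h1 : |k| < 1) : γ (x + k) ≠ γ x := by
  intro e
  have hp := h.1.1
  have fr : ∀ z : ℝ, γ (Int.fract z) = γ z := fun z => by
    have := hp.sub_int_mul_eq (x := z) ⌊z⌋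
    rw [← this]; congr 1; rw [Int.fract]; ring
  have mem : ∀ z : ℝ, Int.fract z ∈ I01 := fun z => ⟨Int.fract_nonneg z, Int.fract_lt_one z⟩
  rw [← fr (x + k), ← fr x] at e
  have e2 := h.2.1 (mem _) (mem _) e
  rw [Int.fract, Int.fract] at e2
  have e3 : k = ((⌊x + k⌋ - ⌊x⌋ : ℤ) : ℝ) := by push_cast; linarith
  rw [e3] at h1 h0
  rw [← Int.cast_abs] at h1
  have : |⌊x + k⌋ - ⌊x⌋| < 1 := by exact_mod_cast h1
  apply h0
  rw [Int.abs_lt_one_iff] at this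
  rw [this]; simp

lemma Fam.bilip {n : ℕ} {s : ℝ} {Γ V : ℝ → ℝ → En n} (F : Fam s Γ V) :
    ∃ c : ℝ, 0 < c ∧ ∀ t ∈ Icc (0:ℝ) 1, ∀ x, c ≤ ‖deriv (Γ t) x‖ ∧
      ∀ h, |h| ≤ 1/2 → c * |h| ≤ ‖Γ t (x + h) - Γ t x‖ := by
  set Q : ℝ × ℝ × ℝ → En n := fun p => ∫ θ in (0:ℝ)..1, deriv (Γ p.1) (p.2.1 + θ * p.2.2) with hQ
  have cQ : Continuous Q := by
    apply intervalIntegral.continuous_parametric_intervalIntegral_of_continuous'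
    have : Continuous fun q : (ℝ × ℝ × ℝ) × ℝ => (q.1.1, q.1.2.1 + q.2 * q.1.2.2) := by fun_prop
    exact F.cΓ'.comp this
  have eQ : ∀ t x h, h • Q (t, x, h) = Γ t (x + h) - Γ t x := by
    intro t x h
    have r := (F.mem t).reg
    simp only [hQ]
    rw [r.ftc x (x + h)]
    have := intervalIntegral.smul_integral_comp_add_mul (deriv (Γ t)) h x (a := 0) (b := 1)
    simp only [mul_zero, add_zero, mul_one] at this
    rw [← this]
    congr 2; ext1 θ; rw [mul_comm]
  have e0 : ∀ t x, Q (t, x, 0) = deriv (Γ t) x := fun t x => by simp [hQ]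
  have ne : ∀ t x h, |h| < 1 → Q (t, x, h) ≠ 0 := by
    intro t x h hh
    rcases eq_or_ne h 0 with rfl | h0
    · rw [e0]; exact (F.mem t).2.2 x
    · intro hz
      have := eQ t x h
      rw [hz, smul_zero] at this
      exact (F.mem t).ne x h0 hh (sub_eq_zero.1 this.symm)
  obtain ⟨⟨t0, x0, h0⟩, hz, hm⟩ := ((isCompact_Icc (a := (0:ℝ)) (b := 1)).prod
    ((isCompact_Icc (a := (0:ℝ)) (b := 1)).prod (isCompact_Icc (a := (-(1/2):ℝ)) (b := 1/2)))).exists_isMinOn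
    ⟨(0, 0, 0), by simp⟩ cQ.norm.continuousOn
  have hb : |h0| < 1 := by
    have := hz.2.2; simp only at this
    rw [abs_lt]; constructor <;> linarith [this.1, this.2]
  have key : ∀ t ∈ Icc (0:ℝ) 1, ∀ x h, |h| ≤ 1/2 → ‖Q (t0, x0, h0)‖ ≤ ‖Q (t, x, h)‖ := by
    intro t ht x h hh
    have per : Function.Periodic (fun x => Q (t, x, h)) 1 := fun x => by
      simp only [hQ]
      congr 1; ext1 θ
      rw [show x + 1 + θ * h = (x + θ * h) + 1 by ring]
      exact deriv_per (F.mem t).1.1 _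
    obtain ⟨y, hy, e⟩ := per.exists_mem_Ico₀ one_pos x
    rw [e]
    exact hm (show (t, y, h) ∈ _ from ⟨ht, Ico_subset_Icc_self hy, abs_le.1 hh⟩)
  refine ⟨‖Q (t0, x0, h0)‖, norm_pos_iff.2 (ne _ _ _ hb), fun t ht x => ⟨?_, fun h hh => ?_⟩⟩
  · rw [← e0]; exact key t ht x 0 (by norm_num)
  · rw [← eQ, norm_smul, Real.norm_eq_abs, mul_comm]
    exact mul_le_mul_of_nonneg_left (key t ht x h hh) (abs_nonneg _)

def gI {n : ℕ} (s : ℝ) (γ u : ℝ → En n) (x y : ℝ) : ℝ :=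
  2 * B1i s γ u x y + (2 * s + 1) * B2i s γ u x y + B3i s γ u x y

lemma gI_nonneg {n : ℕ} {s : ℝ} (hs : 3/2 < s) (γ u : ℝ → En n) (x y : ℝ) : 0 ≤ gI s γ u x y := by
  unfold gI
  have := B1i_nonneg s γ u x y
  have := B2i_nonneg s γ u x y
  have := B3i_nonneg s γ u x y
  have : 0 ≤ 2 * s + 1 := by linarith
  positivity

def GE {n : ℕ} (s : ℝ) (γ u : ℝ → En n) : ℝ≥0∞ :=
  (∫⁻ x in I01, ∫⁻ y in I01, ENNReal.ofReal (gI s γ u x y)) +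
  (∫⁻ x in I01, ENNReal.ofReal (‖Dg γ u x‖ ^ 2 * ‖deriv γ x‖)) +
  (∫⁻ x in I01, ENNReal.ofReal (‖u x‖ ^ 2 * ‖deriv γ x‖))
end

section
lemma B1i_le {n : ℕ} {s c B : ℝ} (hs : 3/2 < s) (hc : 0 < c) (hB : 0 ≤ B) (γ u : ℝ → En n) (x h : ℝ)
    (h0 : h ≠ 0) (w1 : ∀ x, c ≤ ‖deriv γ x‖) (w2 : ∀ x, ‖deriv γ x‖ ≤ B)
    (u2 : ∀ x, ‖deriv u x‖ ≤ B) (hd : c * |h| ≤ ‖γ (x + h) - γ x‖) :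
    B1i s γ u x (x + h) ≤ B ^ 2 / c ^ (2 * s + 1) * (2 * (1 + (B / c) ^ 2)) *
      (‖u (x + h) - u x - h • deriv u x‖ ^ 2 / |h| ^ (2 * s + 1) +
       ‖γ (x + h) - γ x - h • deriv γ x‖ ^ 2 / |h| ^ (2 * s + 1)) := by
  have hh : 0 < |h| := abs_pos.2 h0
  set D := γ (x + h) - γ x with hD
  have Dp : 0 < ‖D‖ := lt_of_lt_of_le (by positivity) hd
  have gp : 0 < ‖deriv γ x‖ := hc.trans_le (w1 x)
  set ru := ‖u (x + h) - u x - h • deriv u x‖ with hru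
  set rg := ‖D - h • deriv γ x‖ with hrg
  have e1 : (u (x + h) - u x) - ⟪Dg γ γ x, D⟫ • Dg γ u x =
      (u (x + h) - u x - h • deriv u x) - ⟪Dg γ γ x, D - h • deriv γ x⟫ • Dg γ u x := by
    have : ⟪Dg γ γ x, h • deriv γ x⟫ • Dg γ u x = h • deriv u x := by
      simp only [Dg, inner_smul_left, inner_smul_right, real_inner_self_eq_norm_sq, smul_smul,
        conj_trivial]
      congr 1; field_simp
    rw [inner_sub_right _ D, sub_smul _ ⟪Dg γ γ x, h • deriv γ x⟫, this]; abel
  have na : ‖Dg γ u x‖ ≤ B / c := by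
    rw [Dg, norm_smul, norm_inv, norm_norm, inv_mul_eq_div]
    exact div_le_div₀ hB (u2 x) hc (w1 x)
  have nN : ‖(u (x + h) - u x) - ⟪Dg γ γ x, D⟫ • Dg γ u x‖ ≤ ru + B / c * rg := by
    rw [e1]
    refine (norm_sub_le _ _).trans (add_le_add le_rfl ?_)
    rw [norm_smul, mul_comm]
    refine mul_le_mul na ?_ (norm_nonneg _) (by positivity)
    refine (norm_inner_le_norm _ _).trans ?_
    rw [norm_T γ (norm_pos_iff.1 gp), one_mul]
  have nN2 : ‖(u (x + h) - u x) - ⟪Dg γ γ x, D⟫ • Dg γ u x‖ ^ 2 ≤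
      2 * (1 + (B / c) ^ 2) * (ru ^ 2 + rg ^ 2) := by
    have a1 : (ru + B / c * rg) ^ 2 ≤ 2 * (1 + (B / c) ^ 2) * (ru ^ 2 + rg ^ 2) := by
      nlinarith [sq_nonneg (ru - B / c * rg), mul_nonneg (sq_nonneg (B/c)) (sq_nonneg ru),
        sq_nonneg rg]
    refine (pow_le_pow_left₀ (norm_nonneg _) nN 2).trans a1
  have e2 : B1i s γ u x (x + h) = ‖(u (x + h) - u x) - ⟪Dg γ γ x, D⟫ • Dg γ u x‖ ^ 2 *
      ((‖deriv γ x‖ * ‖deriv γ (x + h)‖) / ‖D‖ ^ (2 * s + 1)) := by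
    rw [B1i, norm_Rop, muW, ← hD, Real.rpow_add_one Dp.ne', two_mul, Real.rpow_add Dp]
    field_simp
  rw [e2, ← add_div]
  have e3 : (‖deriv γ x‖ * ‖deriv γ (x + h)‖) / ‖D‖ ^ (2 * s + 1) ≤
      B ^ 2 / c ^ (2 * s + 1) / |h| ^ (2 * s + 1) := by
    rw [div_div, ← Real.mul_rpow hc.le hh.le]
    refine div_le_div₀ (by positivity) ?_ (by positivity) (Real.rpow_le_rpow (by positivity) hd
      (by linarith))
    rw [sq]; exact mul_le_mul (w2 _) (w2 _) (norm_nonneg _) hB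
  calc _ ≤ (2 * (1 + (B / c) ^ 2) * (ru ^ 2 + rg ^ 2)) *
        (B ^ 2 / c ^ (2 * s + 1) / |h| ^ (2 * s + 1)) :=
        mul_le_mul nN2 e3 (by positivity) (by positivity)
    _ = _ := by ring

lemma gI_le {s c B : ℝ} (hs : 3/2 < s) (hc : 0 < c) (hB : 0 ≤ B) : ∃ K : ℝ, 0 ≤ K ∧
    ∀ (n : ℕ) (γ u : ℝ → En n), ContDiff ℝ 1 γ → ContDiff ℝ 1 u → ∀ (x h : ℝ),
    (∀ x, c ≤ ‖deriv γ x‖) → (∀ x, ‖deriv γ x‖ ≤ B) →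
    (∀ x, ‖deriv u x‖ ≤ B) → (c * |h| ≤ ‖γ (x + h) - γ x‖) →
    gI s γ u x (x + h) ≤ K *
      (‖u (x + h) - u x - h • deriv u x‖ ^ 2 / |h| ^ (2 * s + 1) +
       ‖γ (x + h) - γ x - h • deriv γ x‖ ^ 2 / |h| ^ (2 * s + 1)) := by
  set K1 := B ^ 2 / c ^ (2 * s + 1) * (2 * (1 + (B / c) ^ 2)) with hK1
  have K1n : 0 ≤ K1 := by positivity
  refine ⟨2 * K1 + (2 * s + 1 + 2) * (B / c) ^ 2 * (K1 * 2), by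
    have : 0 ≤ 2 * s + 1 + 2 := by linarith
    positivity, ?_⟩
  intro n γ u cγ cu x h w1 w2 u2 hd
  rcases eq_or_ne h 0 with rfl | h0
  · simp [gI, B1i, B2i, B3i, muW]
  have hh : 0 < |h| := abs_pos.2 h0
  have Dp : 0 < ‖γ (x + h) - γ x‖ := lt_of_lt_of_le (by positivity) hd
  have b1 := B1i_le hs hc hB γ u x h h0 w1 w2 u2 hd
  have b0 := B1i_le hs hc hB γ γ x h h0 w1 w2 w2 hd
  rw [← hK1] at b0 b1
  set A := ‖u (x + h) - u x - h • deriv u x‖ ^ 2 / |h| ^ (2 * s + 1)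
  set C := ‖γ (x + h) - γ x - h • deriv γ x‖ ^ 2 / |h| ^ (2 * s + 1)
  have An : 0 ≤ A := by positivity
  have Cn : 0 ≤ C := by positivity
  have na : ∀ x, ‖Dg γ u x‖ ^ 2 ≤ (B / c) ^ 2 := fun x => by
    refine pow_le_pow_left₀ (norm_nonneg _) ?_ 2
    rw [Dg, norm_smul, norm_inv, norm_norm, inv_mul_eq_div]
    exact div_le_div₀ hB (u2 x) hc (w1 x)
  have du : ‖u (x + h) - u x‖ ^ 2 / ‖γ (x + h) - γ x‖ ^ 2 ≤ (B / c) ^ 2 := by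
    rw [← div_pow]
    refine pow_le_pow_left₀ (by positivity) ?_ 2
    have : ‖u (x + h) - u x‖ ≤ B * |h| := by
      have := convex_univ.norm_image_sub_le_of_norm_deriv_le (f := u) (C := B) (x := x) (y := x + h)
        (fun z _ => cu.differentiable one_ne_zero z) (fun z _ => u2 z) trivial trivial
      simpa using this
    rw [div_le_div_iff₀ Dp hc]
    nlinarith
  have bn := B1i_nonneg s γ γ x (x + h)
  have b2 : B2i s γ u x (x + h) ≤ (B / c) ^ 2 * B1i s γ γ x (x + h) := by
    have : B2i s γ u x (x + h) = ‖u (x + h) - u x‖ ^ 2 / ‖γ (x + h) - γ x‖ ^ 2 * B1i s γ γ x (x + h) := by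
      unfold B2i B1i; ring
    rw [this]; exact mul_le_mul_of_nonneg_right du bn
  have b3 : B3i s γ u x (x + h) ≤ 2 * (B / c) ^ 2 * B1i s γ γ x (x + h) := by
    have : B3i s γ u x (x + h) = (‖Dg γ u x‖ ^ 2 + ‖Dg γ u (x + h)‖ ^ 2) * B1i s γ γ x (x + h) := by
      unfold B3i B1i; ring
    rw [this]; exact mul_le_mul_of_nonneg_right (by linarith [na x, na (x + h)]) bn
  have s1 : 0 ≤ 2 * s + 1 := by linarith
  unfold gI
  have b0' : B1i s γ γ x (x + h) ≤ K1 * 2 * (A + C) := b0.trans (by nlinarith [mul_nonneg K1n An])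
  have q : 0 ≤ (2 * s + 1 + 2) * (B / c) ^ 2 := by
    have : 0 ≤ 2 * s + 1 + 2 := by linarith
    positivity
  have := mul_le_mul_of_nonneg_left b2 s1
  have := mul_le_mul_of_nonneg_left b0' q
  nlinarith

lemma Reg.perg2 {n : ℕ} {γ u : ℝ → En n} (h : Reg γ) (hu : Function.Periodic u 1) (s x y : ℝ) :
    gI s γ u x (y + 1) = gI s γ u x y := by
  simp only [gI, B1i, B2i, B3i, h.perRop2 hu, h.perRop2 h.per, h.permu2, h.perDg hu y, h.per y, hu y]

lemma Fam.fin {n : ℕ} {s : ℝ} (hs : 3/2 < s) {Γ V : ℝ → ℝ → En n} (F : Fam s Γ V) :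
    ∃ K : ℝ, 0 ≤ K ∧ ∀ t ∈ Icc (0:ℝ) 1, GE s (Γ t) (V t) ≤ ENNReal.ofReal K := by
  obtain ⟨c, hc, hb⟩ := F.bilip
  obtain ⟨M, hM, hMb⟩ := F.bdd
  obtain ⟨C, hC, hS⟩ := sobolev hs
  set B := √(C * M) with hBd
  have hB : 0 ≤ B := Real.sqrt_nonneg _
  have bd : ∀ t ∈ Icc (0:ℝ) 1, ∀ x, ‖deriv (Γ t) x‖ ≤ B ∧ ‖V t x‖ ≤ B ∧ ‖deriv (V t) x‖ ≤ B := by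
    intro t ht x
    have a1 := hS n _ (F.mem t).1 x
    have a2 := hS n _ (F.memV t) x
    have b1 := mul_le_mul_of_nonneg_left (hMb t ht).1 hC.le
    have b2 := mul_le_mul_of_nonneg_left (hMb t ht).2 hC.le
    exact ⟨Real.le_sqrt_of_sq_le (a1.2.trans b1), Real.le_sqrt_of_sq_le (a2.1.trans b2),
      Real.le_sqrt_of_sq_le (a2.2.trans b2)⟩
  obtain ⟨K, hK, hg⟩ := gI_le hs hc hB
  refine ⟨K * (M + M) + (B / c) ^ 2 * B + B ^ 2 * B, by positivity, fun t ht => ?_⟩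
  have r := (F.mem t).reg
  rw [ENNReal.ofReal_add (by positivity) (by positivity), ENNReal.ofReal_add (by positivity) (by positivity)]
  unfold GE
  refine add_le_add (add_le_add ?_ ?_) ?_
  · calc _ = ∫⁻ x in I01, ∫⁻ h in J0, ENNReal.ofReal (gI s (Γ t) (V t) x (x + h)) := by
          refine lintegral_congr fun x => ?_
          exact shift_lint (fun y => ENNReal.ofReal (gI s (Γ t) (V t) x y))
            (fun y => by simp only [r.perg2 (F.memV t).1]) x
      _ ≤ ∫⁻ x in I01, ∫⁻ h in J0, (ENNReal.ofReal K *
            ENNReal.ofReal (‖V t (x + h) - V t x - h • deriv (V t) x‖ ^ 2 / |h| ^ (2 * s + 1)) +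
            ENNReal.ofReal K *
            ENNReal.ofReal (‖Γ t (x + h) - Γ t x - h • deriv (Γ t) x‖ ^ 2 / |h| ^ (2 * s + 1))) := by
          refine lintegral_mono fun x => setLIntegral_mono' measurableSet_Ico fun h hh => ?_
          rw [← mul_add, ← ENNReal.ofReal_add (by positivity) (by positivity),
            ← ENNReal.ofReal_mul hK]
          refine ENNReal.ofReal_le_ofReal (hg n _ _ r.c1 (F.memV t).2.1 x h (fun x => (hb t ht x).1)
            (fun x => (bd t ht x).1) (fun x => (bd t ht x).2.2) ((hb t ht x).2 h ?_))
          exact abs_le.2 ⟨hh.1, hh.2.le⟩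
      _ = ENNReal.ofReal K * (∫⁻ x in I01, ∫⁻ h in J0,
            ENNReal.ofReal (‖V t (x + h) - V t x - h • deriv (V t) x‖ ^ 2 / |h| ^ (2 * s + 1))) +
          ENNReal.ofReal K * (∫⁻ x in I01, ∫⁻ h in J0,
            ENNReal.ofReal (‖Γ t (x + h) - Γ t x - h • deriv (Γ t) x‖ ^ 2 / |h| ^ (2 * s + 1))) := by
          have m : ∀ u : ℝ → En n, ContDiff ℝ 1 u → Measurable (fun z : ℝ × ℝ =>
              ENNReal.ofReal (‖u (z.1 + z.2) - u z.1 - z.2 • deriv u z.1‖ ^ 2 / |z.2| ^ (2 * s + 1))) := by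
            intro u hu
            have a3 := hu.continuous.measurable
            have a4 := (cont_deriv hu).measurable
            have a5 : Measurable (fun z : ℝ × ℝ => |z.2|) := by fun_prop
            have a6 : Measurable (fun z : ℝ × ℝ => ‖u (z.1 + z.2) - u z.1 - z.2 • deriv u z.1‖) := by
              fun_prop
            exact ((a6.pow_const 2).div (a5.pow_const _)).ennreal_ofReal
          have mV := m _ (F.memV t).2.1
          have mΓ := m _ r.c1
          rw [← lintegral_const_mul' _ _ ENNReal.ofReal_ne_top,
            ← lintegral_const_mul' _ _ ENNReal.ofReal_ne_top, ← lintegral_add_left]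
          · refine lintegral_congr fun x => ?_
            rw [lintegral_add_left, lintegral_const_mul' _ _ ENNReal.ofReal_ne_top,
              lintegral_const_mul' _ _ ENNReal.ofReal_ne_top]
            exact (mV.comp measurable_prodMk_left).const_mul _
          · exact (Measurable.lintegral_prod_right' mV).const_mul _
      _ ≤ _ := by
          rw [← mul_add, ENNReal.ofReal_mul hK, ENNReal.ofReal_add hM hM]
          refine mul_le_mul' le_rfl (add_le_add ((hardy_gag hs (F.memV t)).trans ?_)
            ((hardy_gag hs (F.mem t).1).trans ?_))
          · exact (gag_le_Hs (F.memV t)).trans (ENNReal.ofReal_le_ofReal (hMb t ht).2)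
          · exact (gag_le_Hs (F.mem t).1).trans (ENNReal.ofReal_le_ofReal (hMb t ht).1)
  · calc _ ≤ ∫⁻ x in I01, ENNReal.ofReal ((B / c) ^ 2 * B) := by
          refine lintegral_mono fun x => ENNReal.ofReal_le_ofReal ?_
          refine mul_le_mul (pow_le_pow_left₀ (norm_nonneg _) ?_ 2) (bd t ht x).1 (norm_nonneg _)
            (by positivity)
          rw [Dg, norm_smul, norm_inv, norm_norm, inv_mul_eq_div]
          exact div_le_div₀ hB (bd t ht x).2.2 hc (hb t ht x).1
      _ = _ := by simp
  · calc _ ≤ ∫⁻ x in I01, ENNReal.ofReal (B ^ 2 * B) := by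
          refine lintegral_mono fun x => ENNReal.ofReal_le_ofReal ?_
          exact mul_le_mul (pow_le_pow_left₀ (norm_nonneg _) (bd t ht x).2.1 2) (bd t ht x).1
            (norm_nonneg _) (by positivity)
      _ = _ := by simp
end

section
lemma sint {f : ℝ → ℝ} (h0 : ∀ x, 0 ≤ f x) (hm : Measurable f) :
    ∫ x in I01, f x = (∫⁻ x in I01, ENNReal.ofReal (f x)).toReal :=
  integral_eq_lintegral_of_nonneg_ae (Eventually.of_forall h0) hm.aestronglyMeasurable

lemma dint {f : ℝ → ℝ → ℝ} (h0 : ∀ x y, 0 ≤ f x y) (hm : Measurable (fun z : ℝ × ℝ => f z.1 z.2))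
    (hf : ∫⁻ x in I01, ∫⁻ y in I01, ENNReal.ofReal (f x y) ≠ ⊤) :
    ∫ x in I01, ∫ y in I01, f x y = (∫⁻ x in I01, ∫⁻ y in I01, ENNReal.ofReal (f x y)).toReal := by
  have m1 : Measurable (fun x => ∫⁻ y in I01, ENNReal.ofReal (f x y)) :=
    Measurable.lintegral_prod_right' hm.ennreal_ofReal
  have e : ∀ x, ∫ y in I01, f x y = (∫⁻ y in I01, ENNReal.ofReal (f x y)).toReal := fun x =>
    sint (h0 x) (hm.comp measurable_prodMk_left)
  simp_rw [e]
  exact integral_toReal m1.aemeasurable (ae_lt_top m1 hf)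

section
variable {n : ℕ} {Z : Type*} [MeasurableSpace Z] {Γ V : ℝ → ℝ → En n} {s : ℝ}

lemma mB_aux {a b a' b' c d c' d' : Z → En n} (h1 : Measurable a) (h2 : Measurable b)
    (h3 : Measurable a') (h4 : Measurable b') (h5 : Measurable c) (h6 : Measurable d)
    (h7 : Measurable c') (h8 : Measurable d') (s : ℝ) :
    Measurable (fun z => ‖(‖b z - a z‖ ^ s)⁻¹ • (d z - c z -
      ((‖a' z‖ ^ 2)⁻¹ * ⟪a' z, b z - a z⟫) • c' z)‖ ^ 2 * (‖a' z‖ * ‖b' z‖ / ‖b z - a z‖)) ∧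
    Measurable (fun z => ‖(‖b z - a z‖ ^ s)⁻¹ • (b z - a z -
      ((‖a' z‖ ^ 2)⁻¹ * ⟪a' z, b z - a z⟫) • a' z)‖ ^ 2 * (‖d z - c z‖ ^ 2 / ‖b z - a z‖ ^ 2) *
      (‖a' z‖ * ‖b' z‖ / ‖b z - a z‖)) ∧
    Measurable (fun z => ‖(‖b z - a z‖ ^ s)⁻¹ • (b z - a z -
      ((‖a' z‖ ^ 2)⁻¹ * ⟪a' z, b z - a z⟫) • a' z)‖ ^ 2 *
      (‖‖a' z‖⁻¹ • c' z‖ ^ 2 + ‖‖b' z‖⁻¹ • d' z‖ ^ 2) *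
      (‖a' z‖ * ‖b' z‖ / ‖b z - a z‖)) := by
  refine ⟨?_, ?_, ?_⟩ <;> fun_prop

lemma Fam.mB (F : Fam s Γ V) : Measurable (fun z : ℝ × ℝ × ℝ => B1i s (Γ z.1) (V z.1) z.2.1 z.2.2) ∧
    Measurable (fun z : ℝ × ℝ × ℝ => B2i s (Γ z.1) (V z.1) z.2.1 z.2.2) ∧
    Measurable (fun z : ℝ × ℝ × ℝ => B3i s (Γ z.1) (V z.1) z.2.1 z.2.2) := by
  have p1 : Measurable (fun z : ℝ × ℝ × ℝ => (z.1, z.2.1)) := by fun_prop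
  have p2 : Measurable (fun z : ℝ × ℝ × ℝ => (z.1, z.2.2)) := by fun_prop
  have a1 := F.cΓ.measurable.comp p1
  have a2 := F.cΓ.measurable.comp p2
  have a3 := F.cΓ'.measurable.comp p1
  have a4 := F.cΓ'.measurable.comp p2
  have a5 := F.cV.measurable.comp p1
  have a6 := F.cV.measurable.comp p2
  have a7 := F.cV'.measurable.comp p1
  have a8 := F.cV'.measurable.comp p2
  exact mB_aux a1 a2 a3 a4 a5 a6 a7 a8 s

lemma Fam.mg (F : Fam s Γ V) : Measurable (fun z : ℝ × ℝ × ℝ => gI s (Γ z.1) (V z.1) z.2.1 z.2.2) := by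
  obtain ⟨h1, h2, h3⟩ := F.mB
  unfold gI
  fun_prop

lemma Fam.mDg (F : Fam s Γ V) : Measurable (fun z : ℝ × ℝ => ‖Dg (Γ z.1) (V z.1) z.2‖ ^ 2 * ‖deriv (Γ z.1) z.2‖) := by
  have a3 := F.cΓ'.measurable
  have a7 := F.cV'.measurable
  unfold Dg
  fun_prop

lemma Fam.mL (F : Fam s Γ V) : Measurable (fun z : ℝ × ℝ => ‖V z.1 z.2‖ ^ 2 * ‖deriv (Γ z.1) z.2‖) := by
  have a3 := F.cΓ'.measurable
  have a7 := F.cV.measurable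
  fun_prop

lemma Fam.mGE (F : Fam s Γ V) : Measurable (fun t => GE s (Γ t) (V t)) := by
  unfold GE
  refine ((Measurable.lintegral_prod_right' (ν := volume.restrict I01) (f := fun w : ℝ × ℝ =>
    ∫⁻ y in I01, ENNReal.ofReal (gI s (Γ w.1) (V w.1) w.2 y)) ?_).add
    (Measurable.lintegral_prod_right' F.mDg.ennreal_ofReal)).add
    (Measurable.lintegral_prod_right' F.mL.ennreal_ofReal)
  refine Measurable.lintegral_prod_right' (f := fun w : (ℝ × ℝ) × ℝ =>
    ENNReal.ofReal (gI s (Γ w.1.1) (V w.1.1) w.1.2 w.2)) ?_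
  have : Measurable (fun w : (ℝ × ℝ) × ℝ => (w.1.1, w.1.2, w.2)) := by fun_prop
  exact (F.mg.comp this).ennreal_ofReal

lemma Gmet_eq_aux {γ u : ℝ → En n} (hs : 3/2 < s)
    (h1 : Measurable fun z : ℝ × ℝ => B1i s γ u z.1 z.2)
    (h2 : Measurable fun z : ℝ × ℝ => B2i s γ u z.1 z.2)
    (h3 : Measurable fun z : ℝ × ℝ => B3i s γ u z.1 z.2)
    (mD : Measurable (fun x => ‖Dg γ u x‖ ^ 2 * ‖deriv γ x‖))
    (mL : Measurable (fun x => ‖u x‖ ^ 2 * ‖deriv γ x‖)) (h : GE s γ u ≠ ⊤) :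
    Gmet s γ u u = (GE s γ u).toReal := by
  have s1 : 0 ≤ 2 * s + 1 := by linarith
  obtain ⟨L1, hL1⟩ : ∃ L, L = ∫⁻ x in I01, ∫⁻ y in I01, ENNReal.ofReal (B1i s γ u x y) := ⟨_, rfl⟩
  obtain ⟨L2, hL2⟩ : ∃ L, L = ∫⁻ x in I01, ∫⁻ y in I01, ENNReal.ofReal (B2i s γ u x y) := ⟨_, rfl⟩
  obtain ⟨L3, hL3⟩ : ∃ L, L = ∫⁻ x in I01, ∫⁻ y in I01, ENNReal.ofReal (B3i s γ u x y) := ⟨_, rfl⟩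
  have eL : ∫⁻ x in I01, ∫⁻ y in I01, ENNReal.ofReal (gI s γ u x y) =
      ENNReal.ofReal 2 * L1 + ENNReal.ofReal (2 * s + 1) * L2 + L3 := by
    have m1 := h1.ennreal_ofReal
    have m2 := h2.ennreal_ofReal
    have m3 := h3.ennreal_ofReal
    have m1' := Measurable.lintegral_prod_right' (ν := volume.restrict I01) m1
    have m2' := Measurable.lintegral_prod_right' (ν := volume.restrict I01) m2
    rw [hL1, hL2, hL3]
    rw [← lintegral_const_mul' _ _ ENNReal.ofReal_ne_top,
      ← lintegral_const_mul' _ _ ENNReal.ofReal_ne_top, ← lintegral_add_left (by exact m1'.const_mul _),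
      ← lintegral_add_left (by exact (m1'.const_mul _).add (m2'.const_mul _))]
    refine lintegral_congr fun x => ?_
    have n1 := m1.comp (measurable_prodMk_left (x := x))
    have n2 := m2.comp (measurable_prodMk_left (x := x))
    simp only [Function.comp_def] at n1 n2
    rw [← lintegral_const_mul' _ _ ENNReal.ofReal_ne_top,
      ← lintegral_const_mul' _ _ ENNReal.ofReal_ne_top, ← lintegral_add_left (by exact n1.const_mul _),
      ← lintegral_add_left (by exact (n1.const_mul _).add (n2.const_mul _))]
    refine lintegral_congr fun y => ?_
    have := B1i_nonneg s γ u x y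
    have := B2i_nonneg s γ u x y
    have := B3i_nonneg s γ u x y
    rw [gI, ENNReal.ofReal_add (by positivity) (by positivity),
      ENNReal.ofReal_add (by positivity) (by positivity), ENNReal.ofReal_mul (by positivity),
      ENNReal.ofReal_mul (by positivity)]
  have e1 : innerH1g γ u u = (∫⁻ x in I01, ENNReal.ofReal (‖Dg γ u x‖ ^ 2 * ‖deriv γ x‖)).toReal := by
    rw [← sint (f := fun x => ‖Dg γ u x‖ ^ 2 * ‖deriv γ x‖) (fun x => by positivity) mD]
    simp only [innerH1g, real_inner_self_eq_norm_sq]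
  have e2 : innerL2g γ u u = (∫⁻ x in I01, ENNReal.ofReal (‖u x‖ ^ 2 * ‖deriv γ x‖)).toReal := by
    rw [← sint (f := fun x => ‖u x‖ ^ 2 * ‖deriv γ x‖) (fun x => by positivity) mL]
    simp only [innerL2g, real_inner_self_eq_norm_sq]
  unfold GE at h ⊢
  rw [ENNReal.add_ne_top, ENNReal.add_ne_top, eL, ENNReal.add_ne_top, ENNReal.add_ne_top] at h
  obtain ⟨⟨⟨⟨k1, k2⟩, k3⟩, k4⟩, k5⟩ := h
  have z1 : L1 ≠ ⊤ := fun e => by rw [e] at k1; simp at k1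
  have z2 : L2 ≠ ⊤ := fun e => by
    rw [e, ENNReal.mul_top] at k2
    · exact k2 rfl
    · simp; linarith
  have f1 : B1 s γ u u = L1.toReal := by
    rw [B1, hL1, ← dint (B1i_nonneg s γ u) h1 (hL1 ▸ z1)]
    simp only [real_inner_self_eq_norm_sq, B1i]
  have f2 : B2 s γ u u = L2.toReal := by
    rw [B2, hL2, ← dint (B2i_nonneg s γ u) h2 (hL2 ▸ z2)]
    simp only [real_inner_self_eq_norm_sq, B2i]
  have f3 : B3 s γ u u = L3.toReal := by
    rw [B3, hL3, ← dint (B3i_nonneg s γ u) h3 (hL3 ▸ k3)]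
    simp only [real_inner_self_eq_norm_sq, B3i]
  have q1 := ENNReal.add_ne_top.2 ⟨k1, k2⟩
  have q2 := ENNReal.add_ne_top.2 ⟨q1, k3⟩
  have q3 := ENNReal.add_ne_top.2 ⟨q2, k4⟩
  rw [eL, ENNReal.toReal_add q3 k5, ENNReal.toReal_add q2 k4,
    ENNReal.toReal_add q1 k3, ENNReal.toReal_add k1 k2, ENNReal.toReal_mul,
    ENNReal.toReal_mul, ENNReal.toReal_ofReal s1, ENNReal.toReal_ofReal (by norm_num), Gmet, f1, f2, f3, e1, e2]


lemma mB_fix {γ u : ℝ → En n} (hγ : ContDiff ℝ 1 γ) (hu : ContDiff ℝ 1 u) (s : ℝ) :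
    (Measurable fun z : ℝ × ℝ => B1i s γ u z.1 z.2) ∧
    (Measurable fun z : ℝ × ℝ => B2i s γ u z.1 z.2) ∧
    (Measurable fun z : ℝ × ℝ => B3i s γ u z.1 z.2) := by
  have a1 := hγ.continuous.measurable
  have a2 := (cont_deriv hγ).measurable
  have a3 := hu.continuous.measurable
  have a4 := (cont_deriv hu).measurable
  exact mB_aux (a1.comp measurable_fst) (a1.comp measurable_snd) (a2.comp measurable_fst)
    (a2.comp measurable_snd) (a3.comp measurable_fst) (a3.comp measurable_snd)
    (a4.comp measurable_fst) (a4.comp measurable_snd) s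

lemma Gmet_eq {γ u : ℝ → En n} (hγ : ContDiff ℝ 1 γ) (hu : ContDiff ℝ 1 u) (hs : 3/2 < s)
    (h : GE s γ u ≠ ⊤) : Gmet s γ u u = (GE s γ u).toReal := by
  obtain ⟨k1, k2, k3⟩ := mB_fix hγ hu s
  have a2 := (cont_deriv hγ).measurable
  have a3 := hu.continuous.measurable
  have a4 := (cont_deriv hu).measurable
  have k4 : Measurable fun x => ‖Dg γ u x‖ ^ 2 * ‖deriv γ x‖ := by unfold Dg; fun_prop
  have k5 : Measurable fun x => ‖u x‖ ^ 2 * ‖deriv γ x‖ := by fun_prop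
  exact Gmet_eq_aux hs k1 k2 k3 k4 k5 h

/-- speed of a family -/
def spd (s : ℝ) (Γ V : ℝ → ℝ → En n) (t : ℝ) : ℝ := √(GE s (Γ t) (V t)).toReal

lemma spd_nonneg (s : ℝ) (Γ V : ℝ → ℝ → En n) (t : ℝ) : 0 ≤ spd s Γ V t := Real.sqrt_nonneg _

lemma Fam.spd_meas (F : Fam s Γ V) : Measurable (spd s Γ V) := F.mGE.ennreal_toReal.sqrt

lemma Fam.GE_spd (F : Fam s Γ V) (hs : 3/2 < s) {t : ℝ} (ht : t ∈ Icc (0:ℝ) 1) :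
    GE s (Γ t) (V t) = ENNReal.ofReal (spd s Γ V t ^ 2) := by
  obtain ⟨K, hK, h⟩ := F.fin hs
  rw [spd, Real.sq_sqrt ENNReal.toReal_nonneg, ENNReal.ofReal_toReal]
  exact ((h t ht).trans_lt ENNReal.ofReal_lt_top).ne

lemma Fam.spd_int (F : Fam s Γ V) (hs : 3/2 < s) : IntervalIntegrable (spd s Γ V) volume 0 1 := by
  obtain ⟨K, hK, h⟩ := F.fin hs
  rw [intervalIntegrable_iff_integrableOn_Icc_of_le zero_le_one]
  refine Measure.integrableOn_of_bounded (M := √K) (by simp) F.spd_meas.aestronglyMeasurable ?_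
  filter_upwards [ae_restrict_mem measurableSet_Icc] with t ht
  rw [Real.norm_of_nonneg (spd_nonneg _ _ _ _), spd]
  refine Real.sqrt_le_sqrt (ENNReal.toReal_le_of_le_ofReal hK (h t ht))
end

lemma C1Path.len_eq {s : ℝ} {n : ℕ} (P : C1Path s n) (hs : 3/2 < s) :
    pathLen P = ∫ t in (0:ℝ)..1, spd s (fun t => P.Γ (cl t)) (fun t => P.V (cl t)) t := by
  have F := (P.rp hs).toFam
  obtain ⟨K, hK, h⟩ := F.fin hs
  refine intervalIntegral.integral_congr fun t ht => ?_
  rw [uIcc_of_le zero_le_one] at ht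
  have := Gmet_eq (F.mem t).1.2.1 (F.memV t).2.1 hs ((h t ht).trans_lt ENNReal.ofReal_lt_top).ne
  simp only [cl_eq ht] at this
  simp only [spd, cl_eq ht, this]
end

section
section
variable {n : ℕ}

def kf (s : ℝ) (D p q : En n) : ℝ :=
  (‖D‖ ^ 2) ^ (-(2 * s + 1) / 4) * (‖p‖ ^ 2) ^ ((1:ℝ) / 4) * (‖q‖ ^ 2) ^ ((1:ℝ) / 4)
def Nf (D p : En n) : En n := D - (⟪p, D⟫ / ‖p‖ ^ 2) • p
def muf (s : ℝ) (D p q d p' q' : En n) : ℝ :=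
  -(2 * s + 1) / 2 * (⟪D, d⟫ / ‖D‖ ^ 2) + 1 / 2 * (⟪p, p'⟫ / ‖p‖ ^ 2) + 1 / 2 * (⟪q, q'⟫ / ‖q‖ ^ 2)
def Ndf (D p d p' : En n) : En n :=
  d - ((⟪p', D⟫ + ⟪p, d⟫) / ‖p‖ ^ 2 - 2 * ⟪p, D⟫ * ⟪p, p'⟫ / (‖p‖ ^ 2) ^ 2) • p -
    (⟪p, D⟫ / ‖p‖ ^ 2) • p'
def Psid (s : ℝ) (D p q d p' q' : En n) : En n :=
  kf s D p q • (muf s D p q d p' q' • Nf D p + Ndf D p d p')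

lemma hasD_norm {S : Set ℝ} {D : ℝ → En n} {t : ℝ} {d : En n} (h : HasDerivWithinAt D d S t) :
    HasDerivWithinAt (fun t => ‖D t‖ ^ 2) (2 * ⟪D t, d⟫) S t := h.norm_sq

lemma hasD_pow {S : Set ℝ} {D : ℝ → En n} {t : ℝ} {d : En n} (h : HasDerivWithinAt D d S t)
    (h0 : D t ≠ 0) (e : ℝ) :
    HasDerivWithinAt (fun t => (‖D t‖ ^ 2) ^ e) ((‖D t‖ ^ 2) ^ e * (2 * e * (⟪D t, d⟫ / ‖D t‖ ^ 2))) S t := by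
  have p : 0 < ‖D t‖ ^ 2 := by have := norm_pos_iff.2 h0; positivity
  convert (hasD_norm h).rpow_const (p := e) (Or.inl p.ne') using 1
  rw [Real.rpow_sub_one p.ne']
  ring

lemma hasD_Psi {S : Set ℝ} {D p q : ℝ → En n} {t s : ℝ} {d p' q' : En n}
    (hD : HasDerivWithinAt D d S t) (hp : HasDerivWithinAt p p' S t) (hq : HasDerivWithinAt q q' S t)
    (D0 : D t ≠ 0) (p0 : p t ≠ 0) (q0 : q t ≠ 0) :
    HasDerivWithinAt (fun t => kf s (D t) (p t) (q t) • Nf (D t) (p t))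
      (Psid s (D t) (p t) (q t) d p' q') S t := by
  have pp : 0 < ‖p t‖ ^ 2 := by have := norm_pos_iff.2 p0; positivity
  have k1 := ((hasD_pow hD D0 (-(2 * s + 1) / 4)).mul (hasD_pow hp p0 (1/4))).mul (hasD_pow hq q0 (1/4))
  have k2 : HasDerivWithinAt (fun t => kf s (D t) (p t) (q t))
      (kf s (D t) (p t) (q t) * muf s (D t) (p t) (q t) d p' q') S t := by
    refine HasDerivWithinAt.congr_deriv (f := fun t => kf s (D t) (p t) (q t)) k1 ?_
    unfold kf muf; simp only [Pi.mul_apply]; ring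
  have k3 : HasDerivWithinAt (fun t => Nf (D t) (p t)) (Ndf (D t) (p t) d p') S t := by
    have := hD.sub (((hp.inner ℝ hD).div (hasD_norm hp) pp.ne').smul hp)
    refine HasDerivWithinAt.congr_deriv (f := fun t => Nf (D t) (p t)) this ?_
    unfold Ndf
    rw [sub_sub]
    congr 1
    rw [add_comm]
    congr 2
    field_simp
    ring
  refine (k2.smul k3).congr_deriv ?_
  rw [Psid, smul_add, smul_smul, add_comm]

lemma cont_Psid {S : Set ℝ} {D p q d p' q' : ℝ → En n} {s : ℝ} (hD : ContinuousOn D S)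
    (hp : ContinuousOn p S) (hq : ContinuousOn q S) (hd : ContinuousOn d S)
    (hp' : ContinuousOn p' S) (hq' : ContinuousOn q' S)
    (D0 : ∀ t ∈ S, D t ≠ 0) (p0 : ∀ t ∈ S, p t ≠ 0) (q0 : ∀ t ∈ S, q t ≠ 0) :
    ContinuousOn (fun t => Psid s (D t) (p t) (q t) (d t) (p' t) (q' t)) S := by
  have D1 : ∀ t ∈ S, ‖D t‖ ^ 2 ≠ 0 := fun t ht => by simp [D0 t ht]
  have p1 : ∀ t ∈ S, ‖p t‖ ^ 2 ≠ 0 := fun t ht => by simp [p0 t ht]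
  have q1 : ∀ t ∈ S, ‖q t‖ ^ 2 ≠ 0 := fun t ht => by simp [q0 t ht]
  have p2 : ∀ t ∈ S, (‖p t‖ ^ 2) ^ 2 ≠ 0 := fun t ht => by simp [p0 t ht]
  have a1 := (hD.norm.pow 2).rpow_const (p := -(2 * s + 1) / 4) fun t ht => Or.inl (D1 t ht)
  have a2 := (hp.norm.pow 2).rpow_const (p := (1:ℝ) / 4) fun t ht => Or.inl (p1 t ht)
  have a3 := (hq.norm.pow 2).rpow_const (p := (1:ℝ) / 4) fun t ht => Or.inl (q1 t ht)
  have i1 := (hp.inner (𝕜 := ℝ) hD).div (hp.norm.pow 2) p1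
  have i2 := (hp.inner (𝕜 := ℝ) hp').div (hp.norm.pow 2) p1
  have i3 := (hq.inner (𝕜 := ℝ) hq').div (hq.norm.pow 2) q1
  have i4 := (hD.inner (𝕜 := ℝ) hd).div (hD.norm.pow 2) D1
  have i5 := ((hp'.inner (𝕜 := ℝ) hD).add (hp.inner (𝕜 := ℝ) hd)).div (hp.norm.pow 2) p1
  have i6 := (((hp.inner (𝕜 := ℝ) hD).const_mul 2).mul (hp.inner (𝕜 := ℝ) hp')).div ((hp.norm.pow 2).pow 2) p2
  have N := hD.sub (i1.smul hp)
  have M := ((i4.const_mul (-(2 * s + 1) / 2)).add (i2.const_mul (1/2))).add (i3.const_mul (1/2))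
  have Nd := (hd.sub ((i5.sub i6).smul hp)).sub (i1.smul hp')
  exact ((a1.mul a2).mul a3).smul ((M.smul N).add Nd)

lemma meas_Psid {Z : Type*} [MeasurableSpace Z] {D p q d p' q' : Z → En n} {s : ℝ} (hD : Measurable D)
    (hp : Measurable p) (hq : Measurable q) (hd : Measurable d)
    (hp' : Measurable p') (hq' : Measurable q') :
    Measurable (fun z => Psid s (D z) (p z) (q z) (d z) (p' z) (q' z)) := by
  unfold Psid kf muf Nf Ndf
  fun_prop

lemma meas_Psi {Z : Type*} [MeasurableSpace Z] {D p q : Z → En n} {s : ℝ} (hD : Measurable D)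
    (hp : Measurable p) (hq : Measurable q) :
    Measurable (fun z => kf s (D z) (p z) (q z) • Nf (D z) (p z)) := by
  unfold kf Nf
  fun_prop

lemma kf_sq (s : ℝ) (D p q : En n) : kf s D p q ^ 2 = ‖p‖ * ‖q‖ * (‖D‖ ^ (2 * s + 1))⁻¹ := by
  have e : ∀ (a e : ℝ), 0 ≤ a → ((a ^ 2) ^ e) ^ 2 = a ^ (4 * e) := fun a e ha => by
    rw [← Real.rpow_natCast a 2, ← Real.rpow_natCast _ 2, ← Real.rpow_mul ha, ← Real.rpow_mul ha]
    congr 1; push_cast; ring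
  unfold kf
  rw [mul_pow, mul_pow, e _ _ (norm_nonneg _), e _ _ (norm_nonneg _), e _ _ (norm_nonneg _),
    show 4 * (-(2 * s + 1) / 4) = -(2 * s + 1) by ring, show 4 * ((1:ℝ) / 4) = 1 by ring,
    Real.rpow_neg (norm_nonneg _), Real.rpow_one, Real.rpow_one]
  ring

lemma kf_nonneg (s : ℝ) (D p q : En n) : 0 ≤ kf s D p q := by unfold kf; positivity

lemma Psid_le {s : ℝ} (hs : 3/2 < s) (hs2 : s < 2) (D p q d p' q' : En n) (D0 : D ≠ 0) (p0 : p ≠ 0)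
    (q0 : q ≠ 0) : ‖Psid s D p q d p' q'‖ ^ 2 ≤ 9 * (kf s D p q ^ 2 *
      (2 * ‖d - (⟪p, D⟫ / ‖p‖ ^ 2) • p'‖ ^ 2 + (2 * s + 1) * (‖Nf D p‖ ^ 2 * (‖d‖ ^ 2 / ‖D‖ ^ 2)) +
        ‖Nf D p‖ ^ 2 * (‖‖p‖⁻¹ • p'‖ ^ 2 + ‖‖q‖⁻¹ • q'‖ ^ 2))) := by
  have Dp := norm_pos_iff.2 D0
  have pp := norm_pos_iff.2 p0
  have qp := norm_pos_iff.2 q0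
  have sm : ∀ (v v' : En n), 0 < ‖v‖ → |⟪v, v'⟫ / ‖v‖ ^ 2| ≤ ‖v'‖ / ‖v‖ := by
    intro v v' hv
    rw [abs_div, abs_of_pos (pow_pos hv 2), div_le_div_iff₀ (pow_pos hv 2) hv]
    have := abs_real_inner_le_norm v v'
    nlinarith
  set W := d - (⟪p, D⟫ / ‖p‖ ^ 2) • p' with hW
  set m := ‖d‖ / ‖D‖ with hm
  have ax : ‖‖p‖⁻¹ • p'‖ = ‖p'‖ / ‖p‖ := by rw [norm_smul, norm_inv, norm_norm]; ring
  have ay : ‖‖q‖⁻¹ • q'‖ = ‖q'‖ / ‖q‖ := by rw [norm_smul, norm_inv, norm_norm]; ring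
  rw [ax, ay, ← div_pow, ← hm]
  set a := ‖p'‖ / ‖p‖ with ha
  set b := ‖q'‖ / ‖q‖ with hb
  have an : 0 ≤ a := by positivity
  have bn : 0 ≤ b := by positivity
  have mn : 0 ≤ m := by positivity
  have hmu : |muf s D p q d p' q'| ≤ 5/2 * m + 1/2 * a + 1/2 * b := by
    have h1 := sm D d Dp
    have h2 := sm p p' pp
    have h3 := sm q q' qp
    unfold muf
    have z1 : |-(2 * s + 1) / 2 * (⟪D, d⟫ / ‖D‖ ^ 2)| ≤ 5/2 * m := by
      rw [abs_mul]
      refine mul_le_mul ?_ h1 (abs_nonneg _) (by norm_num)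
      rw [abs_le]; constructor <;> linarith
    have z2 : |1 / 2 * (⟪p, p'⟫ / ‖p‖ ^ 2)| ≤ 1/2 * a := by
      rw [abs_mul, abs_of_pos (by norm_num : (0:ℝ) < 1/2)]; linarith
    have z3 : |1 / 2 * (⟪q, q'⟫ / ‖q‖ ^ 2)| ≤ 1/2 * b := by
      rw [abs_mul, abs_of_pos (by norm_num : (0:ℝ) < 1/2)]; linarith
    exact (abs_add_three _ _ _).trans (by linarith)
  have eN : Ndf D p d p' = W - (⟪p, W⟫ / ‖p‖ ^ 2) • p - (⟪p', Nf D p⟫ / ‖p‖ ^ 2) • p := by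
    have e1 : ⟪p, W⟫ = ⟪p, d⟫ - ⟪p, D⟫ / ‖p‖ ^ 2 * ⟪p, p'⟫ := by
      rw [hW, inner_sub_right, inner_smul_right]
    have e2 : ⟪p', Nf D p⟫ = ⟪p', D⟫ - ⟪p, D⟫ / ‖p‖ ^ 2 * ⟪p, p'⟫ := by
      rw [Nf, inner_sub_right, inner_smul_right, real_inner_comm p p']
    rw [e1, e2, hW, Ndf, sub_sub (_ - _), ← add_smul, sub_right_comm]
    congr 2
    field_simp
    ring
  have nN : ‖Ndf D p d p'‖ ≤ 2 * ‖W‖ + a * ‖Nf D p‖ := by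
    rw [eN]
    have z1 : ‖(⟪p, W⟫ / ‖p‖ ^ 2) • p‖ ≤ ‖W‖ := by
      rw [norm_smul, Real.norm_eq_abs]
      calc _ ≤ ‖W‖ / ‖p‖ * ‖p‖ := mul_le_mul_of_nonneg_right (sm p W pp) pp.le
        _ = _ := by field_simp
    have z2 : ‖(⟪p', Nf D p⟫ / ‖p‖ ^ 2) • p‖ ≤ a * ‖Nf D p‖ := by
      rw [norm_smul, Real.norm_eq_abs, abs_div, abs_of_pos (pow_pos pp 2)]
      calc _ ≤ ‖p'‖ * ‖Nf D p‖ / ‖p‖ ^ 2 * ‖p‖ := by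
            gcongr; exact abs_real_inner_le_norm _ _
        _ = _ := by rw [ha]; field_simp
    refine (norm_sub_le _ _).trans ?_
    have := norm_sub_le W ((⟪p, W⟫ / ‖p‖ ^ 2) • p)
    linarith
  have tot : ‖muf s D p q d p' q' • Nf D p + Ndf D p d p'‖ ≤
      (5/2 * m + 3/2 * a + 1/2 * b) * ‖Nf D p‖ + 2 * ‖W‖ := by
    refine (norm_add_le _ _).trans ?_
    rw [norm_smul, Real.norm_eq_abs]
    have := mul_le_mul_of_nonneg_right hmu (norm_nonneg (Nf D p))
    linarith
  rw [Psid, norm_smul, mul_pow, Real.norm_eq_abs, sq_abs, mul_left_comm]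
  refine mul_le_mul_of_nonneg_left ?_ (sq_nonneg _)
  refine (pow_le_pow_left₀ (norm_nonneg _) tot 2).trans ?_
  set N := ‖Nf D p‖
  have Nn : 0 ≤ N := norm_nonneg _
  generalize ‖W‖ = w
  have hsm : 4 * (N ^ 2 * m ^ 2) ≤ (2 * s + 1) * (N ^ 2 * m ^ 2) :=
    mul_le_mul_of_nonneg_right (by linarith) (by positivity)
  have key : ∀ x y z u : ℝ, (x + y + z + u) ^ 2 ≤ 4 * (x ^ 2 + y ^ 2 + z ^ 2 + u ^ 2) := fun x y z u => by
    nlinarith [sq_nonneg (x - y), sq_nonneg (x - z), sq_nonneg (x - u), sq_nonneg (y - z),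
      sq_nonneg (y - u), sq_nonneg (z - u)]
  have := key (5/2 * (m * N)) (3/2 * (a * N)) (1/2 * (b * N)) (2 * w)
  nlinarith [sq_nonneg (m * N), sq_nonneg (a * N), sq_nonneg (b * N), sq_nonneg w]

end
end

section
section
variable {n : ℕ}

lemma kf_mu (s : ℝ) (γ : ℝ → En n) (x y : ℝ) (h : γ y - γ x ≠ 0) :
    kf s (γ y - γ x) (deriv γ x) (deriv γ y) ^ 2 = ((‖γ y - γ x‖ ^ s)⁻¹) ^ 2 * muW γ x y := by
  have Dp := norm_pos_iff.2 h
  rw [kf_sq, muW, Real.rpow_add_one Dp.ne', two_mul, Real.rpow_add Dp]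
  field_simp

lemma B1i_kf (s : ℝ) (γ u : ℝ → En n) (x y : ℝ) (h : γ y - γ x ≠ 0) :
    B1i s γ u x y = kf s (γ y - γ x) (deriv γ x) (deriv γ y) ^ 2 *
      ‖(u y - u x) - (⟪deriv γ x, γ y - γ x⟫ / ‖deriv γ x‖ ^ 2) • deriv u x‖ ^ 2 := by
  rw [kf_mu s γ x y h, B1i, Rop, DDg, norm_smul, mul_pow, inv_mul_eq_div, Real.norm_eq_abs, sq_abs]
  ring

lemma gI_kf (s : ℝ) (γ u : ℝ → En n) (x y : ℝ) (h : γ y - γ x ≠ 0) :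
    gI s γ u x y = kf s (γ y - γ x) (deriv γ x) (deriv γ y) ^ 2 *
      (2 * ‖(u y - u x) - (⟪deriv γ x, γ y - γ x⟫ / ‖deriv γ x‖ ^ 2) • deriv u x‖ ^ 2 +
       (2 * s + 1) * (‖Nf (γ y - γ x) (deriv γ x)‖ ^ 2 * (‖u y - u x‖ ^ 2 / ‖γ y - γ x‖ ^ 2)) +
        ‖Nf (γ y - γ x) (deriv γ x)‖ ^ 2 *
          (‖‖deriv γ x‖⁻¹ • deriv u x‖ ^ 2 + ‖‖deriv γ y‖⁻¹ • deriv u y‖ ^ 2)) := by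
  have e0 := B1i_kf s γ γ x y h
  have e1 := B1i_kf s γ u x y h
  have e2 : B2i s γ u x y = B1i s γ γ x y * (‖u y - u x‖ ^ 2 / ‖γ y - γ x‖ ^ 2) := by
    unfold B2i B1i; ring
  have e3 : B3i s γ u x y = B1i s γ γ x y *
      (‖‖deriv γ x‖⁻¹ • deriv u x‖ ^ 2 + ‖‖deriv γ y‖⁻¹ • deriv u y‖ ^ 2) := by
    unfold B3i B1i Dg; ring
  rw [gI, e2, e3, e0, e1, Nf]
  ring

abbrev mu2 : Measure (ℝ × ℝ) := (volume.restrict I01).prod (volume.restrict I01)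

lemma mu2_ae : ∀ᵐ z ∂mu2, z.1 ∈ I01 ∧ z.2 ∈ I01 ∧ z.1 ≠ z.2 := by
  have h1 : ∀ᵐ z ∂mu2, z ∈ I01 ×ˢ I01 := by
    rw [mu2, Measure.prod_restrict]
    exact ae_restrict_mem (measurableSet_Ico.prod measurableSet_Ico)
  have h2 : ∀ᵐ z ∂mu2, z.1 ≠ z.2 := by
    have m : MeasurableSet {z : ℝ × ℝ | z.1 = z.2} := measurableSet_eq_fun measurable_fst measurable_snd
    rw [ae_iff]
    simp only [not_not, ne_eq]
    rw [Measure.prod_apply m]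
    simp only [lintegral_eq_zero_iff (measurable_measure_prodMk_left m)]
    refine Eventually.of_forall fun x => ?_
    have : Prod.mk x ⁻¹' {z : ℝ × ℝ | z.1 = z.2} = {x} := by ext y; simp [eq_comm]
    simp only [this]; simp
  filter_upwards [h1, h2] with z a b
  exact ⟨a.1, a.2, b⟩

lemma lint_mu2 {f : ℝ → ℝ → ℝ≥0∞} (hf : Measurable (fun z : ℝ × ℝ => f z.1 z.2)) :
    ∫⁻ x in I01, ∫⁻ y in I01, f x y = ∫⁻ z, f z.1 z.2 ∂mu2 :=
  (lintegral_prod _ hf.aemeasurable).symm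

lemma enorm_sq_ofReal {E : Type*} [NormedAddCommGroup E] (v : E) : ‖v‖ₑ ^ 2 = ENNReal.ofReal (‖v‖ ^ 2) := by
  rw [ENNReal.ofReal_pow (norm_nonneg _), ofReal_norm]

lemma lint_sq_add {X E : Type*} [MeasurableSpace X] [NormedAddCommGroup E] [MeasurableSpace E] [BorelSpace E]
    {μ : Measure X} {f g : X → E} (hg : Measurable g) :
    ∫⁻ x, ‖f x‖ₑ ^ 2 ∂μ ≤ 2 * ∫⁻ x, ‖g x‖ₑ ^ 2 ∂μ + 2 * ∫⁻ x, ‖f x - g x‖ₑ ^ 2 ∂μ := by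
  rw [← lintegral_const_mul' _ _ (by norm_num), ← lintegral_const_mul' _ _ (by norm_num),
    ← lintegral_add_left ((hg.enorm.pow_const 2).const_mul _)]
  refine lintegral_mono fun x => ?_
  rw [enorm_sq_ofReal, enorm_sq_ofReal, enorm_sq_ofReal, show (2:ℝ≥0∞) = ENNReal.ofReal 2 by simp,
    ← ENNReal.ofReal_mul (by norm_num), ← ENNReal.ofReal_mul (by norm_num),
    ← ENNReal.ofReal_add (by positivity) (by positivity)]
  apply ENNReal.ofReal_le_ofReal
  have := norm_add_le (g x) (f x - g x)
  rw [add_sub_cancel] at this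
  nlinarith [sq_nonneg (‖g x‖ - ‖f x - g x‖), norm_nonneg (f x)]

variable {Γ V : ℝ → ℝ → En n} {s : ℝ}

lemma RP.energy (F : RP s Γ V) (hs : 3/2 < s) (hs2 : s < 2) {t0 t1 : ℝ} (h0 : t0 ∈ Icc (0:ℝ) 1)
    (h1 : t1 ∈ Icc (0:ℝ) 1) : EtpE s (Γ t1) ≤ 2 * EtpE s (Γ t0) +
      ENNReal.ofReal (18 * (∫ t in (0:ℝ)..1, spd s Γ V t) ^ 2) := by
  have p1 : Measurable (fun z : ℝ × ℝ × ℝ => (z.1, z.2.1)) := by fun_prop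
  have p2 : Measurable (fun z : ℝ × ℝ × ℝ => (z.1, z.2.2)) := by fun_prop
  have a1 := F.cΓ.measurable.comp p1
  have a2 := F.cΓ.measurable.comp p2
  have a3 := F.cΓ'.measurable.comp p1
  have a4 := F.cΓ'.measurable.comp p2
  have a5 := F.cV.measurable.comp p1
  have a6 := F.cV.measurable.comp p2
  have a7 := F.cV'.measurable.comp p1
  have a8 := F.cV'.measurable.comp p2
  have ne : ∀ t, ∀ z : ℝ × ℝ, (z.1 ∈ I01 ∧ z.2 ∈ I01 ∧ z.1 ≠ z.2) → Γ t z.2 - Γ t z.1 ≠ 0 := by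
    rintro t z ⟨ha, hb, hc⟩ e
    exact hc ((F.mem t).2.1 ha hb (sub_eq_zero.1 e).symm)
  have cc : ∀ {f : ℝ × ℝ → En n}, Continuous f → ∀ x, Continuous fun t => f (t, x) :=
    fun hf x => hf.comp (by fun_prop)
  set Φ : ℝ → ℝ × ℝ → En n := fun t z => kf s (Γ t z.2 - Γ t z.1) (deriv (Γ t) z.1) (deriv (Γ t) z.2) •
    Nf (Γ t z.2 - Γ t z.1) (deriv (Γ t) z.1) with hΦ
  set Φ' : ℝ → ℝ × ℝ → En n := fun t z => Psid s (Γ t z.2 - Γ t z.1) (deriv (Γ t) z.1) (deriv (Γ t) z.2)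
    (V t z.2 - V t z.1) (deriv (V t) z.1) (deriv (V t) z.2) with hΦ'
  have E : ∀ t, EtpE s (Γ t) = ∫⁻ z, ‖Φ t z‖ₑ ^ 2 ∂mu2 := by
    intro t
    change ∫⁻ x in I01, ∫⁻ y in I01, ENNReal.ofReal (B1i s (Γ t) (Γ t) x y) = _
    rw [lint_mu2 (f := fun x y => ENNReal.ofReal (B1i s (Γ t) (Γ t) x y))
      (mB_fix (F.mem t).1.2.1 (F.mem t).1.2.1 s).1.ennreal_ofReal]
    refine lintegral_congr_ae ?_
    filter_upwards [mu2_ae] with z hz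
    rw [B1i_kf _ _ _ _ _ (ne t z hz), enorm_sq_ofReal, hΦ]
    simp only
    rw [norm_smul, mul_pow, Real.norm_eq_abs, sq_abs, Nf]
  have mΦ : Measurable (Φ t0) := by
    have b1 := (F.mem t0).1.2.1.continuous.measurable
    have b2 := (cont_deriv (F.mem t0).1.2.1).measurable
    exact meas_Psi ((b1.comp measurable_snd).sub (b1.comp measurable_fst)) (b2.comp measurable_fst)
      (b2.comp measurable_snd)
  have key := mink mu2 Φ Φ' (meas_Psid (a2.sub a1) a3 a4 (a6.sub a5) a7 a8)
    (by
      filter_upwards [mu2_ae] with z hz t ht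
      exact hasD_Psi ((F.dΓ t ht z.2).sub (F.dΓ t ht z.1)) (F.dΓ' t ht z.1) (F.dΓ' t ht z.2) (ne t z hz)
        ((F.mem t).2.2 _) ((F.mem t).2.2 _))
    (by
      filter_upwards [mu2_ae] with z hz
      exact cont_Psid ((cc F.cΓ z.2).sub (cc F.cΓ z.1)).continuousOn (cc F.cΓ' z.1).continuousOn
        (cc F.cΓ' z.2).continuousOn ((cc F.cV z.2).sub (cc F.cV z.1)).continuousOn
        (cc F.cV' z.1).continuousOn (cc F.cV' z.2).continuousOn (fun t _ => ne t z hz)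
        (fun t _ => (F.mem t).2.2 _) (fun t _ => (F.mem t).2.2 _))
    (spd s Γ V) (spd_nonneg s Γ V) F.spd_meas (F.spd_int hs) (C := 9) (by norm_num)
    (by
      intro t ht
      rw [ENNReal.ofReal_mul (by norm_num), ← F.GE_spd hs ht]
      obtain ⟨k1, k2, k3⟩ := mB_fix (F.mem t).1.2.1 (F.memV t).2.1 s
      have mg : Measurable (fun z : ℝ × ℝ => gI s (Γ t) (V t) z.1 z.2) := by
        unfold gI; fun_prop
      calc _ ≤ ∫⁻ z, ENNReal.ofReal 9 * ENNReal.ofReal (gI s (Γ t) (V t) z.1 z.2) ∂mu2 := by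
            refine lintegral_mono_ae ?_
            filter_upwards [mu2_ae] with z hz
            rw [enorm_sq_ofReal, ← ENNReal.ofReal_mul (by norm_num), gI_kf _ _ _ _ _ (ne t z hz)]
            exact ENNReal.ofReal_le_ofReal (Psid_le hs hs2 _ _ _ _ _ _ (ne t z hz)
              ((F.mem t).2.2 _) ((F.mem t).2.2 _))
        _ = ENNReal.ofReal 9 * ∫⁻ x in I01, ∫⁻ y in I01, ENNReal.ofReal (gI s (Γ t) (V t) x y) := by
            rw [lintegral_const_mul' _ _ ENNReal.ofReal_ne_top,
              lint_mu2 (f := fun x y => ENNReal.ofReal (gI s (Γ t) (V t) x y)) mg.ennreal_ofReal]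
        _ ≤ _ := by
            refine mul_le_mul' le_rfl ?_
            unfold GE
            rw [add_assoc]; exact le_self_add) h0 h1
  rw [E t1, E t0]
  refine (lint_sq_add mΦ).trans (add_le_add le_rfl ?_)
  refine (mul_le_mul' le_rfl key).trans (le_of_eq ?_)
  rw [show (2:ℝ≥0∞) = ENNReal.ofReal 2 by simp, ← ENNReal.ofReal_mul (by norm_num)]
  congr 1; ring
end
end

section
section
lemma gag_dom {E F G : Type*} [NormedAddCommGroup E] [NormedAddCommGroup F] [NormedAddCommGroup G]
    [MeasurableSpace E] [BorelSpace E] [SecondCountableTopology E] {f : ℝ → E} {g : ℝ → F} {h : ℝ → G}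
    (hf : Continuous f) (σ : ℝ) {A B : ℝ} (hA : 0 ≤ A) (hB : 0 ≤ B)
    (H : ∀ x y, ‖h y - h x‖ ^ 2 ≤ A * ‖f y - f x‖ ^ 2 + B * ‖g y - g x‖ ^ 2) :
    gagliardoSqE σ h ≤ ENNReal.ofReal A * gagliardoSqE σ f + ENNReal.ofReal B * gagliardoSqE σ g := by
  have mf := meas_gag hf σ
  unfold gagliardoSqE
  rw [← lintegral_const_mul' _ _ ENNReal.ofReal_ne_top, ← lintegral_const_mul' _ _ ENNReal.ofReal_ne_top,
    ← lintegral_add_left (by exact (Measurable.lintegral_prod_right' mf).const_mul _)]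
  refine lintegral_mono fun x => ?_
  have mx := mf.comp (measurable_prodMk_left (x := x))
  simp only [Function.comp_def] at mx
  rw [← lintegral_const_mul' _ _ ENNReal.ofReal_ne_top, ← lintegral_const_mul' _ _ ENNReal.ofReal_ne_top,
    ← lintegral_add_left (by exact mx.const_mul _)]
  refine lintegral_mono fun y => ?_
  have := dT_nonneg x y
  rw [← ENNReal.ofReal_mul hA, ← ENNReal.ofReal_mul hB, ← ENNReal.ofReal_add (by positivity) (by positivity)]
  apply ENNReal.ofReal_le_ofReal
  rw [← mul_div_assoc, ← mul_div_assoc, ← add_div]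
  exact div_le_div_of_nonneg_right (H x y) (by positivity)

lemma gag_dom_le {E F G : Type*} [NormedAddCommGroup E] [NormedAddCommGroup F] [NormedAddCommGroup G]
    [MeasurableSpace E] [BorelSpace E] [SecondCountableTopology E] {f : ℝ → E} {g : ℝ → F} {h : ℝ → G}
    (hf : Continuous f) (σ : ℝ) {A B a b : ℝ} (hA : 0 ≤ A) (hB : 0 ≤ B) (ha : 0 ≤ a) (hb : 0 ≤ b)
    (H : ∀ x y, ‖h y - h x‖ ^ 2 ≤ A * ‖f y - f x‖ ^ 2 + B * ‖g y - g x‖ ^ 2)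
    (h1 : gagliardoSqE σ f ≤ ENNReal.ofReal a) (h2 : gagliardoSqE σ g ≤ ENNReal.ofReal b) :
    gagliardoSqE σ h ≤ ENNReal.ofReal (A * a + B * b) := by
  rw [ENNReal.ofReal_add (by positivity) (by positivity), ENNReal.ofReal_mul hA, ENNReal.ofReal_mul hB]
  exact (gag_dom hf σ hA hB H).trans (add_le_add (mul_le_mul' le_rfl h1) (mul_le_mul' le_rfl h2))

lemma gag_mu2 {E : Type*} [NormedAddCommGroup E] [NormedSpace ℝ E]
    [MeasurableSpace E] [BorelSpace E] [SecondCountableTopology E] {f : ℝ → E} (hf : Continuous f) (σ : ℝ) :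
    gagliardoSqE σ f = ∫⁻ z, ‖√((dT z.1 z.2 ^ (2 * σ + 1))⁻¹) • (f z.2 - f z.1)‖ₑ ^ 2 ∂mu2 := by
  rw [gagliardoSqE, lint_mu2 (f := fun x y => ENNReal.ofReal (‖f y - f x‖ ^ 2 / dT x y ^ (2 * σ + 1)))
    (meas_gag hf σ)]
  refine lintegral_congr fun z => ?_
  have := dT_nonneg z.1 z.2
  rw [enorm_sq_ofReal, norm_smul, mul_pow, Real.norm_eq_abs, sq_abs, Real.sq_sqrt (by positivity)]
  congr 1; ring

lemma gag_mink {E : Type*} [NormedAddCommGroup E] [NormedSpace ℝ E] [CompleteSpace E]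
    [MeasurableSpace E] [BorelSpace E] [SecondCountableTopology E] {f f' : ℝ → ℝ → E} (σ : ℝ)
    (hf : Continuous fun z : ℝ × ℝ => f z.1 z.2) (hf' : Continuous fun z : ℝ × ℝ => f' z.1 z.2)
    (hd : ∀ t ∈ Icc (0:ℝ) 1, ∀ x, HasDerivWithinAt (fun t => f t x) (f' t x) (Icc 0 1) t)
    {g : ℝ → ℝ} (hg0 : ∀ t, 0 ≤ g t) (hgm : Measurable g) (hgi : IntervalIntegrable g volume 0 1)
    {C : ℝ} (hC : 0 ≤ C) (hk : ∀ t ∈ Icc (0:ℝ) 1, gagliardoSqE σ (f' t) ≤ ENNReal.ofReal (C * g t ^ 2))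
    {t0 t1 : ℝ} (h0 : t0 ∈ Icc (0:ℝ) 1) (h1 : t1 ∈ Icc (0:ℝ) 1) :
    gagliardoSqE σ (fun x => f t1 x - f t0 x) ≤ ENNReal.ofReal (C * (∫ t in (0:ℝ)..1, g t) ^ 2) := by
  have c1 : ∀ t, Continuous (f t) := fun t => hf.comp (by fun_prop : Continuous fun x : ℝ => (t, x))
  have c1' : ∀ t, Continuous (f' t) := fun t => hf'.comp (by fun_prop : Continuous fun x : ℝ => (t, x))
  have c2 : ∀ x, Continuous fun t => f' t x := fun x => hf'.comp (by fun_prop : Continuous fun t : ℝ => (t, x))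
  have p1 : Measurable (fun z : ℝ × ℝ × ℝ => (z.1, z.2.1)) := by fun_prop
  have p2 : Measurable (fun z : ℝ × ℝ × ℝ => (z.1, z.2.2)) := by fun_prop
  have md := meas_dT
  have mk : Measurable (fun z : ℝ × ℝ => √((dT z.1 z.2 ^ (2 * σ + 1))⁻¹)) :=
    ((md.pow_const _).inv).sqrt
  have key := mink mu2 (fun t z => √((dT z.1 z.2 ^ (2 * σ + 1))⁻¹) • (f t z.2 - f t z.1))
    (fun t z => √((dT z.1 z.2 ^ (2 * σ + 1))⁻¹) • (f' t z.2 - f' t z.1))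
    ((mk.comp measurable_snd).smul ((hf'.measurable.comp p2).sub (hf'.measurable.comp p1)))
    (Eventually.of_forall fun z t ht => ((hd t ht z.2).sub (hd t ht z.1)).const_smul _)
    (Eventually.of_forall fun z => (((c2 z.2).sub (c2 z.1)).const_smul _).continuousOn)
    g hg0 hgm hgi hC (fun t ht => by rw [← gag_mu2 (c1' t)]; exact hk t ht) h0 h1
  rw [gag_mu2 (f := fun x => f t1 x - f t0 x) ((c1 t1).sub (c1 t0))]
  refine le_trans (le_of_eq (lintegral_congr fun z => ?_)) key
  rw [← smul_sub]
  congr 3; abel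

lemma Hs_le {n : ℕ} {s : ℝ} {u : ℝ → En n} (hu : ContDiff ℝ 1 u) {A B C : ℝ} (hA : 0 ≤ A) (hB : 0 ≤ B)
    (hC : 0 ≤ C)
    (h1 : ∫⁻ x in I01, ‖u x‖ₑ ^ 2 ≤ ENNReal.ofReal A)
    (h2 : ∫⁻ x in I01, ‖deriv u x‖ₑ ^ 2 ≤ ENNReal.ofReal B)
    (h3 : gagliardoSqE (s - 1) (deriv u) ≤ ENNReal.ofReal C) : HsNormSq s u ≤ A + B + C := by
  unfold HsNormSq
  rw [sint (fun x => by positivity) (hu.continuous.measurable.norm.pow_const 2),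
    sint (fun x => by positivity) ((cont_deriv hu).measurable.norm.pow_const 2)]
  simp only [← enorm_sq_ofReal]
  exact add_le_add (add_le_add (ENNReal.toReal_le_of_le_ofReal hA h1) (ENNReal.toReal_le_of_le_ofReal hB h2))
    (ENNReal.toReal_le_of_le_ofReal hC h3)

structure Data {n : ℕ} (s : ℝ) (γ : ℝ → En n) (E l N : ℝ) : Prop where
  en : EtpE s γ ≤ ENNReal.ofReal E
  lw : ∀ x, l⁻¹ ≤ ‖deriv γ x‖ ∧ ‖deriv γ x‖ ≤ l
  gl : gagliardoSqE (s - 1) (fun x => Real.log ‖deriv γ x‖) ≤ ENNReal.ofReal N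

lemma log_lip {c p q : ℝ} (hc : 0 < c) (hp : c ≤ p) (hq : c ≤ q) : |Real.log p - Real.log q| ≤ c⁻¹ * |p - q| := by
  wlog h : q ≤ p generalizing p q
  · rw [abs_sub_comm, abs_sub_comm p]; exact this hq hp (le_of_not_ge h)
  have q0 := hc.trans_le hq
  have p0 := hc.trans_le hp
  rw [abs_of_nonneg (sub_nonneg.2 (Real.log_le_log q0 h)), abs_of_nonneg (sub_nonneg.2 h),
    ← Real.log_div p0.ne' q0.ne']
  have := Real.log_le_sub_one_of_pos (div_pos p0 q0)
  have e : p / q - 1 = q⁻¹ * (p - q) := by field_simp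
  rw [e] at this
  refine this.trans (mul_le_mul_of_nonneg_right (inv_anti₀ hc hq) (sub_nonneg.2 h))

lemma log_lip' {c p q : ℝ} (hp0 : 0 < p) (hq0 : 0 < q) (hp : p ≤ c) (hq : q ≤ c) :
    |p - q| ≤ c * |Real.log p - Real.log q| := by
  wlog h : q ≤ p generalizing p q
  · rw [abs_sub_comm, abs_sub_comm (Real.log p)]; exact this hq0 hp0 hq hp (le_of_not_ge h)
  rw [abs_of_nonneg (sub_nonneg.2 (Real.log_le_log hq0 h)), abs_of_nonneg (sub_nonneg.2 h),
    ← Real.log_div hp0.ne' hq0.ne']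
  have := Real.one_sub_inv_le_log_of_pos (div_pos hp0 hq0)
  rw [inv_div] at this
  calc p - q = p * (1 - q / p) := by field_simp
    _ ≤ p * Real.log (p / q) := mul_le_mul_of_nonneg_left this hp0.le
    _ ≤ c * Real.log (p / q) := mul_le_mul_of_nonneg_right hp
        (Real.log_nonneg (by rw [one_le_div hq0]; exact h))

lemma EtpE_le_GE {n : ℕ} {s : ℝ} (hs : 3/2 < s) (γ : ℝ → En n) : EtpE s γ ≤ GE s γ γ := by
  unfold GE EtpE
  refine le_trans ?_ (le_self_add.trans le_self_add)
  refine lintegral_mono fun x => lintegral_mono fun y => ENNReal.ofReal_le_ofReal ?_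
  change B1i s γ γ x y ≤ _
  unfold gI
  have := B1i_nonneg s γ γ x y
  have hb := B2i_nonneg s γ γ x y
  have := B3i_nonneg s γ γ x y
  have : 0 ≤ (2 * s + 1) * B2i s γ γ x y := mul_nonneg (by linarith) hb
  linarith

lemma InM.fam {n : ℕ} {s : ℝ} {γ : ℝ → En n} (h : InM s γ) : Fam s (fun _ => γ) (fun _ => γ) where
  mem _ := h
  memV _ := h.1
  cΓ := h.1.2.1.continuous.comp continuous_snd
  cΓ' := (cont_deriv h.1.2.1).comp continuous_snd
  cV := h.1.2.1.continuous.comp continuous_snd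
  cV' := (cont_deriv h.1.2.1).comp continuous_snd
  bdd := ⟨HsNormSq s γ, HsNormSq_nonneg _ _, fun _ _ => ⟨le_rfl, le_rfl⟩⟩

lemma InM.data {n : ℕ} {s : ℝ} (hs : 3/2 < s) {γ : ℝ → En n} (h : InM s γ) :
    ∃ E l N : ℝ, 0 ≤ E ∧ 0 < l ∧ 0 ≤ N ∧ Data s γ E l N := by
  obtain ⟨K, hK, hf⟩ := h.fam.fin hs
  have r := h.reg
  obtain ⟨c, hc, hc'⟩ := r.low
  obtain ⟨M, hM⟩ := per_bdd r.cd.norm (fun x => by rw [deriv_per r.per x])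
  have hMp : 0 < M := (r.wpos 0).trans_le (hM 0)
  refine ⟨K, max M c⁻¹, (c⁻¹) ^ 2 * HsNormSq s γ + 0 * 0, hK, by positivity, ?_, ?_, ?_, ?_⟩
  · have := HsNormSq_nonneg s γ
    positivity
  · exact (EtpE_le_GE hs γ).trans (hf 0 (by simp))
  · intro x
    refine ⟨?_, (hM x).trans (le_max_left _ _)⟩
    refine le_trans ?_ (hc' x)
    rw [inv_le_comm₀ (by positivity) hc]; exact le_max_right _ _
  · refine gag_dom_le (g := fun _ : ℝ => (0:ℝ)) r.cd (s - 1) (by positivity) le_rfl (HsNormSq_nonneg _ _) le_rfl (fun x y => ?_)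
      (gag_le_Hs h.1) (by simp [gagliardoSqE])
    rw [zero_mul, add_zero, ← mul_pow, Real.norm_eq_abs]
    refine pow_le_pow_left₀ (abs_nonneg _) ((log_lip hc (hc' y) (hc' x)).trans ?_) 2
    exact mul_le_mul_of_nonneg_left (abs_norm_sub_norm_le _ _) (by positivity)
end
end

section
section
variable {n : ℕ} {s : ℝ}

lemma QE_le_GE (hs : 3/2 < s) (γ u : ℝ → En n) : QE s γ u ≤ GE s γ u := by
  unfold GE QE
  refine le_trans ?_ (le_self_add.trans le_self_add)
  refine lintegral_mono fun x => lintegral_mono fun y => ENNReal.ofReal_le_ofReal ?_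
  unfold gI qI
  have := B1i_nonneg s γ u x y
  have hb := B2i_nonneg s γ u x y
  have := B3i_nonneg s γ u x y
  have : 0 ≤ (2 * s + 1) * B2i s γ u x y := mul_nonneg (by linarith) hb
  linarith

lemma H1_le_GE (s : ℝ) (γ u : ℝ → En n) :
    ∫⁻ x in I01, ENNReal.ofReal (‖Dg γ u x‖ ^ 2 * ‖deriv γ x‖) ≤ GE s γ u := by
  unfold GE
  exact le_add_self.trans le_self_add

lemma L2_le_GE (s : ℝ) (γ u : ℝ → En n) :
    ∫⁻ x in I01, ENNReal.ofReal (‖u x‖ ^ 2 * ‖deriv γ x‖) ≤ GE s γ u := by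
  unfold GE
  exact le_add_self

def bf (Γ V : ℝ → ℝ → En n) (t x : ℝ) : ℝ := ⟪Dg (Γ t) (Γ t) x, Dg (Γ t) (V t) x⟫

variable {Γ V : ℝ → ℝ → En n}

lemma bf_eq (t x : ℝ) : bf Γ V t x = ⟪deriv (Γ t) x, deriv (V t) x⟫ / ‖deriv (Γ t) x‖ ^ 2 := by
  simp only [bf, Dg, real_inner_smul_left, real_inner_smul_right]
  rw [div_eq_inv_mul, sq, mul_inv]; ring

lemma Fam.cbf (F : Fam s Γ V) : Continuous fun z : ℝ × ℝ => bf Γ V z.1 z.2 := by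
  simp only [bf_eq]
  exact (F.cΓ'.inner F.cV').div (F.cΓ'.norm.pow 2)
    (fun z => pow_ne_zero _ (norm_ne_zero_iff.2 ((F.mem z.1).2.2 z.2)))

lemma Fam.clog (F : Fam s Γ V) : Continuous fun z : ℝ × ℝ => Real.log ‖deriv (Γ z.1) z.2‖ :=
  F.cΓ'.norm.log (fun z => norm_ne_zero_iff.2 ((F.mem z.1).2.2 z.2))

lemma RP.dlog (F : RP s Γ V) {t : ℝ} (ht : t ∈ Icc (0:ℝ) 1) (x : ℝ) :
    HasDerivWithinAt (fun t => Real.log ‖deriv (Γ t) x‖) (bf Γ V t x) (Icc 0 1) t := by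
  have h0 : ‖deriv (Γ t) x‖ ^ 2 ≠ 0 := pow_ne_zero _ (norm_ne_zero_iff.2 ((F.mem t).2.2 x))
  have h := ((F.dΓ' t ht x).norm_sq.log h0).const_mul (1/2)
  rw [bf_eq]
  have e1 : (fun t => Real.log ‖deriv (Γ t) x‖) = fun y => 1 / 2 * Real.log (‖deriv (Γ y) x‖ ^ 2) := by
    ext t; simp
  have e2 : ⟪deriv (Γ t) x, deriv (V t) x⟫ / ‖deriv (Γ t) x‖ ^ 2 =
      1 / 2 * (2 * ⟪deriv (Γ t) x, deriv (V t) x⟫ / ‖deriv (Γ t) x‖ ^ 2) := by ring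
  rw [e1, e2]
  exact h

lemma bf_abs (F : Fam s Γ V) (t x : ℝ) : |bf Γ V t x| ≤ ‖Dg (Γ t) (V t) x‖ := by
  have := abs_real_inner_le_norm (Dg (Γ t) (Γ t) x) (Dg (Γ t) (V t) x)
  rwa [norm_T _ ((F.mem t).2.2 x), one_mul] at this

lemma RP.log_pt (F : RP s Γ V) (hs : 3/2 < s) {C : ℝ} (hC : 0 ≤ C)
    (hk : ∀ t ∈ Icc (0:ℝ) 1, ∀ x, ‖Dg (Γ t) (V t) x‖ ^ 2 ≤ C * spd s Γ V t ^ 2)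
    {t0 t1 : ℝ} (h0 : t0 ∈ Icc (0:ℝ) 1) (h1 : t1 ∈ Icc (0:ℝ) 1) (x : ℝ) :
    |Real.log ‖deriv (Γ t1) x‖ - Real.log ‖deriv (Γ t0) x‖| ^ 2 ≤
      C * (∫ t in (0:ℝ)..1, spd s Γ V t) ^ 2 := by
  have key := mink (Measure.dirac x) (fun t x => Real.log ‖deriv (Γ t) x‖) (bf Γ V) F.cbf.measurable
    (Eventually.of_forall fun x t ht => F.dlog ht x)
    (Eventually.of_forall fun x => (F.cbf.comp (by fun_prop : Continuous fun t : ℝ => (t, x))).continuousOn)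
    (spd s Γ V) (spd_nonneg s Γ V) F.spd_meas (F.spd_int hs) hC (by
      intro t ht
      rw [lintegral_dirac, enorm_sq_ofReal, Real.norm_eq_abs]
      refine ENNReal.ofReal_le_ofReal (le_trans ?_ (hk t ht x))
      exact pow_le_pow_left₀ (abs_nonneg _) (bf_abs F.toFam t x) 2) h0 h1
  rw [lintegral_dirac, enorm_sq_ofReal, Real.norm_eq_abs, ENNReal.ofReal_le_ofReal_iff (by positivity)] at key
  exact key

lemma sup_spd (hs : 3/2 < s) {E : ℝ} (hE : 0 ≤ E) : ∃ C : ℝ, 0 < C ∧ ∀ (n : ℕ) (Γ V : ℝ → ℝ → En n),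
    Fam s Γ V → ∀ t ∈ Icc (0:ℝ) 1, EtpE s (Γ t) ≤ ENNReal.ofReal E →
    ∀ x, ‖Dg (Γ t) (V t) x‖ ^ 2 ≤ C * spd s Γ V t ^ 2 := by
  obtain ⟨C, hC, h⟩ := sup_lemma hs E hE
  refine ⟨C, hC, fun n Γ V F t ht he => ?_⟩
  exact h n (Γ t) (V t) (F.mem t).reg he (F.memV t).2.1 (F.memV t).1 _ (sq_nonneg _)
    ((QE_le_GE hs _ _).trans (F.GE_spd hs ht).le) ((H1_le_GE s _ _).trans (F.GE_spd hs ht).le)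

lemma gag_spd (hs : 3/2 < s) {E l C1 : ℝ} (hE : 0 ≤ E) (hl : 0 < l) (hC1 : 0 ≤ C1) : ∃ C : ℝ, 0 < C ∧
    ∀ (n : ℕ) (Γ V : ℝ → ℝ → En n), Fam s Γ V → ∀ t ∈ Icc (0:ℝ) 1, EtpE s (Γ t) ≤ ENNReal.ofReal E →
    (∀ x, l⁻¹ ≤ ‖deriv (Γ t) x‖ ∧ ‖deriv (Γ t) x‖ ≤ l) →
    (∀ x, ‖Dg (Γ t) (V t) x‖ ^ 2 ≤ C1 * spd s Γ V t ^ 2) →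
    gagliardoSqE (s - 1) (Dg (Γ t) (V t)) ≤ ENNReal.ofReal (C * spd s Γ V t ^ 2) ∧
    gagliardoSqE (s - 1) (Dg (Γ t) (Γ t)) ≤ ENNReal.ofReal C := by
  obtain ⟨C, hC, h⟩ := gag_lemma hs E l hE hl
  refine ⟨C * (1 + C1) + C * (3 * E + 1), by positivity, fun n Γ V F t ht he hw ha => ⟨?_, ?_⟩⟩
  · refine (h n (Γ t) (V t) (F.mem t).reg he (F.memV t).2.1 (F.memV t).1 hw ((1 + C1) * spd s Γ V t ^ 2)
      (by positivity) ?_ ?_).trans (ENNReal.ofReal_le_ofReal ?_)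
    · refine ((QE_le_GE hs _ _).trans (F.GE_spd hs ht).le).trans (ENNReal.ofReal_le_ofReal ?_)
      have := mul_nonneg hC1 (sq_nonneg (spd s Γ V t)); linarith
    · intro x
      have := ha x
      have := sq_nonneg (spd s Γ V t); linarith
    · have : 0 ≤ C * (3 * E + 1) * spd s Γ V t ^ 2 := by positivity
      linarith
  · refine (h n (Γ t) (Γ t) (F.mem t).reg he (F.mem t).1.2.1 (F.mem t).1.1 hw (3 * E + 1)
      (by positivity) ?_ ?_).trans (ENNReal.ofReal_le_ofReal ?_)
    · rw [QE_self (F.mem t).reg]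
      refine (mul_le_mul' le_rfl he).trans ?_
      rw [show (3:ℝ≥0∞) = ENNReal.ofReal 3 by simp, ← ENNReal.ofReal_mul (by norm_num)]
      exact ENNReal.ofReal_le_ofReal (by linarith)
    · intro x; rw [norm_T _ ((F.mem t).2.2 x)]; linarith
    · have : 0 ≤ C * (1 + C1) := by positivity
      linarith

lemma gag_bf (F : Fam s Γ V) {t A B C1 g : ℝ} (hA : 0 ≤ A) (hB : 0 ≤ B) (hC1 : 0 ≤ C1)
    (ha : ∀ x, ‖Dg (Γ t) (V t) x‖ ^ 2 ≤ C1 * g ^ 2)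
    (h1 : gagliardoSqE (s - 1) (Dg (Γ t) (V t)) ≤ ENNReal.ofReal (A * g ^ 2))
    (h2 : gagliardoSqE (s - 1) (Dg (Γ t) (Γ t)) ≤ ENNReal.ofReal B) :
    gagliardoSqE (s - 1) (bf Γ V t) ≤ ENNReal.ofReal ((2 * A + 2 * C1 * B) * g ^ 2) := by
  have := gag_dom_le (h := bf Γ V t) ((F.mem t).reg.cDg (F.memV t).2.1) (s - 1) (A := 2) (B := 2 * (C1 * g ^ 2))
    (by norm_num) (by positivity) (by positivity) hB ?_ h1 h2
  · refine this.trans (le_of_eq ?_); congr 1; ring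
  · intro x y
    have e : bf Γ V t y - bf Γ V t x = ⟪Dg (Γ t) (Γ t) y, Dg (Γ t) (V t) y - Dg (Γ t) (V t) x⟫ +
        ⟪Dg (Γ t) (Γ t) y - Dg (Γ t) (Γ t) x, Dg (Γ t) (V t) x⟫ := by
      simp only [bf, inner_sub_left, inner_sub_right]; ring
    have e1 := abs_real_inner_le_norm (Dg (Γ t) (Γ t) y) (Dg (Γ t) (V t) y - Dg (Γ t) (V t) x)
    have e2 := abs_real_inner_le_norm (Dg (Γ t) (Γ t) y - Dg (Γ t) (Γ t) x) (Dg (Γ t) (V t) x)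
    rw [norm_T _ ((F.mem t).2.2 y), one_mul] at e1
    have e3 := pow_le_pow_left₀ (abs_nonneg _) e1 2
    have e4 := pow_le_pow_left₀ (abs_nonneg _) e2 2
    rw [mul_pow] at e4
    have e5 := mul_le_mul_of_nonneg_left (ha x) (sq_nonneg ‖Dg (Γ t) (Γ t) y - Dg (Γ t) (Γ t) x‖)
    rw [sq_abs] at e3 e4
    rw [e, Real.norm_eq_abs, sq_abs]
    have := add_sq_le (a := ⟪Dg (Γ t) (Γ t) y, Dg (Γ t) (V t) y - Dg (Γ t) (V t) x⟫)
      (b := ⟪Dg (Γ t) (Γ t) y - Dg (Γ t) (Γ t) x, Dg (Γ t) (V t) x⟫)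
    linarith

lemma deriv_Dg {γ u : ℝ → En n} {x : ℝ} (h : deriv γ x ≠ 0) : deriv u x = ‖deriv γ x‖ • Dg γ u x := by
  rw [Dg, smul_inv_smul₀ (norm_ne_zero_iff.2 h)]

lemma gag_V (F : Fam s Γ V) {t A N l C1 g : ℝ} (hA : 0 ≤ A) (hN : 0 ≤ N) (hC1 : 0 ≤ C1) (hl : 0 < l)
    (hw : ∀ x, ‖deriv (Γ t) x‖ ≤ l)
    (ha : ∀ x, ‖Dg (Γ t) (V t) x‖ ^ 2 ≤ C1 * g ^ 2)
    (h1 : gagliardoSqE (s - 1) (Dg (Γ t) (V t)) ≤ ENNReal.ofReal (A * g ^ 2))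
    (h2 : gagliardoSqE (s - 1) (fun x => Real.log ‖deriv (Γ t) x‖) ≤ ENNReal.ofReal N) :
    gagliardoSqE (s - 1) (deriv (V t)) ≤ ENNReal.ofReal ((2 * l ^ 2 * A + 2 * C1 * l ^ 2 * N) * g ^ 2) := by
  have := gag_dom_le (h := deriv (V t)) ((F.mem t).reg.cDg (F.memV t).2.1) (s - 1) (A := 2 * l ^ 2)
    (B := 2 * (C1 * g ^ 2) * l ^ 2)
    (by positivity) (by positivity) (by positivity) hN ?_ h1 h2
  · refine this.trans (le_of_eq ?_); congr 1; ring
  · intro x y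
    have px := norm_pos_iff.2 ((F.mem t).2.2 x)
    have py := norm_pos_iff.2 ((F.mem t).2.2 y)
    have e : deriv (V t) y - deriv (V t) x = ‖deriv (Γ t) y‖ • (Dg (Γ t) (V t) y - Dg (Γ t) (V t) x) +
        (‖deriv (Γ t) y‖ - ‖deriv (Γ t) x‖) • Dg (Γ t) (V t) x := by
      rw [deriv_Dg (u := V t) ((F.mem t).2.2 x), deriv_Dg (u := V t) ((F.mem t).2.2 y), smul_sub, sub_smul]
      abel
    set a := Dg (Γ t) (V t) with ha'
    have n1 : ‖deriv (V t) y - deriv (V t) x‖ ≤ l * ‖a y - a x‖ +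
        l * |Real.log ‖deriv (Γ t) y‖ - Real.log ‖deriv (Γ t) x‖| * ‖a x‖ := by
      rw [e]
      refine (norm_add_le _ _).trans (add_le_add ?_ ?_)
      · rw [norm_smul, norm_norm]
        exact mul_le_mul_of_nonneg_right (hw y) (norm_nonneg _)
      · rw [norm_smul, Real.norm_eq_abs]
        exact mul_le_mul_of_nonneg_right (log_lip' py px (hw y) (hw x)) (norm_nonneg _)
    have n2 := pow_le_pow_left₀ (norm_nonneg _) n1 2
    have n3 := add_sq_le (a := l * ‖a y - a x‖)
      (b := l * |Real.log ‖deriv (Γ t) y‖ - Real.log ‖deriv (Γ t) x‖| * ‖a x‖)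
    simp only [Real.norm_eq_abs]
    set q := |Real.log ‖deriv (Γ t) y‖ - Real.log ‖deriv (Γ t) x‖|
    have n4 : (l * q * ‖a x‖) ^ 2 ≤ l ^ 2 * q ^ 2 * (C1 * g ^ 2) := by
      rw [mul_pow, mul_pow]
      exact mul_le_mul_of_nonneg_left (ha x) (by positivity)
    have n5 : (l * ‖a y - a x‖) ^ 2 = l ^ 2 * ‖a y - a x‖ ^ 2 := by ring
    linarith
end
end

section
section
set_option maxHeartbeats 400000 in
lemma path_est {s : ℝ} (hs : 3/2 < s) (hs2 : s < 2) {E0 l N R : ℝ} (hE0 : 0 ≤ E0) (hl : 0 < l) (hN : 0 ≤ N)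
    (hR : 0 ≤ R) : ∃ E1 l1 N1 K : ℝ, 0 ≤ E1 ∧ 0 < l1 ∧ 0 ≤ N1 ∧ 0 ≤ K ∧
    ∀ (n : ℕ) (Γ V : ℝ → ℝ → En n), RP s Γ V → ∀ t0 ∈ Icc (0:ℝ) 1, Data s (Γ t0) E0 l N →
    (∫ t in (0:ℝ)..1, spd s Γ V t) ≤ R → ∀ t1 ∈ Icc (0:ℝ) 1, Data s (Γ t1) E1 l1 N1 ∧
      HsNormSq s (fun x => Γ t1 x - Γ t0 x) ≤ K * (∫ t in (0:ℝ)..1, spd s Γ V t) ^ 2 := by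
  obtain ⟨E1, hE1⟩ : ∃ c : ℝ, c = 2 * E0 + 18 * R ^ 2 := ⟨_, rfl⟩
  have E1p : 0 ≤ E1 := by rw [hE1]; positivity
  obtain ⟨C1, hC1, H1⟩ := sup_spd (s := s) hs E1p
  obtain ⟨l1, hl1⟩ : ∃ c : ℝ, c = l * Real.exp (√C1 * R) := ⟨_, rfl⟩
  have l1p : 0 < l1 := by rw [hl1]; positivity
  obtain ⟨C2, hC2, H2⟩ := gag_spd (s := s) hs E1p l1p hC1.le
  obtain ⟨C3, hC3⟩ : ∃ c : ℝ, c = 2 * C2 + 2 * C1 * C2 := ⟨_, rfl⟩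
  have C3p : 0 ≤ C3 := by rw [hC3]; positivity
  obtain ⟨N1, hN1⟩ : ∃ c : ℝ, c = 2 * N + 2 * (C3 * R ^ 2) := ⟨_, rfl⟩
  have N1p : 0 ≤ N1 := by rw [hN1]; positivity
  obtain ⟨C4, hC4⟩ : ∃ c : ℝ, c = 2 * l1 ^ 2 * C2 + 2 * C1 * l1 ^ 2 * N1 := ⟨_, rfl⟩
  have C4p : 0 ≤ C4 := by rw [hC4]; positivity
  refine ⟨E1, l1, N1, l1 + l1 ^ 2 * C1 + C4, E1p, l1p, N1p, by positivity, ?_⟩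
  intro n Γ V F t0 h0 D hL t1 h1
  set L := ∫ t in (0:ℝ)..1, spd s Γ V t with hLd
  have L0 : 0 ≤ L := intervalIntegral.integral_nonneg zero_le_one fun t _ => spd_nonneg s Γ V t
  have LR : L ^ 2 ≤ R ^ 2 := pow_le_pow_left₀ L0 hL 2
  have en : ∀ t ∈ Icc (0:ℝ) 1, EtpE s (Γ t) ≤ ENNReal.ofReal E1 := fun t ht => by
    refine (F.energy hs hs2 h0 ht).trans ?_
    rw [hE1, ENNReal.ofReal_add (by positivity) (by positivity), ENNReal.ofReal_mul (q := E0) (by norm_num),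
      show ENNReal.ofReal 2 = 2 by simp]
    exact add_le_add (mul_le_mul' le_rfl D.en) (ENNReal.ofReal_le_ofReal (by linarith))
  have sup := fun t ht => H1 n Γ V F.toFam t ht (en t ht)
  have lw : ∀ t ∈ Icc (0:ℝ) 1, ∀ x, l1⁻¹ ≤ ‖deriv (Γ t) x‖ ∧ ‖deriv (Γ t) x‖ ≤ l1 := fun t ht x => by
    have a := F.log_pt hs hC1.le sup h0 ht x
    have p := norm_pos_iff.2 ((F.mem t).2.2 x)
    have p0 := norm_pos_iff.2 ((F.mem t0).2.2 x)
    have b : |Real.log ‖deriv (Γ t) x‖ - Real.log ‖deriv (Γ t0) x‖| ≤ √C1 * R := by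
      refine le_trans (le_trans (Real.le_sqrt_of_sq_le a) (le_of_eq ?_)) (mul_le_mul_of_nonneg_left hL (Real.sqrt_nonneg _))
      rw [Real.sqrt_mul hC1.le, Real.sqrt_sq L0]
    have b' := abs_le.1 b
    obtain ⟨w1, w2⟩ := D.lw x
    constructor
    · rw [hl1, mul_inv, ← Real.exp_neg, ← Real.exp_log p]
      calc l⁻¹ * Real.exp (-(√C1 * R)) ≤ ‖deriv (Γ t0) x‖ * Real.exp (-(√C1 * R)) :=
            mul_le_mul_of_nonneg_right w1 (Real.exp_nonneg _)
        _ = Real.exp (Real.log ‖deriv (Γ t0) x‖ + -(√C1 * R)) := by rw [Real.exp_add, Real.exp_log p0]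
        _ ≤ _ := Real.exp_le_exp.2 (by linarith [b'.1])
    · rw [hl1, ← Real.exp_log p]
      calc _ ≤ Real.exp (Real.log ‖deriv (Γ t0) x‖ + (√C1 * R)) := Real.exp_le_exp.2 (by linarith [b'.2])
        _ = ‖deriv (Γ t0) x‖ * Real.exp (√C1 * R) := by rw [Real.exp_add, Real.exp_log p0]
        _ ≤ _ := mul_le_mul_of_nonneg_right w2 (Real.exp_nonneg _)
  have gg := fun t ht => H2 n Γ V F.toFam t ht (en t ht) (lw t ht) (sup t ht)
  have gl : ∀ t ∈ Icc (0:ℝ) 1, gagliardoSqE (s - 1) (fun x => Real.log ‖deriv (Γ t) x‖) ≤ ENNReal.ofReal N1 := by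
    intro t ht
    have a := gag_mink (f := fun t x => Real.log ‖deriv (Γ t) x‖) (f' := bf Γ V) (g := spd s Γ V) (s - 1) F.clog F.cbf (fun t ht x => F.dlog ht x) (spd_nonneg s Γ V) F.spd_meas
      (F.spd_int hs) C3p (fun t ht => by
        rw [hC3]; exact gag_bf F.toFam hC2.le hC2.le hC1.le (sup t ht) (gg t ht).1 (gg t ht).2)
      h0 ht
    have c0 : Continuous (fun x => Real.log ‖deriv (Γ t0) x‖) :=
      (cont_deriv (F.mem t0).1.2.1).norm.log (fun x => norm_ne_zero_iff.2 ((F.mem t0).2.2 x))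
    have b := gag_add (f := fun x => Real.log ‖deriv (Γ t0) x‖)
      (g := fun x => Real.log ‖deriv (Γ t) x‖ - Real.log ‖deriv (Γ t0) x‖) c0 (s - 1)
    simp only [add_sub_cancel] at b
    refine b.trans ?_
    rw [hN1, ENNReal.ofReal_add (by positivity) (by positivity), ENNReal.ofReal_mul (q := N) (by norm_num),
      ENNReal.ofReal_mul (q := C3 * R ^ 2) (by norm_num), show ENNReal.ofReal 2 = 2 by simp]
    refine add_le_add (mul_le_mul' le_rfl D.gl) (mul_le_mul' le_rfl (a.trans (ENNReal.ofReal_le_ofReal ?_)))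
    exact mul_le_mul_of_nonneg_left LR C3p
  refine ⟨⟨en t1 h1, lw t1 h1, gl t1 h1⟩, ?_⟩
  have gV := fun t ht => gag_V F.toFam hC2.le N1p hC1.le l1p (fun x => (lw t ht x).2) (sup t ht) (gg t ht).1 (gl t ht)
  have cc : ∀ {f : ℝ × ℝ → En n}, Continuous f → ∀ x, ContinuousOn (fun t => f (t, x)) (Icc 0 1) :=
    fun hf x => (hf.comp (by fun_prop : Continuous fun t : ℝ => (t, x))).continuousOn
  have eD : ∀ x, deriv (fun x => Γ t1 x - Γ t0 x) x = deriv (Γ t1) x - deriv (Γ t0) x := fun x =>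
    (((F.mem t1).1.2.1.differentiable one_ne_zero x).hasDerivAt.sub
        ((F.mem t0).1.2.1.differentiable one_ne_zero x).hasDerivAt).deriv
  have k1 := mink (volume.restrict I01) Γ V F.cV.measurable (Eventually.of_forall fun x t ht => F.dΓ t ht x)
    (Eventually.of_forall fun x => cc F.cV x) (spd s Γ V) (spd_nonneg s Γ V) F.spd_meas (F.spd_int hs) l1p.le
    (by
      intro t ht
      rw [ENNReal.ofReal_mul l1p.le, ← F.GE_spd hs ht]
      refine le_trans ?_ (mul_le_mul' le_rfl (L2_le_GE s _ _))
      rw [← lintegral_const_mul' _ _ ENNReal.ofReal_ne_top]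
      refine lintegral_mono fun x => ?_
      rw [enorm_sq_ofReal, ← ENNReal.ofReal_mul l1p.le]
      refine ENNReal.ofReal_le_ofReal ?_
      have h1 := (lw t ht x).1
      have : 1 ≤ l1 * ‖deriv (Γ t) x‖ := by
        rw [inv_le_iff_one_le_mul₀ l1p] at h1; linarith
      nlinarith [mul_le_mul_of_nonneg_left this (sq_nonneg ‖V t x‖)]) h0 h1
  have k2 := mink (volume.restrict I01) (fun t => deriv (Γ t)) (fun t => deriv (V t)) F.cV'.measurable
    (Eventually.of_forall fun x t ht => F.dΓ' t ht x)
    (Eventually.of_forall fun x => cc F.cV' x) (spd s Γ V) (spd_nonneg s Γ V) F.spd_meas (F.spd_int hs)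
    (C := l1 ^ 2 * C1) (by positivity)
    (by
      intro t ht
      calc _ ≤ ∫⁻ x in I01, ENNReal.ofReal (l1 ^ 2 * C1 * spd s Γ V t ^ 2) := by
            refine lintegral_mono fun x => ?_
            rw [enorm_sq_ofReal]
            refine ENNReal.ofReal_le_ofReal ?_
            rw [deriv_Dg (u := V t) ((F.mem t).2.2 x), norm_smul, mul_pow, norm_norm, mul_assoc]
            exact mul_le_mul (pow_le_pow_left₀ (norm_nonneg _) (lw t ht x).2 2) (sup t ht x) (by positivity)
              (by positivity)
        _ = _ := by rw [lintegral_const]; simp) h0 h1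
  have k3 := gag_mink (f := fun t => deriv (Γ t)) (f' := fun t => deriv (V t)) (g := spd s Γ V) (s - 1) F.cΓ' F.cV' F.dΓ' (spd_nonneg s Γ V) F.spd_meas
      (F.spd_int hs) C4p (fun t ht => by rw [hC4]; exact gV t ht) h0 h1
  have := Hs_le (s := s) (u := fun x => Γ t1 x - Γ t0 x) ((F.mem t1).1.2.1.sub (F.mem t0).1.2.1)
    (A := l1 * L ^ 2) (B := l1 ^ 2 * C1 * L ^ 2) (C := C4 * L ^ 2) (by positivity) (by positivity) (by positivity)
    k1 (by simp only [eD]; exact k2) (by rw [funext eD]; exact k3)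
  linarith
end
end

section
section
variable {n : ℕ} {s : ℝ}

lemma pathLen_nonneg (P : C1Path s n) : 0 ≤ pathLen P :=
  intervalIntegral.integral_nonneg zero_le_one fun _ _ => Real.sqrt_nonneg _

lemma exists_path {γ₀ γ₁ : ℝ → En n} {r : ℝ} (h : geodDist s γ₀ γ₁ < ENNReal.ofReal r) :
    ∃ P : C1Path s n, (P.Γ 0 = γ₀ ∧ P.Γ 1 = γ₁) ∧ pathLen P < r := by
  unfold geodDist at h
  obtain ⟨P, h⟩ := iInf_lt_iff.1 h
  obtain ⟨e, h⟩ := iInf_lt_iff.1 h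
  exact ⟨P, e, (ENNReal.ofReal_lt_ofReal_iff'.1 h).1⟩

lemma path_est' (hs : 3/2 < s) (hs2 : s < 2) {E0 l N R : ℝ} (hE0 : 0 ≤ E0) (hl : 0 < l) (hN : 0 ≤ N)
    (hR : 0 ≤ R) : ∃ E1 l1 N1 K : ℝ, 0 ≤ E1 ∧ 0 < l1 ∧ 0 ≤ N1 ∧ 0 ≤ K ∧
    ∀ (P : C1Path s n), Data s (P.Γ 1) E0 l N → pathLen P ≤ R → Data s (P.Γ 0) E1 l1 N1 ∧
      HsNormSq s (fun x => P.Γ 0 x - P.Γ 1 x) ≤ K * pathLen P ^ 2 := by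
  obtain ⟨E1, l1, N1, K, a, b, c, d, h⟩ := path_est hs hs2 hE0 hl hN hR
  refine ⟨E1, l1, N1, K, a, b, c, d, fun P D hP => ?_⟩
  have z0 : (0:ℝ) ∈ Icc (0:ℝ) 1 := by simp
  have z1 : (1:ℝ) ∈ Icc (0:ℝ) 1 := by simp
  have := h n _ _ (P.rp hs) 1 z1 (by rw [cl_eq z1]; exact D) (by rw [← P.len_eq hs]; exact hP) 0 z0
  rw [← P.len_eq hs] at this
  simpa only [cl_eq z0, cl_eq z1] using this

lemma unif (hs : 3/2 < s) (hs2 : s < 2) {U : Set (ℝ → En n)} (hU : GBounded s U) :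
    ∃ E l N M : ℝ, 0 ≤ E ∧ 0 < l ∧ 0 ≤ N ∧ 0 ≤ M ∧ ∀ γ ∈ U, Data s γ E l N ∧ HsNormSq s γ ≤ M := by
  obtain ⟨hM, γ₀, hγ₀, R, hR⟩ := hU
  obtain ⟨E, l, N, hE, hl, hN, D⟩ := hγ₀.data hs
  obtain ⟨E1, l1, N1, K, a, b, c, d, h⟩ := path_est' (n := n) hs hs2 hE hl hN (R := max R 0 + 1) (by positivity)
  refine ⟨E1, l1, N1, 2 * (K * (max R 0 + 1) ^ 2) + 2 * HsNormSq s γ₀, a, b, c, ?_, fun γ hγ => ?_⟩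
  · have := HsNormSq_nonneg s γ₀; positivity
  have lt : geodDist s γ γ₀ < ENNReal.ofReal (max R 0 + 1) := by
    refine (hR γ hγ).trans_lt (ENNReal.ofReal_lt_ofReal_iff'.2 ⟨?_, by positivity⟩)
    linarith [le_max_left R 0]
  obtain ⟨P, ⟨rfl, rfl⟩, hP⟩ := exists_path lt
  obtain ⟨h1, h2⟩ := h P D hP.le
  refine ⟨h1, ?_⟩
  have h3 := HsNormSq_of_sub (hM _ hγ).1 hγ₀.1
  have h4 : K * pathLen P ^ 2 ≤ K * (max R 0 + 1) ^ 2 :=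
    mul_le_mul_of_nonneg_left (pow_le_pow_left₀ (pathLen_nonneg P) hP.le 2) d
  linarith

lemma HsNormSq_sub_le {u v : ℝ → En n} (hu : InHs s u) (hv : InHs s v) :
    HsNormSq s (fun x => u x - v x) ≤ 2 * HsNormSq s u + 2 * HsNormSq s v := by
  have a := HsNormSq_add hu (hv.smul (-1))
  rw [HsNormSq_smul hv] at a
  simpa [sub_eq_add_neg] using a

lemma part1 (hs : 3/2 < s) (hs2 : s < 2) {U : Set (ℝ → En n)} (hU : GBounded s U) :
    ∃ K : ℝ, 0 < K ∧ ∀ γ₀ ∈ U, ∀ γ₁ ∈ U, ENNReal.ofReal (HsNorm s (fun x => γ₁ x - γ₀ x)) ≤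
          ENNReal.ofReal K * geodDist s γ₁ γ₀ := by
  obtain ⟨E, l, N, M, hE, hl, hN, hM, h⟩ := unif hs hs2 hU
  obtain ⟨E1, l1, N1, K, a, b, c, d, H⟩ := path_est' (n := n) hs hs2 hE hl hN zero_le_one
  refine ⟨√K + √(4 * M) + 1, by positivity, fun γ₀ h0 γ₁ h1 => ?_⟩
  rw [mul_comm, ← ENNReal.div_le_iff_le_mul (Or.inl (by simp; positivity)) (Or.inl ENNReal.ofReal_ne_top)]
  unfold geodDist
  refine le_iInf₂ fun P e => ?_
  obtain ⟨rfl, rfl⟩ := e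
  rw [ENNReal.div_le_iff_le_mul (Or.inl (by simp; positivity)) (Or.inl ENNReal.ofReal_ne_top),
    ← ENNReal.ofReal_mul (pathLen_nonneg P)]
  apply ENNReal.ofReal_le_ofReal
  have L0 := pathLen_nonneg P
  have k0 := Real.sqrt_nonneg K
  have m0 := Real.sqrt_nonneg (4 * M)
  rcases le_total (pathLen P) 1 with hP | hP
  · have := (H P (h _ h0).1 hP).2
    have : HsNorm s (fun x => P.Γ 0 x - P.Γ 1 x) ≤ √K * pathLen P := by
      rw [HsNorm, ← Real.sqrt_sq L0, ← Real.sqrt_mul d]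
      exact Real.sqrt_le_sqrt this
    nlinarith
  · have : HsNorm s (fun x => P.Γ 0 x - P.Γ 1 x) ≤ √(4 * M) := by
      apply Real.sqrt_le_sqrt
      have := HsNormSq_sub_le (hU.1 _ h1).1 (hU.1 _ h0).1
      linarith [(h _ h0).2, (h _ h1).2]
    nlinarith

lemma InHs_zero (s : ℝ) : InHs s (fun _ : ℝ => (0 : En n)) :=
  ⟨fun _ => rfl, contDiff_const, by simp [gagliardoSqE]⟩

lemma HsNorm_zero (s : ℝ) : HsNorm s (fun _ : ℝ => (0 : En n)) = 0 := by
  simp [HsNorm, HsNormSq, gagliardoSqE]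

def constPath {γ : ℝ → En n} (h : InM s γ) : C1Path s n where
  Γ _ := γ
  V _ _ := 0
  mem _ _ := h
  memV _ _ := InHs_zero s
  isDeriv t _ := by simp only [sub_self, smul_zero, HsNorm_zero]; exact tendsto_const_nhds
  contV t _ := by simp only [sub_self, smul_zero, HsNorm_zero]; exact tendsto_const_nhds

lemma geodDist_self {γ : ℝ → En n} (h : InM s γ) : ∃ r : ℝ, 0 ≤ r ∧ geodDist s γ γ ≤ ENNReal.ofReal r :=
  ⟨pathLen (constPath h), pathLen_nonneg _, iInf₂_le (constPath h) ⟨rfl, rfl⟩⟩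

lemma part2 (hs : 3/2 < s) (hs2 : s < 2) (γ₀ γ₁ : ℝ → En n) (h0 : InM s γ₀) (h1 : InM s γ₁)
    (h : geodDist s γ₀ γ₁ = 0) : γ₀ = γ₁ := by
  obtain ⟨r, hr, hr'⟩ := geodDist_self h1
  have B : GBounded s ({γ₀, γ₁} : Set (ℝ → En n)) := by
    refine ⟨?_, γ₁, h1, r, ?_⟩
    · rintro γ (rfl | rfl) <;> assumption
    · rintro γ (rfl | rfl)
      · rw [h]; exact zero_le
      · exact hr'
  obtain ⟨K, hK, H⟩ := part1 hs hs2 B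
  have := H γ₁ (by simp) γ₀ (by simp)
  rw [h, mul_zero, nonpos_iff_eq_zero, ENNReal.ofReal_eq_zero] at this
  have z : HsNormSq s (fun x => γ₀ x - γ₁ x) = 0 := by
    have e := HsNorm_sq s (fun x => γ₀ x - γ₁ x)
    rw [← e, le_antisymm this (Real.sqrt_nonneg _)]; simp
  obtain ⟨C, hC, S⟩ := sobolev hs
  funext x
  have := (S n _ (h0.1.sub h1.1) x).1
  rw [z, mul_zero] at this
  have : ‖γ₀ x - γ₁ x‖ = 0 := by
    have := le_antisymm this (sq_nonneg _)
    exact pow_eq_zero_iff (two_ne_zero) |>.1 this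
  exact sub_eq_zero.1 (norm_eq_zero.1 this)

lemma part3 (hs : 3/2 < s) (hs2 : s < 2) (γk : ℕ → ℝ → En n) (γ : ℝ → En n) (hk : ∀ k, InM s (γk k))
    (h : InM s γ) (ht : Tendsto (fun k => geodDist s (γk k) γ) atTop (𝓝 0)) :
    Tendsto (fun k => HsNorm s (fun x => γk k x - γ x)) atTop (𝓝 0) := by
  obtain ⟨r, hr, hr'⟩ := geodDist_self h
  have B : GBounded s (insert γ {γ' | InM s γ' ∧ geodDist s γ' γ ≤ 1}) := by
    refine ⟨?_, γ, h, r + 1, ?_⟩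
    · rintro γ' (rfl | h')
      · exact h
      · exact h'.1
    · rintro γ' (rfl | h')
      · exact hr'.trans (ENNReal.ofReal_le_ofReal (by linarith))
      · refine h'.2.trans ?_
        rw [← ENNReal.ofReal_one]
        exact ENNReal.ofReal_le_ofReal (by linarith)
  obtain ⟨K, hK, H⟩ := part1 hs hs2 B
  have e1 : ∀ᶠ k in atTop, geodDist s (γk k) γ < 1 := ht.eventually (gt_mem_nhds one_pos)
  have l1 : Tendsto (fun k => ENNReal.ofReal K * geodDist s (γk k) γ) atTop (𝓝 0) := by
    have := ENNReal.Tendsto.const_mul (a := ENNReal.ofReal K) ht (Or.inr ENNReal.ofReal_ne_top)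
    simpa using this
  have l2 : Tendsto (fun k => ENNReal.ofReal (HsNorm s (fun x => γk k x - γ x))) atTop (𝓝 0) := by
    refine tendsto_of_tendsto_of_tendsto_of_le_of_le' tendsto_const_nhds l1
      (Eventually.of_forall fun _ => zero_le) ?_
    filter_upwards [e1] with k hk'
    exact H γ (by simp) (γk k) (Or.inr ⟨hk k, hk'.le⟩)
  have := (ENNReal.tendsto_toReal ENNReal.zero_ne_top).comp l2
  refine (this.congr fun k => ?_)
  exact ENNReal.toReal_ofReal (Real.sqrt_nonneg _)
end
end

/-- the geodesic distance dominates the `H^s` distance on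
`G`-bounded sets: on every `G`-bounded `U ⊆ 𝓜` there is `K > 0` with
`‖γ₁ − γ₀‖_{H^s} ≤ K · d_G(γ₁,γ₀)`; in particular `d_G` is definite, convergence in
`d_G` implies convergence in `H^s`, and every `G`-bounded set is bounded in `H^s`. -/
theorem statement13 (s : ℝ) (hs : s ∈ Set.Ioo (3 / 2 : ℝ) 2) (n : ℕ) (hn : 2 ≤ n) :
    (∀ U : Set (ℝ → En n), GBounded s U → ∃ K : ℝ, 0 < K ∧
      ∀ γ₀ ∈ U, ∀ γ₁ ∈ U,
        ENNReal.ofReal (HsNorm s (fun x => γ₁ x - γ₀ x)) ≤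
          ENNReal.ofReal K * geodDist s γ₁ γ₀) ∧
    (∀ γ₀ γ₁ : ℝ → En n, InM s γ₀ → InM s γ₁ → geodDist s γ₀ γ₁ = 0 → γ₀ = γ₁) ∧
    (∀ (γk : ℕ → ℝ → En n) (γ : ℝ → En n), (∀ k, InM s (γk k)) → InM s γ →
      Tendsto (fun k => geodDist s (γk k) γ) atTop (𝓝 0) →
      Tendsto (fun k => HsNorm s (fun x => γk k x - γ x)) atTop (𝓝 0)) ∧
    (∀ U : Set (ℝ → En n), GBounded s U → ∃ M : ℝ, ∀ γ ∈ U, HsNorm s γ ≤ M) := by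
  obtain ⟨hs1, hs2⟩ := hs
  refine ⟨fun U hU => part1 hs1 hs2 hU, fun γ₀ γ₁ => part2 hs1 hs2 γ₀ γ₁,
    fun γk γ => part3 hs1 hs2 γk γ, fun U hU => ?_⟩
  obtain ⟨E, l, N, M, _, _, _, _, h⟩ := unif hs1 hs2 hU
  exact ⟨√M, fun γ hγ => Real.sqrt_le_sqrt (h γ hγ).2⟩
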